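/- (Main Theorem) Every complete first-order theory with NSOP₂ has NSOP₁; equivalently, if T has SOP₁ then T has SOP₂. -/

import Mathlib

/- Common model-theoretic infrastructure for formalizing
   "NSOP₂ theories are NSOP₁" (arXiv:2206.08512).

   We work with a monster model `𝕄` of a complete theory: a sufficiently
   saturated and strongly homogeneous `L`-structure.  Tuples are functions
   `α → 𝕄`; sets of formulas with parameters are coded via `FmlP`. -/

open FirstOrder Language

universe u v w

namespace NSOP2Paper

/-- A first-order formula in free variables `α ⊕ Fin n` together with an
`n`-tuple of parameters from `𝕄`. -/
abbrev FmlP (L : FirstOrder.Language.{u, u}) (𝕄 : Type u) (α : Type v) :=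
  Σ n : ℕ, L.Formula (α ⊕ Fin n) × (Fin n → 𝕄)

/-- `a ≡_C b` : the tuples `a` and `b` satisfy the same formulas with
parameters from `C`. -/
def EqTpOver (L : FirstOrder.Language.{u, u}) {𝕄 : Type u} [L.Structure 𝕄] (C : Set 𝕄)
    {α : Type v} (a b : α → 𝕄) : Prop :=
  ∀ (n : ℕ) (φ : L.Formula (α ⊕ Fin n)) (c : Fin n → 𝕄), (∀ i, c i ∈ C) →
    (φ.Realize (Sum.elim a c) ↔ φ.Realize (Sum.elim b c))

/-- `tp(a / C)` is finitely satisfiable in `Ms`: every formula over `C`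
satisfied by `a` has a realization by a tuple from `Ms`. -/
def FinSatIn (L : FirstOrder.Language.{u, u}) {𝕄 : Type u} [L.Structure 𝕄] (Ms : Set 𝕄)
    {α : Type v} (a : α → 𝕄) (C : Set 𝕄) : Prop :=
  ∀ (n : ℕ) (φ : L.Formula (α ⊕ Fin n)) (c : Fin n → 𝕄), (∀ i, c i ∈ C) →
    φ.Realize (Sum.elim a c) →
    ∃ m : α → 𝕄, (∀ i, m i ∈ Ms) ∧ φ.Realize (Sum.elim m c)

/-- `Ms` is the underlying set of a (small) elementary submodel of `𝕄`. -/
def IsElemSubmodel (L : FirstOrder.Language.{u, u}) {𝕄 : Type u} [L.Structure 𝕄] (Ms : Set 𝕄) : Prop :=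
  ∃ S : L.ElementarySubstructure 𝕄, (S : Set 𝕄) = Ms

/-- A complete consistent global type (a complete type over the monster `𝕄`)
in variables `α`, coded as the set of formulas-with-parameters it contains. -/
structure GlobalType (L : FirstOrder.Language.{u, u}) (𝕄 : Type u) [L.Structure 𝕄] (α : Type v) where
  carrier : Set (FmlP L 𝕄 α)
  consistent : ∀ t : Finset (FmlP L 𝕄 α), ↑t ⊆ carrier →
    ∃ a : α → 𝕄, ∀ p ∈ t, p.2.1.Realize (Sum.elim a p.2.2)
  complete : ∀ (n : ℕ) (φ : L.Formula (α ⊕ Fin n)) (c : Fin n → 𝕄),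
    (⟨n, (φ, c)⟩ : FmlP L 𝕄 α) ∈ carrier ∨ (⟨n, (φ.not, c)⟩ : FmlP L 𝕄 α) ∈ carrier

variable {L : FirstOrder.Language.{u, u}} {𝕄 : Type u} [L.Structure 𝕄]

/-- The global type `q` is finitely satisfiable in `Ms` (i.e. it is a coheir of
its restriction to `Ms`). -/
def GlobalType.FinSatInM {α : Type v} (q : GlobalType L 𝕄 α) (Ms : Set 𝕄) : Prop :=
  ∀ t : Finset (FmlP L 𝕄 α), ↑t ⊆ q.carrier →
    ∃ m : α → 𝕄, (∀ i, m i ∈ Ms) ∧ ∀ p ∈ t, p.2.1.Realize (Sum.elim m p.2.2)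

/-- `a ⊨ q|_C` : the tuple `a` realizes the restriction of the global type `q`
to parameters from `C`. -/
def RealizesType {α : Type v} (q : GlobalType L 𝕄 α) (a : α → 𝕄) (C : Set 𝕄) : Prop :=
  ∀ (n : ℕ) (φ : L.Formula (α ⊕ Fin n)) (c : Fin n → 𝕄), (∀ i, c i ∈ C) →
    (⟨n, (φ, c)⟩ : FmlP L 𝕄 α) ∈ q.carrier → φ.Realize (Sum.elim a c)

/-- The global type `q` extends `tp(a / C)`. -/
def ExtendsTpOver {α : Type v} (q : GlobalType L 𝕄 α) (C : Set 𝕄) (a : α → 𝕄) : Prop :=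
  ∀ (n : ℕ) (φ : L.Formula (α ⊕ Fin n)) (c : Fin n → 𝕄), (∀ i, c i ∈ C) →
    φ.Realize (Sum.elim a c) → (⟨n, (φ, c)⟩ : FmlP L 𝕄 α) ∈ q.carrier

/-- `B` is a coheir Morley sequence over `Ms` in the global type `q`:
`q` is finitely satisfiable in `Ms` and `B i ⊨ q|_(Ms ∪ B_{<i})`. -/
def MorleyIn {α : Type v} (q : GlobalType L 𝕄 α) (Ms : Set 𝕄) (B : ℕ → α → 𝕄) : Prop :=
  q.FinSatInM Ms ∧
    ∀ i : ℕ, RealizesType q (B i) (Ms ∪ ⋃ (j : ℕ) (_ : j < i), Set.range (B j))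

/-- `B` is a coheir Morley sequence over `Ms`. -/
def CoheirMorley (L : FirstOrder.Language.{u, u}) {𝕄 : Type u} [L.Structure 𝕄] (Ms : Set 𝕄)
    {α : Type v} (B : ℕ → α → 𝕄) : Prop :=
  ∃ q : GlobalType L 𝕄 α, MorleyIn q Ms B

/-- Flatten an `ℕ`-indexed sequence of `α`-tuples into a single tuple. -/
def flatSeq {α : Type v} (I : ℕ → α → 𝕄) : ℕ × α → 𝕄 := fun p => I p.1 p.2

/-- The sequence `I` is indiscernible over `C`. -/
def IndiscernibleOver (L : FirstOrder.Language.{u, u}) {𝕄 : Type u} [L.Structure 𝕄] (C : Set 𝕄)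
    {α : Type v} (I : ℕ → α → 𝕄) : Prop :=
  ∀ (n : ℕ) (f g : Fin n → ℕ), StrictMono f → StrictMono g →
    EqTpOver L C (fun p : Fin n × α => I (f p.1) p.2) (fun p : Fin n × α => I (g p.1) p.2)

/-- `𝕄` is `κ`-saturated: every finitely satisfiable set of formulas in fewer
than `κ` variables over a parameter set of size `< κ` is realized in `𝕄`. -/
def IsSaturated (L : FirstOrder.Language.{u, u}) (𝕄 : Type u) [L.Structure 𝕄] (κ : Cardinal.{u}) : Prop :=
  ∀ (α : Type u) (A : Set 𝕄), Cardinal.mk α < κ → Cardinal.mk A < κ →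
    ∀ Γ : Set (FmlP L 𝕄 α), (∀ p ∈ Γ, ∀ i, p.2.2 i ∈ A) →
      (∀ t : Finset (FmlP L 𝕄 α), ↑t ⊆ Γ →
        ∃ a : α → 𝕄, ∀ p ∈ t, p.2.1.Realize (Sum.elim a p.2.2)) →
      ∃ a : α → 𝕄, ∀ p ∈ Γ, p.2.1.Realize (Sum.elim a p.2.2)

/-- `𝕄` is strongly `κ`-homogeneous: partial elementary maps between tuples of
length `< κ` extend to automorphisms of `𝕄`. -/
def IsStronglyHomogeneous (L : FirstOrder.Language.{u, u}) (𝕄 : Type u) [L.Structure 𝕄]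
    (κ : Cardinal.{u}) : Prop :=
  ∀ (α : Type u), Cardinal.mk α < κ → ∀ a b : α → 𝕄, EqTpOver L (∅ : Set 𝕄) a b →
    ∃ σ : 𝕄 ≃[L] 𝕄, ∀ i, σ (a i) = b i

/-- `𝕄` is a monster model (for smallness degree `κ`): sufficiently saturated
and strongly homogeneous. -/
def IsMonster (L : FirstOrder.Language.{u, u}) (𝕄 : Type u) [L.Structure 𝕄] (κ : Cardinal.{u}) : Prop :=
  Cardinal.aleph0 < κ ∧ IsSaturated L 𝕄 κ ∧ IsStronglyHomogeneous L 𝕄 κ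

/-! ### Tree combinatorics -/

/-- The meet (longest common prefix) of two finite sequences. -/
def meet {A : Type w} [DecidableEq A] : List A → List A → List A
  | a :: as, b :: bs => if a = b then a :: meet as bs else []
  | _, _ => []

/-- The meet of `η 0, …, η i`. -/
def combMeet {A : Type w} [DecidableEq A] {k : ℕ} (η : Fin k → List A) (i : Fin k) : List A :=
  (List.ofFn fun j : Fin i.val => η (Fin.castLE i.2.le j)).foldl meet (η i)

/-- `η 0, …, η (k-1)` is a descending comb: a lexicographically increasing
antichain such that the meet of `η 0, …, η (i+1)` is a proper initial segment
of the meet of `η 0, …, η i`. -/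
def DescendingComb {A : Type w} [DecidableEq A] [LT A] {k : ℕ} (η : Fin k → List A) : Prop :=
  (∀ i j : Fin k, i ≠ j → ¬ η i <+: η j) ∧
  (∀ i j : Fin k, i < j → List.Lex (· < ·) (η i) (η j)) ∧
  (∀ (i : ℕ) (h : i + 1 < k),
    combMeet η ⟨i + 1, h⟩ <+: combMeet η ⟨i, by omega⟩ ∧
    combMeet η ⟨i + 1, h⟩ ≠ combMeet η ⟨i, by omega⟩)

/-! ### Tree properties of theories (witnessed in the monster model) -/

/-- `T = Th(𝕄)` has `SOP₁`. -/
def HasSOP1 (L : FirstOrder.Language.{u, u}) (𝕄 : Type u) [L.Structure 𝕄] : Prop :=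
  ∃ (k m : ℕ) (φ : L.Formula (Fin k ⊕ Fin m)) (b : List Bool → Fin m → 𝕄),
    (∀ σ : ℕ → Bool, ∃ a : Fin k → 𝕄,
      ∀ n : ℕ, φ.Realize (Sum.elim a (b (List.ofFn fun i : Fin n => σ i)))) ∧
    ∀ η₁ η₂ : List Bool, (η₁ ++ [false]) <+: η₂ →
      ¬ ∃ a : Fin k → 𝕄, φ.Realize (Sum.elim a (b η₂)) ∧
        φ.Realize (Sum.elim a (b (η₁ ++ [true])))

/-- `T = Th(𝕄)` has `SOP₂`. -/
def HasSOP2 (L : FirstOrder.Language.{u, u}) (𝕄 : Type u) [L.Structure 𝕄] : Prop :=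
  ∃ (k m : ℕ) (φ : L.Formula (Fin k ⊕ Fin m)) (b : List Bool → Fin m → 𝕄),
    (∀ σ : ℕ → Bool, ∃ a : Fin k → 𝕄,
      ∀ n : ℕ, φ.Realize (Sum.elim a (b (List.ofFn fun i : Fin n => σ i)))) ∧
    ∀ η₁ η₂ : List Bool, ¬ η₁ <+: η₂ → ¬ η₂ <+: η₁ →
      ¬ ∃ a : Fin k → 𝕄, φ.Realize (Sum.elim a (b η₁)) ∧ φ.Realize (Sum.elim a (b η₂))

/-- `T = Th(𝕄)` has `k`-`DCTP₁`: paths are consistent but descending combs of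
size `k` are inconsistent. -/
def HasKDCTP1 (L : FirstOrder.Language.{u, u}) (𝕄 : Type u) [L.Structure 𝕄] (k : ℕ) : Prop :=
  ∃ (r m : ℕ) (φ : L.Formula (Fin r ⊕ Fin m)) (b : List ℕ → Fin m → 𝕄),
    (∀ σ : ℕ → ℕ, ∃ a : Fin r → 𝕄,
      ∀ n : ℕ, φ.Realize (Sum.elim a (b (List.ofFn fun i : Fin n => σ i)))) ∧
    ∀ η : Fin k → List ℕ, DescendingComb η →
      ¬ ∃ a : Fin r → 𝕄, ∀ i, φ.Realize (Sum.elim a (b (η i)))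

/-- `T = Th(𝕄)` has weak `k`-`TP₁`: paths are consistent but any `k` pairwise
incomparable nodes with common pairwise meet are inconsistent. -/
def HasWeakKTP1 (L : FirstOrder.Language.{u, u}) (𝕄 : Type u) [L.Structure 𝕄] (k : ℕ) : Prop :=
  ∃ (r m : ℕ) (φ : L.Formula (Fin r ⊕ Fin m)) (b : List ℕ → Fin m → 𝕄),
    (∀ σ : ℕ → ℕ, ∃ a : Fin r → 𝕄,
      ∀ n : ℕ, φ.Realize (Sum.elim a (b (List.ofFn fun i : Fin n => σ i)))) ∧
    ∀ η : Fin k → List ℕ,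
      (∀ i j, i ≠ j → ¬ η i <+: η j) →
      (∀ i j i' j' : Fin k, i ≠ j → i' ≠ j' → meet (η i) (η j) = meet (η i') (η j')) →
      ¬ ∃ a : Fin r → 𝕄, ∀ i, φ.Realize (Sum.elim a (b (η i)))

/-- `T = Th(𝕄)` has `k`-`DCTP₂`: paths are `k`-inconsistent but descending
combs are consistent. -/
def HasKDCTP2 (L : FirstOrder.Language.{u, u}) (𝕄 : Type u) [L.Structure 𝕄] (k : ℕ) : Prop :=
  ∃ (r m : ℕ) (φ : L.Formula (Fin r ⊕ Fin m)) (b : List Bool → Fin m → 𝕄),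
    (∀ σ : ℕ → Bool, ∀ s : Finset ℕ, s.card = k →
      ¬ ∃ a : Fin r → 𝕄, ∀ n ∈ s,
        φ.Realize (Sum.elim a (b (List.ofFn fun i : Fin n => σ i)))) ∧
    ∀ (l : ℕ) (η : Fin l → List Bool), DescendingComb η →
      ∃ a : Fin r → 𝕄, ∀ i, φ.Realize (Sum.elim a (b (η i)))

/-! ### Kim-dividing and Conant-dividing, with respect to coheir Morley sequences -/

/-- `φ(x, b)` Kim-divides over `Ms`: some coheir Morley sequence over `Ms`
starting with `b` makes it inconsistent. -/
def KimDivides (L : FirstOrder.Language.{u, u}) {𝕄 : Type u} [L.Structure 𝕄] (Ms : Set 𝕄)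
    {α : Type v} {n : ℕ} (φ : L.Formula (α ⊕ Fin n)) (b : Fin n → 𝕄) : Prop :=
  ∃ B : ℕ → Fin n → 𝕄, CoheirMorley L Ms B ∧ B 0 = b ∧
    ¬ ∃ a : α → 𝕄, ∀ i, φ.Realize (Sum.elim a (B i))

/-- `φ(x, b)` Kim-forks over `Ms`: it implies a finite disjunction of formulas
Kim-dividing over `Ms`. -/
def KimForks (L : FirstOrder.Language.{u, u}) {𝕄 : Type u} [L.Structure 𝕄] (Ms : Set 𝕄)
    {α : Type v} {n : ℕ} (φ : L.Formula (α ⊕ Fin n)) (b : Fin n → 𝕄) : Prop :=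
  ∃ (N : ℕ) (m : Fin N → ℕ) (ψ : ∀ j : Fin N, L.Formula (α ⊕ Fin (m j)))
    (c : ∀ j : Fin N, Fin (m j) → 𝕄),
    (∀ j, KimDivides L Ms (ψ j) (c j)) ∧
    ∀ a : α → 𝕄, φ.Realize (Sum.elim a b) → ∃ j, (ψ j).Realize (Sum.elim a (c j))

/-- `φ(x, b)` Conant-divides over `Ms`: every coheir Morley sequence over `Ms`
starting with `b` makes it inconsistent. -/
def ConantDivides (L : FirstOrder.Language.{u, u}) {𝕄 : Type u} [L.Structure 𝕄] (Ms : Set 𝕄)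
    {α : Type v} {n : ℕ} (φ : L.Formula (α ⊕ Fin n)) (b : Fin n → 𝕄) : Prop :=
  ∀ B : ℕ → Fin n → 𝕄, CoheirMorley L Ms B → B 0 = b →
    ¬ ∃ a : α → 𝕄, ∀ i, φ.Realize (Sum.elim a (B i))

/-- `φ(x, b)` Conant-forks over `Ms`. -/
def ConantForks (L : FirstOrder.Language.{u, u}) {𝕄 : Type u} [L.Structure 𝕄] (Ms : Set 𝕄)
    {α : Type v} {n : ℕ} (φ : L.Formula (α ⊕ Fin n)) (b : Fin n → 𝕄) : Prop :=
  ∃ (N : ℕ) (m : Fin N → ℕ) (ψ : ∀ j : Fin N, L.Formula (α ⊕ Fin (m j)))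
    (c : ∀ j : Fin N, Fin (m j) → 𝕄),
    (∀ j, ConantDivides L Ms (ψ j) (c j)) ∧
    ∀ a : α → 𝕄, φ.Realize (Sum.elim a b) → ∃ j, (ψ j).Realize (Sum.elim a (c j))

/-- `a ⫝^{K*}_{Ms} b` : `tp(a/Ms b)` contains no formula Conant-forking
over `Ms`. -/
def ConantIndep (L : FirstOrder.Language.{u, u}) {𝕄 : Type u} [L.Structure 𝕄] (Ms : Set 𝕄)
    {α : Type v} {β : Type w} (a : α → 𝕄) (b : β → 𝕄) : Prop :=
  ∀ (n : ℕ) (φ : L.Formula (α ⊕ Fin n)) (d : Fin n → 𝕄),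
    (∀ i, d i ∈ Ms ∪ Set.range b) → φ.Realize (Sum.elim a d) →
    ¬ ConantForks L Ms φ d

/-! ### Abstract independence relations between sets over models -/

/-- An abstract ternary relation `A ⫝_M B` between subsets of `𝕄` over
(elementary submodels of) `𝕄`. -/
structure IndRel (L : FirstOrder.Language.{u, u}) (𝕄 : Type u) [L.Structure 𝕄] where
  rel : Set 𝕄 → Set 𝕄 → Set 𝕄 → Prop

/-- A set `S` of `α`-tuples is type-definable over `C`. -/
def TypeDefinableOver (L : FirstOrder.Language.{u, u}) {𝕄 : Type u} [L.Structure 𝕄] (C : Set 𝕄)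
    {γ : Type v} (S : Set (γ → 𝕄)) : Prop :=
  ∃ Γ : Set (FmlP L 𝕄 γ), (∀ p ∈ Γ, ∀ i, p.2.2 i ∈ C) ∧
    ∀ g : γ → 𝕄, g ∈ S ↔ ∀ p ∈ Γ, p.2.1.Realize (Sum.elim g p.2.2)

namespace IndRel


/-- Invariance under automorphisms of `𝕄`. -/
def Invariant (R : IndRel L 𝕄) : Prop :=
  ∀ (σ : 𝕄 ≃[L] 𝕄) (A Ms B : Set 𝕄), R.rel A Ms B →
    R.rel ((⇑σ) '' A) ((⇑σ) '' Ms) ((⇑σ) '' B)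

/-- Monotonicity (on both sides). -/
def Mono (R : IndRel L 𝕄) : Prop :=
  ∀ (A A' Ms B B' : Set 𝕄), IsElemSubmodel L Ms → R.rel A Ms B →
    Ms ⊆ A' → A' ⊆ A → Ms ⊆ B' → B' ⊆ B → R.rel A' Ms B'

/-- Existence: for `M ⊆ A, B` there is `A' ≡_M A` with `A' ⫝_M B`. -/
def Existence (R : IndRel L 𝕄) (κ : Cardinal.{u}) : Prop :=
  ∀ (Ms : Set 𝕄), IsElemSubmodel L Ms → Cardinal.mk Ms < κ →
    ∀ (α β : Type u), Cardinal.mk α < κ → Cardinal.mk β < κ →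
      ∀ (a : α → 𝕄) (b : β → 𝕄),
        ∃ a' : α → 𝕄, EqTpOver L Ms a' a ∧
          R.rel (Ms ∪ Set.range a') Ms (Ms ∪ Set.range b)

/-- Right extension. -/
def RightExt (R : IndRel L 𝕄) (κ : Cardinal.{u}) : Prop :=
  ∀ (Ms : Set 𝕄), IsElemSubmodel L Ms → Cardinal.mk Ms < κ →
    ∀ (α : Type u), Cardinal.mk α < κ → ∀ (a : α → 𝕄) (B C : Set 𝕄),
      Cardinal.mk B < κ → Cardinal.mk C < κ →
      R.rel (Set.range a) Ms B → B ⊆ C →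
      ∃ a' : α → 𝕄, EqTpOver L B a' a ∧ R.rel (Set.range a') Ms C

/-- Quasi-strong finite character: for complete types `p = tp(a₀/Ms)` and
`q = tp(b₀/Ms)`, the set of pairs of realizations `(a, b)` with `a ⫝_Ms b`
is type-definable over `Ms`. -/
def QSFC (R : IndRel L 𝕄) (κ : Cardinal.{u}) : Prop :=
  ∀ (Ms : Set 𝕄), IsElemSubmodel L Ms → Cardinal.mk Ms < κ →
    ∀ (α β : Type u), Cardinal.mk α < κ → Cardinal.mk β < κ →
      ∀ (a₀ : α → 𝕄) (b₀ : β → 𝕄),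
        TypeDefinableOver L Ms {g : (α ⊕ β) → 𝕄 |
          EqTpOver L Ms (g ∘ Sum.inl) a₀ ∧ EqTpOver L Ms (g ∘ Sum.inr) b₀ ∧
          R.rel (Set.range (g ∘ Sum.inl)) Ms (Set.range (g ∘ Sum.inr))}

/-- The coheir chain condition. -/
def CoheirChain (R : IndRel L 𝕄) (κ : Cardinal.{u}) : Prop :=
  ∀ (Ms : Set 𝕄), IsElemSubmodel L Ms → Cardinal.mk Ms < κ →
    ∀ (α β : Type u), Cardinal.mk α < κ → Cardinal.mk β < κ →
      ∀ (a : α → 𝕄) (b : β → 𝕄), R.rel (Set.range a) Ms (Set.range b) →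
        ∀ I : ℕ → β → 𝕄, CoheirMorley L Ms I → I 0 = b →
          ∃ I' : ℕ → β → 𝕄, EqTpOver L Ms (flatSeq I') (flatSeq I) ∧
            R.rel (Set.range a) Ms (⋃ i, Set.range (I' i)) ∧
            ∀ i, EqTpOver L (Ms ∪ Set.range a) (I' i) b

/-- `R` implies `⫝ʰ` : `A ⫝_M B` implies `tp(B / M A)` is finitely
satisfiable in `M`. -/
def StrongerThanH (R : IndRel L 𝕄) : Prop :=
  ∀ (A Ms B : Set 𝕄), IsElemSubmodel L Ms → R.rel A Ms B →
    FinSatIn L Ms (fun x : B => (x : 𝕄)) (Ms ∪ A)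

end IndRel

/-- The axioms satisfied by the relations among which `⫝^CK` is weakest. -/
def GoodRel (R : IndRel L 𝕄) (κ : Cardinal.{u}) : Prop :=
  R.StrongerThanH ∧ R.Invariant ∧ R.Mono ∧ R.Existence κ ∧ R.RightExt κ ∧ R.CoheirChain κ

/-- `R` is `⫝^CK` : the weakest relation implying `⫝ʰ` and satisfying
invariance, monotonicity, existence, right extension and the coheir chain
condition. -/
def IsCK (R : IndRel L 𝕄) (κ : Cardinal.{u}) : Prop :=
  GoodRel R κ ∧ ∀ R' : IndRel L 𝕄, GoodRel R' κ →
    ∀ A Ms B : Set 𝕄, R'.rel A Ms B → R.rel A Ms B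

/-- `q` is a canonical global type over `Ms` (w.r.t. the relation `R = ⫝^CK`):
whenever `c ⊨ q|_{Ms b}` we have `b ⫝^CK_{Ms} c`. -/
def IsCanonicalGlobal (R : IndRel L 𝕄) (κ : Cardinal.{u}) (Ms : Set 𝕄) {α : Type v}
    (q : GlobalType L 𝕄 α) : Prop :=
  ∀ (β : Type u), Cardinal.mk β < κ → ∀ (b : β → 𝕄) (c : α → 𝕄),
    RealizesType q c (Ms ∪ Set.range b) → R.rel (Set.range b) Ms (Set.range c)

/-- A canonical Morley sequence over `Ms`: a coheir Morley sequence in a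
canonical coheir. -/
def CanonicalMorley (R : IndRel L 𝕄) (κ : Cardinal.{u}) (Ms : Set 𝕄) {α : Type v}
    (I : ℕ → α → 𝕄) : Prop :=
  ∃ q : GlobalType L 𝕄 α, IsCanonicalGlobal R κ Ms q ∧ MorleyIn q Ms I

/-- `q` is a strong canonical global type over `Ms`. -/
def IsStrongCanonical (R : IndRel L 𝕄) (κ : Cardinal.{u}) (Ms : Set 𝕄) {α : Type v}
    (q : GlobalType L 𝕄 α) : Prop :=
  ∀ (β : Type u), Cardinal.mk β < κ → ∀ (b : β → 𝕄) (c : α → 𝕄),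
    RealizesType q c (Ms ∪ Set.range b) →
    ∀ (γ : Type u), Cardinal.mk γ < κ → ∀ (a : γ → 𝕄),
      ∃ a' : γ → 𝕄, EqTpOver L (Ms ∪ Set.range c) a' a ∧
        ∃ q' : GlobalType L 𝕄 (γ ⊕ α), IsCanonicalGlobal R κ Ms q' ∧
          ExtendsTpOver q' (Ms ∪ Set.range b) (Sum.elim a' c)

/-! ### `M`-invariant ideals and `𝓘`-Kim-dividing -/

/-- An `Ms`-invariant ideal on the definable subsets of `𝕄` (in variables `α`). -/
structure InvIdeal (L : FirstOrder.Language.{u, u}) (𝕄 : Type u) [L.Structure 𝕄] (Ms : Set 𝕄)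
    (α : Type v) where
  mem : Set (α → 𝕄) → Prop
  definable_of_mem : ∀ S, mem S → ∃ (n : ℕ) (ψ : L.Formula (α ⊕ Fin n)) (c : Fin n → 𝕄),
    S = {a : α → 𝕄 | ψ.Realize (Sum.elim a c)}
  union_mem : ∀ S T, mem S → mem T → mem (S ∪ T)
  subset_mem : ∀ S T, mem S →
    (∃ (n : ℕ) (ψ : L.Formula (α ⊕ Fin n)) (c : Fin n → 𝕄),
      T = {a : α → 𝕄 | ψ.Realize (Sum.elim a c)}) →
    T ⊆ S → mem T
  invariant : ∀ σ : 𝕄 ≃[L] 𝕄, (∀ x ∈ Ms, σ x = x) → ∀ S, mem S →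
    mem ((fun a => (⇑σ) ∘ a) '' S)

/-- `φ(x, b)` `𝓘`-Kim-divides over `Ms`. -/
def IKimDivides {Ms : Set 𝕄} {α : Type v} (I : InvIdeal L 𝕄 Ms α) {n : ℕ}
    (φ : L.Formula (α ⊕ Fin n)) (b : Fin n → 𝕄) : Prop :=
  ∃ (B : ℕ → Fin n → 𝕄) (k : ℕ), CoheirMorley L Ms B ∧ B 0 = b ∧ 0 < k ∧
    ∀ s : Finset ℕ, s.card = k →
      I.mem {a : α → 𝕄 | ∀ i ∈ s, φ.Realize (Sum.elim a (B i))}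

/-- `φ(x, b)` `𝓘`-Kim-forks over `Ms`. -/
def IKimForks {Ms : Set 𝕄} {α : Type v} (I : InvIdeal L 𝕄 Ms α) {n : ℕ}
    (φ : L.Formula (α ⊕ Fin n)) (b : Fin n → 𝕄) : Prop :=
  ∃ (N : ℕ) (m : Fin N → ℕ) (ψ : ∀ j : Fin N, L.Formula (α ⊕ Fin (m j)))
    (c : ∀ j : Fin N, Fin (m j) → 𝕄),
    (∀ j, IKimDivides I (ψ j) (c j)) ∧
    ∀ a : α → 𝕄, φ.Realize (Sum.elim a b) → ∃ j, (ψ j).Realize (Sum.elim a (c j))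

/-- `φ(x, b)` `𝓘`-quasi-divides over `Ms`. -/
def IQuasiDivides {Ms : Set 𝕄} {α : Type v} (I : InvIdeal L 𝕄 Ms α) {n : ℕ}
    (φ : L.Formula (α ⊕ Fin n)) (b : Fin n → 𝕄) : Prop :=
  ∃ (mm : ℕ) (b' : Fin mm → Fin n → 𝕄), 0 < mm ∧ (∀ j, EqTpOver L Ms (b' j) b) ∧
    I.mem {a : α → 𝕄 | ∀ j, φ.Realize (Sum.elim a (b' j))}

/-! ### `h^⫝`-inconsistency and the derived relation `⫝'` -/

/-- A family of formulas is `h^⫝`-inconsistent with respect to `P = tp(a₀/Ms)`. -/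
def HInconsistent (R : IndRel L 𝕄) (Ms : Set 𝕄) {α : Type v} (a₀ : α → 𝕄)
    {ι : Type w} (m : ι → ℕ) (φ : ∀ i : ι, L.Formula (α ⊕ Fin (m i)))
    (b : ∀ i : ι, Fin (m i) → 𝕄) : Prop :=
  ¬ ∃ a : α → 𝕄, EqTpOver L Ms a a₀ ∧
      R.rel (Set.range a) Ms (⋃ i, Set.range (b i)) ∧
      ∀ i, (φ i).Realize (Sum.elim a (b i))

/-- A single formula is `h^⫝`-inconsistent with respect to `P = tp(a₀/Ms)`. -/
def HInconsistentSingle (R : IndRel L 𝕄) (Ms : Set 𝕄) {α : Type v} (a₀ : α → 𝕄)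
    {n : ℕ} (φ : L.Formula (α ⊕ Fin n)) (b : Fin n → 𝕄) : Prop :=
  ¬ ∃ a : α → 𝕄, EqTpOver L Ms a a₀ ∧ R.rel (Set.range a) Ms (Set.range b) ∧
      φ.Realize (Sum.elim a b)

/-- `φ(x, b)` `h^⫝`-Kim-divides with respect to `tp(a₀/Ms)`. -/
def HKimDivides (R : IndRel L 𝕄) (Ms : Set 𝕄) {α : Type v} (a₀ : α → 𝕄)
    {n : ℕ} (φ : L.Formula (α ⊕ Fin n)) (b : Fin n → 𝕄) : Prop :=
  ∃ B : ℕ → Fin n → 𝕄, CoheirMorley L Ms B ∧ B 0 = b ∧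
    HInconsistent R Ms a₀ (fun _ : ℕ => n) (fun _ => φ) B

/-- `φ(x, b)` `h^⫝`-Kim-forks with respect to `tp(a₀/Ms)`. -/
def HKimForks (R : IndRel L 𝕄) (Ms : Set 𝕄) {α : Type v} (a₀ : α → 𝕄)
    {n : ℕ} (φ : L.Formula (α ⊕ Fin n)) (b : Fin n → 𝕄) : Prop :=
  ∃ (N : ℕ) (m : Fin N → ℕ) (ψ : ∀ j : Fin N, L.Formula (α ⊕ Fin (m j)))
    (c : ∀ j : Fin N, Fin (m j) → 𝕄),
    (∀ j, HKimDivides R Ms a₀ (ψ j) (c j)) ∧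
    ∀ a : α → 𝕄, φ.Realize (Sum.elim a b) → ∃ j, (ψ j).Realize (Sum.elim a (c j))

/-- `φ(x, b)` `h^⫝`-quasi-divides with respect to `tp(a₀/Ms)`. -/
def HQuasiDivides (R : IndRel L 𝕄) (Ms : Set 𝕄) {α : Type v} (a₀ : α → 𝕄)
    {n : ℕ} (φ : L.Formula (α ⊕ Fin n)) (b : Fin n → 𝕄) : Prop :=
  ∃ (mm : ℕ) (b' : Fin mm → Fin n → 𝕄), 0 < mm ∧ (∀ j, EqTpOver L Ms (b' j) b) ∧
    HInconsistent R Ms a₀ (fun _ : Fin mm => n) (fun _ => φ) b'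

/-- The derived relation `⫝'` on tuples:
`tp(a / Ms b)` contains no formula `h^⫝`-Kim-forking w.r.t. `tp(a/Ms)`. -/
def DerivedIndep (R : IndRel L 𝕄) (Ms : Set 𝕄) {α : Type v} {β : Type w}
    (a : α → 𝕄) (b : β → 𝕄) : Prop :=
  ∀ (n : ℕ) (φ : L.Formula (α ⊕ Fin n)) (d : Fin n → 𝕄),
    (∀ i, d i ∈ Ms ∪ Set.range b) → φ.Realize (Sum.elim a d) →
    ¬ HKimForks R Ms a φ d

/-- The derived relation `⫝'` as a relation between sets over models. -/
def derived (R : IndRel L 𝕄) : IndRel L 𝕄 where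
  rel A Ms B := ∀ (n : ℕ) (φ : L.Formula (↥A ⊕ Fin n)) (d : Fin n → 𝕄),
    (∀ i, d i ∈ Ms ∪ B) → φ.Realize (Sum.elim (fun x : A => (x : 𝕄)) d) →
    ¬ HKimForks R Ms (fun x : A => (x : 𝕄)) φ d

/-! ### Coheir trees -/

/-- The tuple, indexed by extensions, consisting of the part of the tree `c`
lying (weakly) above the node `ν` (where `ν` has length `Lh`). -/
def subtreeTupleLen {α : Type v} {n : ℕ} (c : {l : List ℕ // l.length ≤ n} → α → 𝕄)
    (Lh : ℕ) (ν : List ℕ) (hν : ν.length = Lh) :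
    ({s : List ℕ // Lh + s.length ≤ n} × α) → 𝕄 :=
  fun p => c ⟨ν ++ p.1.1, by rw [List.length_append, hν]; exact p.1.2⟩ p.2

end NSOP2Paper

namespace CanonicalCoheir

open Filter

section

/-- A family of definable sets of tuples (with parameters) from a first-order structure on `M`. -/
structure DefinableFamily (M : Type u) where
  /-- The definable sets of `α`-tuples. -/
  IsDef : ∀ {α : Type}, Set (α → M) → Prop
  univ : ∀ {α : Type}, IsDef (Set.univ : Set (α → M))
  inter : ∀ {α : Type} {S T : Set (α → M)}, IsDef S → IsDef T → IsDef (S ∩ T)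
  compl : ∀ {α : Type} {S : Set (α → M)}, IsDef S → IsDef Sᶜ
  reindex : ∀ {α β : Type} (f : α → β) {S : Set (α → M)}, IsDef S → IsDef {v : β → M | v ∘ f ∈ S}
  proj : ∀ {α β : Type} [Finite β] {S : Set (α ⊕ β → M)}, IsDef S →
    IsDef {v : α → M | ∃ w : β → M, Sum.elim v w ∈ S}
  fiber : ∀ {α β : Type} {S : Set (α ⊕ β → M)} (w : β → M), IsDef S →
    IsDef {v : α → M | Sum.elim v w ∈ S}
  diag : IsDef {v : Bool → M | v true = v false}
  support : ∀ {α : Type} {S : Set (α → M)}, IsDef S →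
    ∃ (F : Finset α) (S₀ : Set (F → M)), IsDef S₀ ∧ S = {v | (fun i : F => v i) ∈ S₀}

variable {M : Type u} {α β γ δ : Type}

/-- The restriction of an ultrafilter on tuples along a map of indices. -/
def rs (U : Ultrafilter (β → M)) (f : α → β) : Ultrafilter (α → M) := U.map (fun v => v ∘ f)

/-- The product of ultrafilters: the left factor is generic over the right one. -/
def tens (U : Ultrafilter (α → M)) (R : Ultrafilter (β → M)) : Ultrafilter (α ⊕ β → M) :=
  R.bind fun w => U.map fun v => Sum.elim v w

theorem mem_rs {U : Ultrafilter (β → M)} {f : α → β} {S : Set (α → M)} :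
    S ∈ rs U f ↔ {v | v ∘ f ∈ S} ∈ U := Iff.rfl

theorem mem_tens {U : Ultrafilter (α → M)} {R : Ultrafilter (β → M)} {S : Set (α ⊕ β → M)} :
    S ∈ tens U R ↔ {w | {v | Sum.elim v w ∈ S} ∈ U} ∈ R := Iff.rfl

theorem rs_id (U : Ultrafilter (β → M)) : rs U id = U := Ultrafilter.ext fun _ => Iff.rfl

theorem rs_rs (U : Ultrafilter (γ → M)) (f : β → γ) (g : α → β) :
    rs (rs U f) g = rs U (f ∘ g) := Ultrafilter.ext fun _ => Iff.rfl

theorem tens_rs (U : Ultrafilter (γ → M)) (R : Ultrafilter (δ → M)) (f : α → γ) (g : β → δ) :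
    rs (tens U R) (Sum.map f g) = tens (rs U f) (rs R g) := by
  ext S
  simp only [mem_rs, mem_tens]
  have : ∀ (v : γ → M) (w : δ → M), Sum.elim v w ∘ Sum.map f g = Sum.elim (v ∘ f) (w ∘ g) := by
    intro v w; ext (i | i) <;> rfl
  simp [this]

theorem rs_tens_inl (U : Ultrafilter (α → M)) (R : Ultrafilter (β → M)) :
    rs (tens U R) Sum.inl = U :=
  Ultrafilter.ext fun S => by
    have : (∀ᶠ _ in (R : Filter (β → M)), S ∈ U) ↔ S ∈ U := Filter.eventually_const
    exact this

theorem rs_tens_inr (U : Ultrafilter (α → M)) (R : Ultrafilter (β → M)) :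
    rs (tens U R) Sum.inr = R := by
  ext S
  have : ∀ w : β → M, {v : α → M | w ∈ S} ∈ U ↔ w ∈ S := fun w =>
    Filter.eventually_const (f := (U : Filter (α → M)))
  simp [mem_rs, mem_tens, this]

theorem tens_assoc (U : Ultrafilter (α → M)) (R : Ultrafilter (β → M)) (G : Ultrafilter (γ → M)) :
    rs (tens (tens U R) G) (Equiv.sumAssoc α β γ).symm = tens U (tens R G) := by
  ext S
  simp only [mem_rs, mem_tens]
  have : ∀ (u : α → M) (v : β → M) (w : γ → M),
      Sum.elim (Sum.elim u v) w ∘ (Equiv.sumAssoc α β γ).symm = Sum.elim u (Sum.elim v w) := by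
    intro u v w; ext (i | i | i) <;> rfl
  simp [this]

namespace DefinableFamily

variable (D : DefinableFamily M)

/-- Two ultrafilters on tuples have the same type when they contain the same definable sets. -/
def Eqv (U V : Ultrafilter (α → M)) : Prop := ∀ S, D.IsDef S → (S ∈ U ↔ S ∈ V)

/-- The filter generated by the definable sets in an ultrafilter. -/
def tp (U : Ultrafilter (α → M)) : Filter (α → M) where
  sets := {A | ∃ S, D.IsDef S ∧ S ∈ U ∧ S ⊆ A}
  univ_sets := ⟨_, D.univ, Filter.univ_mem, subset_rfl⟩
  sets_of_superset := fun ⟨S, h, h', h''⟩ hA => ⟨S, h, h', h''.trans hA⟩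
  inter_sets := fun ⟨S, h, h', h''⟩ ⟨T, k, k', k''⟩ =>
    ⟨S ∩ T, D.inter h k, Filter.inter_mem h' k', Set.inter_subset_inter h'' k''⟩

variable {D}

theorem finset_inter {ι : Type*} (s : Finset ι) {S : ι → Set (α → M)} (h : ∀ i ∈ s, D.IsDef (S i)) :
    D.IsDef {v | ∀ i ∈ s, v ∈ S i} := by
  classical
  induction s using Finset.induction_on with
  | empty => simpa using D.univ
  | insert a s ha ih =>
    have := D.inter (h a (by simp)) (ih fun i hi => h i (by simp [hi]))
    convert this using 1
    ext v; simp

theorem finite_inter {ι : Type*} [Finite ι] {S : ι → Set (α → M)} (h : ∀ i, D.IsDef (S i)) :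
    D.IsDef {v | ∀ i, v ∈ S i} := by
  cases nonempty_fintype ι
  simpa using finset_inter (D := D) Finset.univ (S := S) fun i _ => h i

theorem eq_coord (i j : α) : D.IsDef {v : α → M | v i = v j} :=
  D.reindex (fun b : Bool => if b then i else j) D.diag

theorem agree [Finite β] (f g : β → α) : D.IsDef {v : α → M | v ∘ f = v ∘ g} := by
  have := finite_inter (D := D) (ι := β) (S := fun b => {v : α → M | v (f b) = v (g b)})
    fun b => eq_coord _ _
  convert this using 1
  ext v; simp [funext_iff]

theorem Eqv.refl (U : Ultrafilter (α → M)) : D.Eqv U U := fun _ _ => Iff.rfl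

theorem Eqv.symm {U V : Ultrafilter (α → M)} (h : D.Eqv U V) : D.Eqv V U :=
  fun S hS => (h S hS).symm

theorem Eqv.trans {U V W : Ultrafilter (α → M)} (h : D.Eqv U V) (h' : D.Eqv V W) : D.Eqv U W :=
  fun S hS => (h S hS).trans (h' S hS)

theorem Eqv.of_eq {U V : Ultrafilter (α → M)} (h : U = V) : D.Eqv U V := h ▸ Eqv.refl _

theorem Eqv.of_imp {U V : Ultrafilter (α → M)} (h : ∀ S, D.IsDef S → S ∈ U → S ∈ V) :
    D.Eqv U V := by
  refine fun S hS => ⟨h S hS, fun hV => ?_⟩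
  by_contra hU
  exact Ultrafilter.compl_mem_iff_notMem.1
    (h _ (D.compl hS) (Ultrafilter.compl_mem_iff_notMem.2 hU)) hV

theorem Eqv.of_le_tp {U V : Ultrafilter (α → M)} (h : (U : Filter (α → M)) ≤ D.tp V) : D.Eqv U V :=
  (Eqv.of_imp fun S hS hV => h ⟨S, hS, hV, subset_rfl⟩).symm

theorem Eqv.restrict {U V : Ultrafilter (β → M)} (h : D.Eqv U V) (f : α → β) :
    D.Eqv (rs U f) (rs V f) := fun _ hS => h _ (D.reindex f hS)

theorem Eqv.prod {U V : Ultrafilter (α → M)} (h : D.Eqv U V) (R : Ultrafilter (β → M)) :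
    D.Eqv (tens U R) (tens V R) := by
  intro S hS
  have : ∀ w : β → M, {v | Sum.elim v w ∈ S} ∈ U ↔ {v | Sum.elim v w ∈ S} ∈ V :=
    fun w => h _ (D.fiber w hS)
  simp only [mem_tens, this]

/-- Realising a type over a finite set of definable conditions inside a model. -/
theorem exists_amalgam [Finite α] {U : Ultrafilter (γ → M)} {R : Ultrafilter (δ → M)} [Finite γ]
    {f : α → γ} {g : α → δ} (h : D.Eqv (rs U f) (rs R g)) :
    ∃ R' : Ultrafilter (γ ⊕ δ → M), D.Eqv (rs R' Sum.inl) U ∧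
      rs R' Sum.inr = R ∧ {v | v ∘ Sum.inl ∘ f = v ∘ Sum.inr ∘ g} ∈ R' := by
  set F : Filter (γ ⊕ δ → M) := comap (fun v => v ∘ Sum.inl) (D.tp U) ⊓
    comap (fun v => v ∘ Sum.inr) R ⊓ 𝓟 {v | v ∘ Sum.inl ∘ f = v ∘ Sum.inr ∘ g} with hF
  have hne : F.NeBot := by
    rw [← forall_mem_nonempty_iff_neBot]
    intro A hA
    rw [hF, mem_inf_principal, mem_inf_iff] at hA
    obtain ⟨A₁, ⟨B₁, ⟨S, hS, hSU, hSB⟩, hA₁⟩, A₂, ⟨E, hE, hA₂⟩, hA⟩ := hA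
    have hS' : D.IsDef {x : α → M | ∃ v : γ → M, Sum.elim x v ∈
        {w : α ⊕ γ → M | w ∘ Sum.inr ∈ S ∧ w ∘ Sum.inl = w ∘ (Sum.inr ∘ f)}} :=
      D.proj (D.inter (D.reindex Sum.inr hS) (agree _ _))
    have h1 := (h _ hS').1 (by
      rw [mem_rs]
      filter_upwards [hSU] with v hv
      exact ⟨v, hv, rfl⟩)
    rw [mem_rs] at h1
    obtain ⟨w, ⟨v, hv, hvw⟩, hwE⟩ := R.nonempty_of_mem (inter_mem h1 hE)
    refine ⟨Sum.elim v w, ?_⟩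
    have : Sum.elim v w ∈ A₁ ∩ A₂ := ⟨hA₁ (hSB hv), hA₂ hwE⟩
    rw [← hA] at this
    exact this hvw.symm
  have hle := Ultrafilter.of_le F
  refine ⟨Ultrafilter.of F, ?_, ?_, ?_⟩
  · refine Eqv.of_le_tp ?_
    exact map_le_iff_le_comap.2 (hle.trans (inf_le_left.trans inf_le_left))
  · refine Ultrafilter.eq_of_le ?_
    exact map_le_iff_le_comap.2 (hle.trans (inf_le_left.trans inf_le_right))
  · exact hle.trans inf_le_right (mem_principal_self _)

theorem exists_eqv_rs_eq {U : Ultrafilter (γ → M)} {R : Ultrafilter (α → M)} [Finite γ]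
    [Finite α] {f : α → γ} (h : D.Eqv (rs U f) R) :
    ∃ R' : Ultrafilter (γ → M), D.Eqv R' U ∧ rs R' f = R := by
  obtain ⟨R', h1, h2, h3⟩ := exists_amalgam (D := D) (U := U) (R := R) (f := f) (g := id) h
  refine ⟨rs R' Sum.inl, h1, ?_⟩
  rw [← h2]
  ext S
  rw [mem_rs, mem_rs, mem_rs]
  apply Filter.congr_sets
  filter_upwards [h3] with v hv
  have : v ∘ Sum.inl ∘ f = v ∘ Sum.inr := hv
  rw [Function.comp_assoc, this]

variable (D) in
/-- The sets which cannot belong to an ultrafilter of the given type admissible at level `n`. -/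
def Bad : ℕ → ∀ {α : Type}, Ultrafilter (α → M) → Set (α → M) → Prop
  | 0, _, _, _ => False
  | n + 1, α, p, S => Bad n p S ∨ ∃ (δ : Type) (_ : Finite δ) (g : α → δ) (R : Ultrafilter (δ → M)),
      D.Eqv (rs R g) p ∧ ∀ Q : Ultrafilter (δ ⊕ δ → M), D.Eqv Q (tens R R) →
        S ∈ rs Q (Sum.inl ∘ g) → S ∈ rs Q (Sum.inr ∘ g) → ∃ E ∈ Q, Bad n Q E

variable (D) in
/-- Admissibility at level `n`. -/
def Adm (n : ℕ) (q : Ultrafilter (α → M)) : Prop := ∀ E ∈ q, ¬ D.Bad n q E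

variable (D) in
/-- Canonical ultrafilters: those admissible at all levels. -/
def AdmAll (q : Ultrafilter (α → M)) : Prop := ∀ n, D.Adm n q

theorem Bad.congr {n : ℕ} {p p' : Ultrafilter (α → M)} (h : D.Eqv p p') {S : Set (α → M)}
    (hb : D.Bad n p S) : D.Bad n p' S := by
  induction n with
  | zero => exact hb
  | succ n ih =>
    rcases hb with hb | ⟨δ, hδ, g, R, hR, hb⟩
    · exact Or.inl (ih hb)
    · exact Or.inr ⟨δ, hδ, g, R, hR.trans h, hb⟩

theorem Bad.mono {n m : ℕ} (hnm : n ≤ m) {p : Ultrafilter (α → M)} {S : Set (α → M)}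
    (hb : D.Bad n p S) : D.Bad m p S := by
  induction hnm with
  | refl => exact hb
  | step _ ih => exact Or.inl ih

theorem Bad.comap {n : ℕ} {α β : Type} [Finite α] [Finite β] {p : Ultrafilter (β → M)} {f : α → β}
    {S : Set (α → M)} (hb : D.Bad n (rs p f) S) : D.Bad n p {v | v ∘ f ∈ S} := by
  induction n generalizing α β with
  | zero => exact hb
  | succ n ih =>
    rcases hb with hb | ⟨δ, hδ, g, R, hR, hb⟩
    · exact Or.inl (ih hb)
    · obtain ⟨R', h1, rfl, h3⟩ := exists_amalgam (D := D) hR.symm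
      refine Or.inr ⟨β ⊕ δ, inferInstance, Sum.inl, R', h1, fun Q hQ hl hr => ?_⟩
      have key : ∀ i : β ⊕ δ → (β ⊕ δ) ⊕ (β ⊕ δ), rs (tens R' R') i = R' →
          {v | v ∘ f ∈ S} ∈ rs Q (i ∘ Sum.inl) → S ∈ rs Q (i ∘ Sum.inr ∘ g) := by
        intro i hi h
        have : {v | v ∘ Sum.inl ∘ f = v ∘ Sum.inr ∘ g} ∈ rs Q i :=
          ((hQ.restrict i) _ (agree _ _)).2 (by rwa [hi])
        rw [mem_rs] at this h ⊢
        filter_upwards [this, h] with v hv hv'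
        have h4 : v ∘ i ∘ Sum.inr ∘ g = v ∘ i ∘ Sum.inl ∘ f := hv.symm
        change v ∘ i ∘ Sum.inr ∘ g ∈ S
        rw [h4]; exact hv'
      have hQ' : D.Eqv (rs Q (Sum.map Sum.inr Sum.inr))
          (tens (rs R' Sum.inr) (rs R' Sum.inr)) := by
        have := hQ.restrict (Sum.map Sum.inr Sum.inr)
        rwa [tens_rs] at this
      obtain ⟨E, hE, hbad⟩ := hb _ hQ' (key Sum.inl (rs_tens_inl _ _) hl)
        (key Sum.inr (rs_tens_inr _ _) hr)
      exact ⟨_, hE, ih hbad⟩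

theorem Adm.restrict {n : ℕ} [Finite α] [Finite β] {q : Ultrafilter (β → M)} (h : D.Adm n q)
    (f : α → β) : D.Adm n (rs q f) := fun _ hE hb => h _ hE hb.comap

theorem AdmAll.restrict [Finite α] [Finite β] {q : Ultrafilter (β → M)} (h : D.AdmAll q)
    (f : α → β) : D.AdmAll (rs q f) := fun n => (h n).restrict f

theorem exists_adm_of_frequently {p : Ultrafilter (α → M)} (ℬ : ℕ → Set (Set (α → M)))
    (hmono : Monotone ℬ) {F : Filter (α → M)}
    (h : ∀ n, ∀ l : List (Set (α → M)), (∀ E ∈ l, E ∈ ℬ n) → ∀ A ∈ F,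
      ∃ Q : Ultrafilter (α → M), D.Eqv Q p ∧ A ∈ Q ∧ ∀ E ∈ l, E ∉ Q) :
    ∃ Q : Ultrafilter (α → M), D.Eqv Q p ∧ (Q : Filter (α → M)) ≤ F ∧ ∀ n, ∀ E ∈ ℬ n, E ∉ Q := by
  set G : Filter (α → M) := D.tp p ⊓ F ⊓ generate {A | ∃ n, Aᶜ ∈ ℬ n} with hG
  have hne : G.NeBot := by
    rw [← forall_mem_nonempty_iff_neBot]
    intro A hA
    rw [hG, mem_inf_iff] at hA
    obtain ⟨A₁, hA₁, A₂, hA₂, rfl⟩ := hA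
    obtain ⟨B₁, ⟨S, hS, hSp, hSB⟩, B₂, hB₂, rfl⟩ := mem_inf_iff.1 hA₁
    obtain ⟨t, ht, htf, htA⟩ := mem_generate_iff.1 hA₂
    obtain ⟨n, hn⟩ : ∃ n, ∀ A ∈ t, Aᶜ ∈ ℬ n := by
      refine htf.induction_on_subset (motive := fun s _ => ∃ n, ∀ A ∈ s, Aᶜ ∈ ℬ n) t ⟨0, by simp⟩ ?_
      rintro a s ha hs - ⟨n, hn⟩
      obtain ⟨m, hm⟩ := ht ha
      refine ⟨max n m, ?_⟩
      rintro A (rfl | hA)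
      · exact hmono (le_max_right _ _) hm
      · exact hmono (le_max_left _ _) (hn _ hA)
    obtain ⟨Q, hQ, hAQ, hlQ⟩ := h n (htf.toFinset.toList.map fun A => Aᶜ) (by
      intro E hE
      simp only [List.mem_map, Finset.mem_toList, Set.Finite.mem_toFinset] at hE
      obtain ⟨A, hA, rfl⟩ := hE
      exact hn A hA) B₂ hB₂
    have h1 : ⋂₀ t ∈ Q := by
      refine (Filter.sInter_mem htf).2 fun A hA => ?_
      have := hlQ Aᶜ (by simpa using hA)
      rwa [Ultrafilter.compl_notMem_iff] at this
    have h2 : S ∈ Q := (hQ S hS).2 hSp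
    obtain ⟨v, ⟨hv1, hv2⟩, hv3⟩ := Q.nonempty_of_mem (inter_mem (inter_mem h1 h2) hAQ)
    exact ⟨v, ⟨⟨hSB hv2, hv3⟩, htA hv1⟩⟩
  have hle := Ultrafilter.of_le G
  refine ⟨Ultrafilter.of G, Eqv.of_le_tp (hle.trans (inf_le_left.trans inf_le_left)),
    hle.trans (inf_le_left.trans inf_le_right), fun n E hE hEG => ?_⟩
  have : Eᶜ ∈ Ultrafilter.of G :=
    hle.trans inf_le_right (mem_generate_of_mem ⟨n, by rwa [_root_.compl_compl]⟩)
  exact Ultrafilter.compl_mem_iff_notMem.1 this hEG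

theorem exists_admAll_of_forall_adm {p : Ultrafilter (α → M)} {F : Filter (α → M)}
    (h : ∀ n, ∀ A ∈ F, ∃ Q : Ultrafilter (α → M), D.Eqv Q p ∧ A ∈ Q ∧ D.Adm n Q) :
    ∃ Q : Ultrafilter (α → M), D.Eqv Q p ∧ (Q : Filter (α → M)) ≤ F ∧ D.AdmAll Q := by
  obtain ⟨Q, hQ, hF, hQ'⟩ := exists_adm_of_frequently (D := D) (p := p) (fun n => {E | D.Bad n p E})
    (fun n m hnm E hE => Bad.mono hnm hE) (F := F) (by
      intro n l hl A hA
      obtain ⟨Q, hQ, hAQ, had⟩ := h n A hA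
      exact ⟨Q, hQ, hAQ, fun E hE hEQ => had E hEQ ((hl E hE).congr hQ.symm)⟩)
  exact ⟨Q, hQ, hF, fun n E hE hb => hQ' n E (hb.congr hQ) hE⟩

/-- The ultrafilter `G` together with the event `W` can be coheired over by admissible ultrafilters
in arbitrary products. -/
def Avoids (D : DefinableFamily M) (n : ℕ) (G : Ultrafilter (δ → M)) (W : Set (δ → M)) : Prop :=
  ∀ (γ : Type) [Finite γ] (U : Ultrafilter (γ → M)), ∃ Q : Ultrafilter (γ ⊕ δ → M),
    D.Adm n Q ∧ D.Eqv Q (tens U G) ∧ W ∈ rs Q Sum.inr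

theorem Avoids.exists_avoiding {n : ℕ} (m : ℕ) : ∀ {γ δ : Type} [Finite γ] [Finite δ]
    {U : Ultrafilter (γ → M)} {G : Ultrafilter (δ → M)} {W : Set (δ → M)},
    Avoids D n G W → ∀ l : List (Set (γ → M)), l.length = m → (∀ S ∈ l, D.Bad (n + 1) U S) →
    ∃ Q : Ultrafilter (γ ⊕ δ → M), D.Adm n Q ∧ D.Eqv Q (tens U G) ∧ W ∈ rs Q Sum.inr ∧
      ∀ S ∈ l, S ∉ rs Q Sum.inl := by
  induction m with
  | zero =>
    intro γ δ _ _ U G W h l hl _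
    obtain ⟨Q, h1, h2, h3⟩ := h γ U
    rw [List.length_eq_zero_iff] at hl
    exact ⟨Q, h1, h2, h3, by simp [hl]⟩
  | succ m ih =>
    intro γ δ _ _ U G W h l hl hlb
    obtain ⟨S, l, rfl⟩ := List.exists_cons_of_length_eq_add_one hl
    have hl : l.length = m := by simpa using hl
    rcases hlb S (by simp) with hb | ⟨δ₀, _, g, R, hR, hb⟩
    · obtain ⟨Q, h1, h2, h3, h4⟩ := ih (U := U) h l hl fun S hS => hlb S (by simp [hS])
      refine ⟨Q, h1, h2, h3, ?_⟩
      have h5 : D.Eqv U (rs Q Sum.inl) := by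
        have := (h2.restrict Sum.inl).symm; rwa [rs_tens_inl] at this
      intro S' hS'
      rcases List.mem_cons.1 hS' with rfl | hS'
      · exact fun hQ => h1.restrict Sum.inl _ hQ (hb.congr h5)
      · exact h4 S' hS'
    · have hbad : ∀ S ∈ l, D.Bad (n + 1) R {v | v ∘ g ∈ S} := fun S hS =>
        ((hlb S (by simp [hS])).congr hR.symm).comap
      have hav : Avoids D n (tens R G)
          {w | (∀ S ∈ l, w ∘ Sum.inl ∘ g ∉ S) ∧ w ∘ Sum.inr ∈ W} := by
        intro γ' _ U'
        obtain ⟨Q, h1, h2, h3, h4⟩ := ih (U := tens U' R) h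
          (l.map fun S => {v | v ∘ Sum.inr ∘ g ∈ S}) (by simpa using hl) (by
            intro S' hS'
            obtain ⟨S, hS, rfl⟩ := List.mem_map.1 hS'
            have := hbad S hS
            rw [← rs_tens_inr U' R] at this
            exact this.comap)
        refine ⟨rs Q (Equiv.sumAssoc _ _ _).symm, h1.restrict _, ?_, ?_⟩
        · rw [← tens_assoc]; exact h2.restrict _
        · have h5 : ∀ᶠ v in (Q : Filter ((γ' ⊕ δ₀) ⊕ δ → M)), ∀ S ∈ {S | S ∈ l},
              v ∘ Sum.inl ∘ Sum.inr ∘ g ∉ S := by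
            refine (Filter.eventually_all_finite (List.finite_toSet l)).2 fun S hS => ?_
            exact Ultrafilter.compl_mem_iff_notMem.2 (h4 _ (List.mem_map_of_mem hS))
          exact Filter.mp_mem h3 (Filter.mp_mem h5 (Filter.univ_mem' fun v h5 h3 => ⟨h5, h3⟩))
      obtain ⟨Q, h1, h2, h3, h4⟩ := ih (U := R) hav (l.map fun S => {v | v ∘ g ∈ S})
        (by simpa using hl) (by
          intro S' hS'
          obtain ⟨S, hS, rfl⟩ := List.mem_map.1 hS'
          exact hbad S hS)
      have hQR : D.Eqv (rs Q (Sum.map id Sum.inl)) (tens R R) := by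
        have := h2.restrict (Sum.map id Sum.inl)
        rwa [tens_rs, rs_id, rs_tens_inl] at this
      have finish : ∀ B : δ₀ → δ₀ ⊕ (δ₀ ⊕ δ),
          D.Eqv (rs Q (Sum.elim B (Sum.inr ∘ Sum.inr))) (tens R G) → S ∉ rs Q (B ∘ g) →
          (∀ S ∈ l, S ∉ rs Q (B ∘ g)) → ∃ Q : Ultrafilter (γ ⊕ δ → M), D.Adm n Q ∧
            D.Eqv Q (tens U G) ∧ W ∈ rs Q Sum.inr ∧ ∀ S' ∈ S :: l, S' ∉ rs Q Sum.inl := by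
        intro B hB hSB hlB
        refine ⟨rs Q (Sum.elim (B ∘ g) (Sum.inr ∘ Sum.inr)), h1.restrict _, ?_, ?_, ?_⟩
        · have h5 := hB.restrict (Sum.map g id)
          rw [rs_rs, tens_rs, rs_id, Sum.elim_comp_map] at h5
          exact h5.trans (hR.prod G)
        · rw [rs_rs, Sum.elim_comp_inr]
          rw [mem_rs] at h3 ⊢
          filter_upwards [h3] with v h3
          exact h3.2
        · rw [rs_rs, Sum.elim_comp_inl]
          intro S' hS'
          rcases List.mem_cons.1 hS' with rfl | hS'
          · exact hSB
          · exact hlB S' hS'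
      by_cases hA : S ∈ rs Q (Sum.inl ∘ g)
      · have hB : S ∉ rs Q (Sum.inr ∘ Sum.inl ∘ g) := fun hB => by
          obtain ⟨E, hE, hE'⟩ := hb _ hQR hA hB
          exact h1.restrict _ E hE hE'
        refine finish (Sum.inr ∘ Sum.inl) ?_ hB fun S' hS' hQ => ?_
        · have := h2.restrict Sum.inr
          rw [rs_tens_inr] at this
          rwa [show Sum.elim (Sum.inr ∘ Sum.inl) (Sum.inr ∘ Sum.inr) =
            (Sum.inr : δ₀ ⊕ δ → δ₀ ⊕ (δ₀ ⊕ δ)) from by ext (i | i) <;> rfl]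
        · obtain ⟨v, hv1, hv2⟩ := Q.nonempty_of_mem (inter_mem h3 hQ)
          exact hv1.1 S' hS' hv2
      · refine finish Sum.inl ?_ hA fun S' hS' hQ => h4 _ (List.mem_map_of_mem hS') hQ
        have := h2.restrict (Sum.map id Sum.inr)
        rw [tens_rs, rs_id, rs_tens_inr] at this
        exact this

theorem exists_adm (n : ℕ) : ∀ {α : Type} [Finite α] (p : Ultrafilter (α → M)),
    ∃ q, D.Eqv q p ∧ D.Adm n q := by
  induction n with
  | zero => exact fun p => ⟨p, Eqv.refl p, fun _ _ h => h⟩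
  | succ n ih =>
    intro α _ p
    have hav : ∀ G : Ultrafilter (Empty → M), Avoids D n G Set.univ := fun G γ _ U => by
      obtain ⟨q, hq, hq'⟩ := ih (tens U G)
      exact ⟨q, hq', hq, Filter.univ_mem⟩
    obtain ⟨q, hq, -, hq'⟩ := exists_adm_of_frequently (D := D) (p := p)
      (fun _ => {E | D.Bad (n + 1) p E}) monotone_const (F := ⊤) (by
        intro _ l hl A hA
        rw [mem_top] at hA
        obtain ⟨Q, h1, h2, -, h4⟩ := (hav (rs p Empty.elim)).exists_avoiding l.length l rfl hl
        refine ⟨rs Q Sum.inl, ?_, hA ▸ Filter.univ_mem, h4⟩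
        have := h2.restrict Sum.inl
        rwa [rs_tens_inl] at this)
    exact ⟨q, hq, fun E hE hb => hq' 0 E (hb.congr hq) hE⟩

theorem exists_admAll [Finite α] (p : Ultrafilter (α → M)) : ∃ q, D.Eqv q p ∧ D.AdmAll q := by
  obtain ⟨q, hq, -, hq'⟩ := exists_admAll_of_forall_adm (D := D) (p := p) (F := ⊤) (by
    intro n A hA
    rw [mem_top] at hA
    obtain ⟨q, hq, hq'⟩ := exists_adm (D := D) n p
    exact ⟨q, hq, hA ▸ Filter.univ_mem, hq'⟩)
  exact ⟨q, hq, hq'⟩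

/-- Two-sided extension of a canonical ultrafilter along a Morley pair. -/
theorem AdmAll.exists_pair [Finite δ] {q : Ultrafilter (α → M)} (hq : D.AdmAll q) {g : α → δ}
    {R : Ultrafilter (δ → M)} (hR : D.Eqv (rs R g) q) :
    ∃ Q : Ultrafilter (δ ⊕ δ → M), D.AdmAll Q ∧ D.Eqv Q (tens R R) ∧
      rs Q (Sum.inl ∘ g) = q ∧ rs Q (Sum.inr ∘ g) = q := by
  obtain ⟨Q, h1, h2, h3⟩ := exists_admAll_of_forall_adm (D := D) (p := tens R R)
    (F := comap (fun v => v ∘ Sum.inl ∘ g) q ⊓ comap (fun v => v ∘ Sum.inr ∘ g) q) (by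
      intro n A hA
      obtain ⟨A₁, ⟨S₁, hS₁, hA₁⟩, A₂, ⟨S₂, hS₂, hA₂⟩, rfl⟩ := mem_inf_iff.1 hA
      have := hq (n + 1) _ (inter_mem hS₁ hS₂)
      rw [Bad] at this
      push Not at this
      obtain ⟨Q, h1, h2, h3, h4⟩ := this.2 δ inferInstance g R hR
      exact ⟨Q, h1, Filter.mem_of_superset (inter_mem h2 h3) fun v hv =>
        ⟨hA₁ hv.1.1, hA₂ hv.2.2⟩, h4⟩)
  exact ⟨Q, h3, h1, Ultrafilter.eq_of_le (map_le_iff_le_comap.2 (h2.trans inf_le_left)),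
    Ultrafilter.eq_of_le (map_le_iff_le_comap.2 (h2.trans inf_le_right))⟩

theorem AdmAll.exists_extension [Finite δ] {q : Ultrafilter (α → M)} (hq : D.AdmAll q) {g : α → δ}
    {R : Ultrafilter (δ → M)} (hR : D.Eqv (rs R g) q) :
    ∃ Q : Ultrafilter (δ → M), D.AdmAll Q ∧ D.Eqv Q R ∧ rs Q g = q := by
  obtain ⟨Q, h1, h2, h3, -⟩ := hq.exists_pair hR
  refine ⟨rs Q Sum.inl, h1.restrict _, ?_, h3⟩
  have := h2.restrict Sum.inl
  rwa [rs_tens_inl] at this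

end DefinableFamily
end

section

variable {M : Type u} {α β γ δ τ ζ ξ : Type}

/-- The first `k` members of a sequence of tuples of indices. -/
def pre (y : ℕ → τ → γ) (k : ℕ) : Fin k × τ → γ := fun p => y p.1 p.2

/-- Split off the last entry of a sequence of tuples. -/
def splitLast (k : ℕ) : Fin (k + 1) × τ → (Fin k × τ) ⊕ τ := fun p =>
  if h : (p.1 : ℕ) < k then Sum.inl (⟨p.1, h⟩, p.2) else Sum.inr p.2

/-- Concatenation of finite sequences of tuples, on indices. -/
def concatIdx (m k : ℕ) : (Fin m × τ) ⊕ (Fin k × τ) → Fin (m + k) × τ :=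
  Sum.elim (fun p => (Fin.castAdd k p.1, p.2)) fun p => (Fin.natAdd m p.1, p.2)

/-- The iterated product of a sequence of ultrafilters, the first one being the most generic. -/
def ch (R : ℕ → Ultrafilter (τ → M)) : (k : ℕ) → Ultrafilter (Fin k × τ → M)
  | 0 => pure fun p => p.1.elim0
  | k + 1 => rs (tens (ch R k) (R k)) (splitLast k)

/-- The power of an ultrafilter. -/
abbrev pw (Q : Ultrafilter (τ → M)) : (k : ℕ) → Ultrafilter (Fin k × τ → M) := ch fun _ => Q

theorem pre_succ (y : ℕ → τ → γ) (k : ℕ) :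
    pre y (k + 1) = Sum.elim (pre y k) (y k) ∘ splitLast k := by
  ext ⟨⟨i, hi⟩, t⟩
  by_cases h : i < k
  · simp [pre, splitLast, h]
  · have : i = k := by omega
    simp [pre, splitLast, this]

theorem elim_pre (y : ℕ → τ → γ) (k : ℕ) :
    Sum.elim (pre y k) (y k) = pre y (k + 1) ∘
      Sum.elim (fun p => (Fin.castSucc p.1, p.2)) (fun t => (Fin.last k, t)) := by
  ext (⟨i, t⟩ | t) <;> simp [pre]

theorem splitLast_comp (k : ℕ) : splitLast k ∘
    Sum.elim (fun p : Fin k × τ => (Fin.castSucc p.1, p.2)) (fun t => (Fin.last k, t)) = id := by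
  ext1 x
  rcases x with ⟨i, t⟩ | t <;> simp [splitLast]

theorem rs_ch_succ (R : ℕ → Ultrafilter (τ → M)) (k : ℕ) : rs (ch R (k + 1))
    (Sum.elim (fun p : Fin k × τ => (Fin.castSucc p.1, p.2)) (fun t => (Fin.last k, t))) =
      tens (ch R k) (R k) := by
  rw [ch, rs_rs, splitLast_comp, rs_id]

theorem rs_ch_add (R : ℕ → Ultrafilter (τ → M)) (m k : ℕ) :
    rs (ch R (m + k)) (concatIdx m k) = tens (ch R m) (ch (fun i => R (m + i)) k) := by
  induction k with
  | zero =>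
    ext S
    rw [mem_rs, mem_tens, ch, Ultrafilter.mem_pure]
    have : ∀ v : Fin (m + 0) × τ → M, v ∘ concatIdx m 0 = Sum.elim v fun p => p.1.elim0 := by
      intro v
      ext (⟨i, t⟩ | ⟨i, t⟩)
      · rfl
      · exact i.elim0
    simp only [this]
    exact Iff.rfl
  | succ k ih =>
    change rs (rs (tens (ch R (m + k)) (R (m + k))) (splitLast _)) _ =
      tens _ (rs (tens (ch _ k) (R (m + k))) (splitLast _))
    rw [← rs_id (ch R m), ← tens_rs, ← tens_assoc, rs_rs, rs_rs, ← ih]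
    conv_rhs => rw [← rs_id (R (m + k)), ← tens_rs, rs_rs]
    congr 1
    ext1 x
    rcases x with ⟨⟨i, hi⟩, t⟩ | ⟨⟨i, hi⟩, t⟩
    · have : i < m + k := by omega
      simp [splitLast, concatIdx, this]
    · by_cases h : i < k
      · simp [splitLast, concatIdx, h]
      · simp [splitLast, concatIdx, h]

theorem rs_ch_castAdd (R : ℕ → Ultrafilter (τ → M)) (m k : ℕ) :
    rs (ch R (m + k)) (fun p : Fin m × τ => (Fin.castAdd k p.1, p.2)) = ch R m := by
  rw [← rs_tens_inl (ch R m), ← rs_ch_add, rs_rs]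
  rfl

/-- The tuples `u` for which the instances of `Ψ` along `u` are consistent. -/
def Con (Ψ : Set (ξ ⊕ τ → M)) (k : ℕ) : Set (Fin k × τ → M) :=
  {u | ∃ x : ξ → M, ∀ l, Sum.elim x (fun t => u (l, t)) ∈ Ψ}

/-- Reindex a sequence of tuples. -/
def shift (f : ℕ → ℕ) : α ⊕ (ℕ × ζ) → α ⊕ (ℕ × ζ) := Sum.map id (Prod.map f id)

/-- The sequence of tuples inside `α ⊕ (ℕ × ζ)`. -/
def seqIdx (l : ℕ) : ζ → α ⊕ (ℕ × ζ) := fun z => Sum.inr (l, z)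

theorem shift_comp (f g : ℕ → ℕ) : (shift f ∘ shift g : α ⊕ (ℕ × ζ) → α ⊕ (ℕ × ζ)) =
    shift (f ∘ g) := by
  ext1 x; rcases x with a | ⟨l, z⟩ <;> rfl

/-! ### An indiscernible ultrafilter on sequences of natural numbers -/

/-- Prepend an entry to a sequence. -/
def consSeq (i : ℕ) (f : ℕ → ℕ) : ℕ → ℕ
  | 0 => i
  | n + 1 => f n

/-- The iterated product of a nonprincipal ultrafilter on `ℕ`, the first entry being outermost. -/
noncomputable def iterUlt : ℕ → Ultrafilter (ℕ → ℕ)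
  | 0 => pure fun _ => 0
  | k + 1 => (hyperfilter ℕ).bind fun i => (iterUlt k).map (consSeq i)

/-- A property of sequences which depends only on the first `k` entries. -/
def LocalAt (k : ℕ) (P : (ℕ → ℕ) → Prop) : Prop :=
  ∀ f g : ℕ → ℕ, (∀ j < k, f j = g j) → (P f ↔ P g)

theorem LocalAt.const {P : (ℕ → ℕ) → Prop} (h : LocalAt 0 P) (U : Ultrafilter (ℕ → ℕ))
    (f : ℕ → ℕ) : (∀ᶠ g in (U : Filter (ℕ → ℕ)), P g) ↔ P f := by
  have : ∀ g, P g ↔ P f := fun g => h _ _ (by simp)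
  simp only [this, eventually_const]

theorem eventually_iterUlt_succ {k : ℕ} {P : (ℕ → ℕ) → Prop} :
    (∀ᶠ f in (iterUlt (k + 1) : Filter (ℕ → ℕ)), P f) ↔
      ∀ᶠ i in (hyperfilter ℕ : Filter ℕ), ∀ᶠ f in (iterUlt k : Filter (ℕ → ℕ)), P (consSeq i f) :=
  Iff.rfl

theorem eventually_iterUlt_comp (K : ℕ) : ∀ (k : ℕ) (P : (ℕ → ℕ) → Prop) (g : ℕ → ℕ),
    LocalAt k P → StrictMono g → (∀ j < k, g j < K) →
    ((∀ᶠ f in (iterUlt K : Filter (ℕ → ℕ)), P (f ∘ g)) ↔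
      ∀ᶠ f in (iterUlt k : Filter (ℕ → ℕ)), P f) := by
  induction K with
  | zero =>
    intro k P g hP hg hK
    obtain rfl : k = 0 := by
      by_contra h; exact absurd (hK 0 (by omega)) (by omega)
    rw [hP.const _ id,
      LocalAt.const (P := fun f => P (f ∘ g)) (fun f f' _ => hP _ _ (by simp)) _ id]
    exact hP _ _ (by simp)
  | succ K ih =>
    intro k P g hP hg hK
    rcases k with _ | k
    · rw [hP.const _ id,
        LocalAt.const (P := fun f => P (f ∘ g)) (fun f f' _ => hP _ _ (by simp)) _ id]
      exact hP _ _ (by simp)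
    rw [eventually_iterUlt_succ]
    rcases Nat.eq_zero_or_pos (g 0) with h0 | h0
    · rw [eventually_iterUlt_succ]
      apply eventually_congr
      refine Eventually.of_forall fun i => ?_
      have hg1 : ∀ j, 1 ≤ g (j + 1) := fun j => by
        have := hg (Nat.succ_pos j)
        simp only [Nat.succ_eq_add_one] at this
        omega
      rw [← ih k (fun f => P (consSeq i f)) (fun j => g (j + 1) - 1)]
      · apply eventually_congr
        refine Eventually.of_forall fun f => ?_
        apply hP
        rintro (_ | j) hj
        · simp [h0, consSeq]
        · obtain ⟨m, hm⟩ := Nat.exists_eq_add_of_le' (hg1 j)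
          simp [hm, consSeq]
      · intro f f' h
        apply hP
        rintro (_ | j) hj
        · rfl
        · exact h j (by omega)
      · intro a b hab
        have := hg (Nat.succ_lt_succ hab)
        have := hg1 a
        simp only [Nat.succ_eq_add_one] at *
        omega
      · intro j hj
        have := hK (j + 1) (by omega)
        have := hg1 j
        omega
    · have hg1 : ∀ j, 1 ≤ g j := fun j => by have := hg.monotone (Nat.zero_le j); omega
      have : ∀ i f, consSeq i f ∘ g = f ∘ fun j => g j - 1 := by
        intro i f
        ext j
        obtain ⟨m, hm⟩ := Nat.exists_eq_add_of_le' (hg1 j)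
        simp [hm, consSeq]
      simp only [this, eventually_const]
      refine ih _ P _ hP ?_ ?_
      · intro a b hab
        have := hg hab
        have := hg1 a
        change g a - 1 < g b - 1
        omega
      · intro j hj
        have := hK j hj
        have := hg1 j
        omega

/-- An ultrafilter on sequences of natural numbers concentrating on increasing sequences and
invariant under passing to subsequences, as far as finitely many entries are concerned. -/
noncomputable def seqUlt : Ultrafilter (ℕ → ℕ) := (hyperfilter ℕ).bind iterUlt

theorem eventually_seqUlt_iff {k : ℕ} {P : (ℕ → ℕ) → Prop} (hP : LocalAt k P) :
    (∀ᶠ f in (seqUlt : Filter (ℕ → ℕ)), P f) ↔ ∀ᶠ f in (iterUlt k : Filter (ℕ → ℕ)), P f := by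
  have h : ∀ᶠ K in (hyperfilter ℕ : Filter ℕ), k ≤ K := by
    have : ∀ᶠ K in atTop, k ≤ K := eventually_ge_atTop k
    rw [← Nat.cofinite_eq_atTop] at this
    exact hyperfilter_le_cofinite this
  have h1 : (∀ᶠ f in (seqUlt : Filter (ℕ → ℕ)), P f) ↔
    ∀ᶠ K in (hyperfilter ℕ : Filter ℕ), ∀ᶠ f in (iterUlt K : Filter (ℕ → ℕ)), P f := Iff.rfl
  rw [h1, ← eventually_const (f := (hyperfilter ℕ : Filter ℕ))
    (p := ∀ᶠ f in (iterUlt k : Filter (ℕ → ℕ)), P f)]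
  apply eventually_congr
  filter_upwards [h] with K hK
  exact eventually_iterUlt_comp K k P id hP strictMono_id fun j hj => lt_of_lt_of_le hj hK

theorem eventually_seqUlt_comp {k : ℕ} {P : (ℕ → ℕ) → Prop} (hP : LocalAt k P) {g : ℕ → ℕ}
    (hg : StrictMono g) : (∀ᶠ f in (seqUlt : Filter (ℕ → ℕ)), P (f ∘ g)) ↔
      ∀ᶠ f in (seqUlt : Filter (ℕ → ℕ)), P f := by
  rw [eventually_seqUlt_iff hP, eventually_seqUlt_iff (k := g k),
    eventually_iterUlt_comp (g k) k P g hP hg fun j hj => hg hj]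
  exact fun f f' h => hP _ _ fun j hj => h _ (hg hj)

theorem eventually_seqUlt_lt {i j : ℕ} (hij : i < j) :
    ∀ᶠ f in (seqUlt : Filter (ℕ → ℕ)), f i < f j := by
  have h2 : LocalAt 2 fun f => f 0 < f 1 := fun f f' h => by
    dsimp only
    rw [h 0 (by omega), h 1 (by omega)]
  have := (eventually_seqUlt_comp h2 (g := fun n => if n = 0 then i else j + n - 1) (by
    intro a b hab
    dsimp only
    split_ifs <;> omega)).2 (by
      rw [eventually_seqUlt_iff h2, eventually_iterUlt_succ]
      refine Eventually.of_forall fun a => ?_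
      rw [eventually_iterUlt_succ]
      have : ∀ᶠ K in (hyperfilter ℕ : Filter ℕ), a < K := by
        have : ∀ᶠ K in atTop, a < K := eventually_gt_atTop a
        rw [← Nat.cofinite_eq_atTop] at this
        exact hyperfilter_le_cofinite this
      filter_upwards [this] with b hb
      exact Eventually.of_forall fun f => hb)
  simpa using this

theorem exists_strictMono_agree {k : ℕ} {f : ℕ → ℕ} (h : ∀ j < k, ∀ i < j, f i < f j) :
    ∃ g, StrictMono g ∧ ∀ j < k, f j = g j := by
  refine ⟨fun n => if n < k then f n else (∑ i ∈ Finset.range k, f i) + n + 1, ?_, ?_⟩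
  · intro a b hab
    dsimp only
    by_cases hb : b < k
    · rw [if_pos hb, if_pos (by omega)]
      exact h b hb a hab
    · rw [if_neg hb]
      split_ifs with ha
      · have := Finset.single_le_sum (f := f) (s := Finset.range k) (fun _ _ => Nat.zero_le _)
          (Finset.mem_range.2 ha)
        omega
      · omega
  · intro j hj; simp [hj]

theorem eventually_seqUlt_of_forall {k : ℕ} {P : (ℕ → ℕ) → Prop} (hP : LocalAt k P)
    (h : ∀ f, StrictMono f → P f) : ∀ᶠ f in (seqUlt : Filter (ℕ → ℕ)), P f := by
  have : ∀ᶠ f in (seqUlt : Filter (ℕ → ℕ)), ∀ j ∈ {j | j < k}, ∀ i ∈ {i | i < j}, f i < f j := by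
    refine (eventually_all_finite (Set.finite_lt_nat k)).2 fun j _ =>
      (eventually_all_finite (Set.finite_lt_nat j)).2 fun i hi => eventually_seqUlt_lt hi
  filter_upwards [this] with f hf
  obtain ⟨g, hg, hfg⟩ := exists_strictMono_agree hf
  exact (hP _ _ hfg).2 (h g hg)

namespace DefinableFamily
variable {D : DefinableFamily M}

theorem con [Finite ξ] {Ψ : Set (ξ ⊕ τ → M)} (h : D.IsDef Ψ) (k : ℕ) : D.IsDef (Con Ψ k) := by
  have : D.IsDef {v : (Fin k × τ) ⊕ ξ → M | ∀ l : Fin k,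
      v ∈ {v | v ∘ Sum.elim Sum.inr (fun t => Sum.inl (l, t)) ∈ Ψ}} :=
    finite_inter fun l => D.reindex _ h
  convert D.proj this using 1
  ext u
  refine exists_congr fun x => forall_congr' fun l => ?_
  rw [iff_iff_eq]
  change (_ ∈ Ψ) = (_ ∈ Ψ)
  congr 1
  ext (i | i) <;> rfl

variable (D) in
/-- The part of `U` along `g` realises `R` generically over the part along `f`. -/
def Indep (U : Ultrafilter (γ → M)) (f : α → γ) (g : β → γ) (R : Ultrafilter (β → M)) : Prop :=
  D.Eqv (rs U (Sum.elim f g)) (tens (rs U f) R)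

theorem Indep.restrict {U : Ultrafilter (γ → M)} {f : α → γ} {g : β → γ} {R : Ultrafilter (β → M)}
    (h : D.Indep U f g R) (i : δ → α) (j : τ → β) : D.Indep U (f ∘ i) (g ∘ j) (rs R j) := by
  have := Eqv.restrict h (Sum.map i j)
  rwa [rs_rs, Sum.elim_comp_map, tens_rs, rs_rs] at this

theorem Indep.restrict_left {U : Ultrafilter (γ → M)} {f : α → γ} {g : β → γ}
    {R : Ultrafilter (β → M)} (h : D.Indep U f g R) (i : δ → α) : D.Indep U (f ∘ i) g R :=
  h.restrict i id

theorem eqv_ch_succ {U : Ultrafilter (γ → M)} {y : ℕ → τ → γ} {R : ℕ → Ultrafilter (τ → M)}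
    {k : ℕ} (h : D.Eqv (rs U (pre y k)) (ch R k)) (h' : D.Indep U (pre y k) (y k) (R k)) :
    D.Eqv (rs U (pre y (k + 1))) (ch R (k + 1)) := by
  rw [pre_succ, ← rs_rs]
  exact (Eqv.trans h' (h.prod _)).restrict _

theorem eqv_ch_zero (U : Ultrafilter (γ → M)) (y : ℕ → τ → γ) (R : ℕ → Ultrafilter (τ → M)) :
    D.Eqv (rs U (pre y 0)) (ch R 0) := by
  refine Eqv.of_eq (Ultrafilter.ext fun S => ?_)
  have : ∀ v : γ → M, v ∘ pre y 0 = fun p => p.1.elim0 := fun v => by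
    ext ⟨i, _⟩; exact i.elim0
  simp only [mem_rs, this, ch, Ultrafilter.mem_pure]
  exact eventually_const (f := (U : Filter (γ → M)))

theorem eqv_ch_of_indep {U : Ultrafilter (γ → M)} {y : ℕ → τ → γ} {R : ℕ → Ultrafilter (τ → M)}
    (h : ∀ k, D.Indep U (pre y k) (y k) (R k)) (k : ℕ) : D.Eqv (rs U (pre y k)) (ch R k) := by
  induction k with
  | zero => exact eqv_ch_zero U y R
  | succ k ih => exact eqv_ch_succ ih (h k)

theorem indep_block {U : Ultrafilter (γ → M)} {y : ℕ → τ → γ} {R : ℕ → Ultrafilter (τ → M)}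
    (h : ∀ k, D.Eqv (rs U (pre y k)) (ch R k)) (m k : ℕ) :
    D.Indep U (pre y m) (pre (fun i => y (m + i)) k) (ch (fun i => R (m + i)) k) := by
  have h1 := (h (m + k)).restrict (concatIdx m k)
  rw [rs_ch_add, rs_rs] at h1
  have h2 : pre y (m + k) ∘ concatIdx m k =
      Sum.elim (pre y m) (pre (fun i => y (m + i)) k) := by
    ext (⟨i, t⟩ | ⟨i, t⟩) <;> rfl
  rw [h2] at h1
  exact h1.trans ((h m).symm.prod _)

theorem indep_last {U : Ultrafilter (γ → M)} {y : ℕ → τ → γ} {R : ℕ → Ultrafilter (τ → M)}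
    (h : ∀ k, D.Eqv (rs U (pre y k)) (ch R k)) (k : ℕ) : D.Indep U (pre y k) (y k) (R k) := by
  have h1 := (h (k + 1)).restrict
    (Sum.elim (fun p : Fin k × τ => (Fin.castSucc p.1, p.2)) (fun t => (Fin.last k, t)))
  rw [rs_ch_succ, rs_rs, ← elim_pre] at h1
  exact h1.trans ((h k).symm.prod _)

theorem eqv_pw_comp {U : Ultrafilter (γ → M)} {y : ℕ → τ → γ} {Q : Ultrafilter (τ → M)}
    (h : ∀ k, D.Eqv (rs U (pre y k)) (pw Q k)) {f : ℕ → ℕ} (hf : StrictMono f) (k : ℕ) :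
    D.Eqv (rs U (pre (y ∘ f) k)) (pw Q k) :=
  eqv_ch_of_indep (fun k => (indep_last h (f k)).restrict_left
    fun p : Fin k × τ => (⟨f p.1, hf p.1.2⟩, p.2)) k

/-- Group a sequence of tuples into blocks of length `B`. -/
def blocks (B : ℕ) (y : ℕ → τ → γ) (l : ℕ) : Fin B × τ → γ := pre (fun i => y (l * B + i)) B

theorem eqv_pw_blocks {U : Ultrafilter (γ → M)} {y : ℕ → τ → γ} {Q : Ultrafilter (τ → M)}
    (h : ∀ k, D.Eqv (rs U (pre y k)) (pw Q k)) (B k : ℕ) :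
    D.Eqv (rs U (pre (blocks B y) k)) (pw (pw Q B) k) := by
  refine eqv_ch_of_indep (fun k => ?_) k
  have := (indep_block h (k * B) B).restrict_left
    fun p : Fin k × (Fin B × τ) => (⟨p.1 * B + p.2.1, by
      calc (p.1 : ℕ) * B + p.2.1 < p.1 * B + B := by omega
        _ = (p.1 + 1) * B := by ring
        _ ≤ k * B := Nat.mul_le_mul_right _ p.1.2⟩, p.2.2)
  exact this

variable (D) in
/-- The sequence part of `U` is indiscernible. -/
def Indisc (U : Ultrafilter (α ⊕ (ℕ × ζ) → M)) : Prop :=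
  ∀ f, StrictMono f → D.Eqv (rs U (shift f)) U

theorem localAt_shift {S : Set (α ⊕ (ℕ × ζ) → M)} (hS : D.IsDef S)
    (U : Ultrafilter (α ⊕ (ℕ × ζ) → M)) : ∃ k, LocalAt k fun f => S ∈ rs U (shift f) := by
  obtain ⟨F, S₀, -, rfl⟩ := D.support hS
  refine ⟨(F.sup fun x => Sum.elim (fun _ => 0) (fun p => p.1) x) + 1, fun f g hfg => ?_⟩
  have : ∀ v : α ⊕ (ℕ × ζ) → M, (fun i : F => (v ∘ shift f) i) = fun i : F => (v ∘ shift g) i := by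
    intro v
    ext ⟨x, hx⟩
    rcases x with a | ⟨l, z⟩
    · rfl
    · have h1 : l ≤ F.sup fun x => Sum.elim (fun _ => 0) (fun p => p.1) x :=
        Finset.le_sup (f := fun x => Sum.elim (fun _ => 0) (fun p : ℕ × ζ => p.1) x) hx
      simp [shift, hfg l (by omega)]
  change {v : α ⊕ (ℕ × ζ) → M | (fun i : F => (v ∘ shift f) i) ∈ S₀} ∈ U ↔ _
  simp only [this]
  exact Iff.rfl

/-- Extraction of an indiscernible sequence. -/
theorem exists_indisc (U : Ultrafilter (α ⊕ (ℕ × ζ) → M)) :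
    ∃ U' : Ultrafilter (α ⊕ (ℕ × ζ) → M), D.Indisc U' ∧
      ∀ S, D.IsDef S → (∀ f, StrictMono f → S ∈ rs U (shift f)) → S ∈ U' := by
  refine ⟨seqUlt.bind fun f => rs U (shift f), fun g hg => ?_, fun S hS h => ?_⟩
  · intro S hS
    obtain ⟨k, hk⟩ := localAt_shift hS U
    refine Iff.trans ?_ (eventually_seqUlt_comp hk hg)
    simp only [← shift_comp]
    exact Iff.rfl
  · obtain ⟨k, hk⟩ := localAt_shift hS U
    exact eventually_seqUlt_of_forall hk h

/-- Compactness: a type over a Morley sequence which is finitely consistent is realised. -/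
theorem exists_seq {P : Ultrafilter (τ ⊕ ζ → M)} {Q : Ultrafilter (δ → M)} (e : ζ → δ)
    (h : ∀ S, D.IsDef S → S ∈ P → ∀ N, {u : Fin N × δ → M | ∃ t : τ → M,
      ∀ l, Sum.elim t (fun z => u (l, e z)) ∈ S} ∈ pw Q N) :
    ∃ U : Ultrafilter (τ ⊕ (ℕ × δ) → M), (∀ k, rs U (pre seqIdx k) = pw Q k) ∧
      ∀ l, D.Eqv (rs U (Sum.elim Sum.inl (seqIdx l ∘ e))) P := by
  let F : Filter (τ ⊕ (ℕ × δ) → M) :=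
    { sets := {A | ∃ S, D.IsDef S ∧ S ∈ P ∧ ∃ N, ∃ A₀ ∈ pw Q N,
        {v | v ∘ pre seqIdx N ∈ A₀ ∧ ∀ l < N, v ∘ Sum.elim Sum.inl (seqIdx l ∘ e) ∈ S} ⊆ A}
      univ_sets := ⟨_, D.univ, Filter.univ_mem, 0, _, Filter.univ_mem, Set.subset_univ _⟩
      sets_of_superset := fun ⟨S, h1, h2, N, A₀, h3, h4⟩ hA => ⟨S, h1, h2, N, A₀, h3, h4.trans hA⟩
      inter_sets := by
        rintro A B ⟨S, h1, h2, N, A₀, h3, h4⟩ ⟨T, k1, k2, K, B₀, k3, k4⟩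
        have hpre : ∀ (N K : ℕ) (hNK : N ≤ K) (A₀ : Set (Fin N × δ → M)), A₀ ∈ pw Q N →
            {u | u ∘ (fun p : Fin N × δ => (Fin.castLE hNK p.1, p.2)) ∈ A₀} ∈ pw Q K := by
          intro N K hNK A₀ h
          obtain ⟨K, rfl⟩ := Nat.exists_eq_add_of_le hNK
          rw [pw, ← rs_ch_castAdd _ N K] at h
          exact h
        exact ⟨S ∩ T, D.inter h1 k1, inter_mem h2 k2, max N K, _,
          inter_mem (hpre N _ (le_max_left _ _) A₀ h3) (hpre K _ (le_max_right _ _) B₀ k3),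
          fun v hv => ⟨h4 ⟨hv.1.1, fun l hl => (hv.2 l (lt_max_of_lt_left hl)).1⟩,
            k4 ⟨hv.1.2, fun l hl => (hv.2 l (lt_max_of_lt_right hl)).2⟩⟩⟩ }
  have hne : F.NeBot := by
    rw [← forall_mem_nonempty_iff_neBot]
    rintro A ⟨S, h1, h2, N, A₀, h3, h4⟩
    obtain ⟨u, hu, t, ht⟩ := (pw Q N).nonempty_of_mem (inter_mem h3 (h S h1 h2 N))
    obtain ⟨w, -⟩ := Q.nonempty_of_mem Filter.univ_mem
    refine ⟨Sum.elim t fun p => if hp : p.1 < N then u (⟨p.1, hp⟩, p.2) else w p.2, h4 ⟨?_, ?_⟩⟩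
    · convert hu using 1
      ext ⟨i, z⟩
      simp [pre, seqIdx]
    · intro l hl
      convert ht ⟨l, hl⟩ using 1
      ext (a | z) <;> simp [seqIdx, hl]
  have hle := Ultrafilter.of_le F
  refine ⟨Ultrafilter.of F, fun k => Ultrafilter.eq_of_le fun A hA => ?_, fun l =>
    (Eqv.of_imp fun S hS hSP => ?_).symm⟩
  · exact hle ⟨_, D.univ, Filter.univ_mem, k, A, hA, fun v hv => hv.1⟩
  · exact hle ⟨S, hS, hSP, l + 1, _, Filter.univ_mem, fun v hv => hv.2 l (by omega)⟩

end DefinableFamily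
end

/-! ### Combinatorics of combs -/

/-- Combs in the tree of finite sequences of natural numbers, innermost element first. -/
inductive Comb : List (List ℕ) → Prop
  | single (ν : List ℕ) : Comb [ν]
  | child (i : ℕ) {l : List (List ℕ)} : Comb l → Comb (l.map (List.cons i))
  | ext {i j : ℕ} (ν : List ℕ) {l : List (List ℕ)} :
      j < i → Comb l → Comb (l.map (List.cons i) ++ [j :: ν])

theorem Comb.ne_nil {l : List (List ℕ)} (h : Comb l) : l ≠ [] := by
  induction h <;> simp_all

theorem Comb.graft {d : List (List ℕ)} (hd : Comb d) {l : List (List ℕ)} (hl : Comb l) :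
    ∀ {μ : List ℕ} {c : List (List ℕ)}, l = μ :: c → Comb (d.map (μ ++ ·) ++ c) := by
  induction hl with
  | single ν =>
    rintro μ c h
    obtain ⟨rfl, rfl⟩ : ν = μ ∧ c = [] := by simpa [eq_comm] using h
    rw [List.append_nil]
    induction ν with
    | nil => simpa using hd
    | cons a ν ih => simpa [Function.comp_def] using Comb.child a (ih rfl)
  | @child i l hl ih =>
    rintro μ c h
    obtain ⟨μ', c', rfl⟩ := List.exists_cons_of_ne_nil hl.ne_nil
    obtain ⟨rfl, rfl⟩ : i :: μ' = μ ∧ c'.map (List.cons i) = c := by simpa using h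
    simpa [Function.comp_def] using Comb.child i (ih rfl)
  | @ext i j ν l hji hl ih =>
    rintro μ c h
    obtain ⟨μ', c', rfl⟩ := List.exists_cons_of_ne_nil hl.ne_nil
    obtain ⟨rfl, rfl⟩ : i :: μ' = μ ∧ c'.map (List.cons i) ++ [j :: ν] = c := by simpa using h
    simpa [Function.comp_def] using Comb.ext ν hji (ih rfl)

/-- An abstract notion of consistency for sets of nodes under which paths are consistent and
combs of size `K` are inconsistent. -/
structure CombSystem (K : ℕ) (C : Set (List ℕ) → Prop) : Prop where
  mono : ∀ {F G : Set (List ℕ)}, F ⊆ G → C G → C F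
  map_iff : ∀ {g : ℕ → ℕ}, StrictMono g → ∀ {F : Set (List ℕ)}, F.Finite →
    (C (List.map g '' F) ↔ C F)
  path : ∀ p : List ℕ, C {ν | ν <+: p}
  comb : ∀ l, Comb l → l.length = K → ¬ C {ν | ν ∈ l}

/-- The nodes between `μ` and `μ ++ p`. -/
def chunk (μ p : List ℕ) : Set (List ℕ) := {ν | ∃ q, q <+: p ∧ ν = μ ++ q}

/-- A partial comb `κ` with a node `μ` at which it can be continued, all labels being below `B`. -/
inductive Reach : ℕ → List ℕ → List (List ℕ) → ℕ → Prop
  | base : Reach 0 [] [] 0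
  | step {j : ℕ} {μ : List ℕ} {κ : List (List ℕ)} {B i : ℕ} :
      Reach j μ κ B → B ≤ i → Reach j (μ ++ [i]) κ (i + 1)
  | branch {j : ℕ} {μ : List ℕ} {κ : List (List ℕ)} {B i a : ℕ} {ν : List ℕ} :
      Reach j μ κ B → B ≤ i → a < i → (∀ x ∈ ν, x < i) →
      Reach (j + 1) (μ ++ [i]) ((μ ++ a :: ν) :: κ) (i + 1)

theorem Reach.comb {j : ℕ} {μ : List ℕ} {κ : List (List ℕ)} {B : ℕ} (h : Reach j μ κ B) :
    κ.length = j ∧ ∀ ρ, Comb ((μ ++ ρ) :: κ) := by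
  induction h with
  | base => exact ⟨rfl, fun ρ => .single _⟩
  | @step j μ κ B i h hi ih => exact ⟨ih.1, fun ρ => by simpa using ih.2 (i :: ρ)⟩
  | @branch j μ κ B i a ν h hi ha hν ih =>
    refine ⟨by simp [ih.1], fun ρ => ?_⟩
    have := Comb.graft (Comb.ext ν ha (.single ρ)) (ih.2 []) rfl
    simpa using this

theorem Reach.lt {j : ℕ} {μ : List ℕ} {κ : List (List ℕ)} {B : ℕ} (h : Reach j μ κ B) :
    (∀ x ∈ μ, x < B) ∧ ∀ ν ∈ κ, ∀ x ∈ ν, x < B := by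
  induction h with
  | base => simp
  | @step j μ κ B i h hi ih =>
    refine ⟨?_, fun ν hν x hx => by have := ih.2 ν hν x hx; omega⟩
    simp only [List.mem_append, List.mem_singleton]
    rintro x (hx | rfl)
    · have := ih.1 x hx; omega
    · omega
  | @branch j μ κ B i a ν h hi ha hν ih =>
    constructor
    · simp only [List.mem_append, List.mem_singleton]
      rintro x (hx | rfl)
      · have := ih.1 x hx; omega
      · omega
    · simp only [List.mem_cons]
      rintro ρ (rfl | hρ) x hx
      · simp only [List.mem_append, List.mem_cons] at hx
        rcases hx with hx | rfl | hx
        · have := ih.1 x hx; omega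
        · omega
        · have := hν x hx; omega
      · have := ih.2 ρ hρ x hx; omega

theorem Reach.range' {j : ℕ} {μ : List ℕ} {κ : List (List ℕ)} {B : ℕ} (h : Reach j μ κ B) (n : ℕ) :
    Reach j (μ ++ List.range' B n) κ (B + n) := by
  induction n with
  | zero => simpa using h
  | succ n ih =>
    have := ih.step le_rfl
    rw [List.range'_concat]
    simpa [add_assoc] using this

theorem chunk_finite (μ p : List ℕ) : (chunk μ p).Finite := by
  have : chunk μ p = (μ ++ ·) '' {q | q ∈ p.inits} := by
    ext ν; simp [chunk, List.mem_inits, eq_comm]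
  rw [this]
  exact (List.finite_toSet _).image _

theorem chunk_mono {μ p q : List ℕ} (h : p <+: q) : chunk μ p ⊆ chunk μ q :=
  fun _ ⟨r, hr, hν⟩ => ⟨r, hr.trans h, hν⟩

theorem image_map_eq_self {g : ℕ → ℕ} {B : ℕ} (hg : ∀ x < B, g x = x) {μ : List ℕ}
    (h : ∀ x ∈ μ, x < B) : μ.map g = μ :=
  (List.map_congr_left fun x hx => hg x (h x hx)).trans (List.map_id' μ)

theorem CombSystem.chunk_iff {K : ℕ} {C : Set (List ℕ) → Prop} (hC : CombSystem K C)
    {μ : List ℕ} {κ : List (List ℕ)} {B : ℕ} (hμ : ∀ x ∈ μ, x < B)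
    (hκ : ∀ ν ∈ κ, ∀ x ∈ ν, x < B) {p : List ℕ} (hp : p.Pairwise (· < ·)) (hB : ∀ x ∈ p, B ≤ x) :
    C ({ν | ν ∈ κ} ∪ chunk μ p) ↔ C ({ν | ν ∈ κ} ∪ chunk μ (List.range' B p.length)) := by
  obtain ⟨g, hg, hgp⟩ := exists_strictMono_agree (k := B + p.length)
    (f := fun x => if x < B then x else p.getD (x - B) 0) (by
      intro j hj i hij
      split_ifs with h1 h2 h2
      · exact hij
      · rw [List.getD_eq_getElem _ _ (by omega)]
        exact lt_of_lt_of_le h1 (hB _ (List.getElem_mem _))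
      · omega
      · rw [List.getD_eq_getElem _ _ (by omega), List.getD_eq_getElem _ _ (by omega)]
        exact List.pairwise_iff_getElem.1 hp _ _ _ _ (by omega))
  have hgB : ∀ x < B, g x = x := fun x hx => by rw [← hgp x (by omega), if_pos hx]
  have hgp' : (List.range' B p.length).map g = p := by
    apply List.ext_getElem (by simp)
    intro i h1 h2
    rw [List.getElem_map, List.getElem_range', one_mul, ← hgp _ (by simpa using h2),
      if_neg (by omega),
      Nat.add_sub_cancel_left, List.getD_eq_getElem _ _ h2]
  rw [← hC.map_iff hg (F := {ν | ν ∈ κ} ∪ chunk μ (List.range' B p.length))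
    ((List.finite_toSet κ).union (chunk_finite _ _)), Set.image_union]
  have h1 : List.map g '' {ν | ν ∈ κ} = {ν | ν ∈ κ} := by
    ext ν
    constructor
    · rintro ⟨ν, hν, rfl⟩
      rwa [image_map_eq_self hgB (hκ ν hν)]
    · intro hν
      exact ⟨ν, hν, image_map_eq_self hgB (hκ ν hν)⟩
  have h2 : List.map g '' chunk μ (List.range' B p.length) = chunk μ p := by
    ext ν
    constructor
    · rintro ⟨-, ⟨q, hq, rfl⟩, rfl⟩
      refine ⟨q.map g, ?_, by rw [List.map_append, image_map_eq_self hgB hμ]⟩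
      rw [← hgp']; exact hq.map g
    · rintro ⟨q, hq, rfl⟩
      refine ⟨μ ++ (List.range' B p.length).take q.length, ⟨_, ⟨_, List.take_append_drop _ _⟩, rfl⟩, ?_⟩
      rw [List.map_append, image_map_eq_self hgB hμ, List.map_take, hgp',
        ← List.prefix_iff_eq_take.1 hq]
  rw [h1, h2]

/-- The number of labels used by the binary tree of chunks. -/
def chunkWidth (n : ℕ) : ℕ → ℕ
  | 0 => n
  | d + 1 => n + 2 + 2 * chunkWidth n d

/-- The starting nodes of a binary tree of chunks of length `n`. -/
def chunkNode (n : ℕ) : ℕ → List Bool → List ℕ → ℕ → List ℕ × ℕ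
  | d + 1, false :: η, μ, B => chunkNode n d η (μ ++ List.range' B n ++ [B + n]) (B + n + 1)
  | d + 1, true :: η, μ, B => chunkNode n d η (μ ++ List.range' B n ++ [B + n + 1 + chunkWidth n d])
      (B + n + 1 + chunkWidth n d + 1)
  | 0, _, μ, B => (μ, B)
  | _ + 1, [], μ, B => (μ, B)

theorem Reach.chunkNode (n d : ℕ) :
    ∀ {j : ℕ} {μ : List ℕ} {κ : List (List ℕ)} {B : ℕ} (η : List Bool),
    Reach j μ κ B → Reach j (chunkNode n d η μ B).1 κ (chunkNode n d η μ B).2 := by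
  induction d with
  | zero => intro j μ κ B η h; simpa [CanonicalCoheir.chunkNode] using h
  | succ d ih =>
    rintro j μ κ B (_ | ⟨_ | _, η⟩) h
    · simpa [CanonicalCoheir.chunkNode] using h
    · exact ih η ((h.range' n).step le_rfl)
    · exact ih η ((h.range' n).step (by omega))

theorem chunkNode_bound (n d : ℕ) : ∀ (μ : List ℕ) (B : ℕ) (η : List Bool),
    ∃ ρ, (chunkNode n d η μ B).1 = μ ++ ρ ∧ ∀ x ∈ ρ, x < B + chunkWidth n d := by
  induction d with
  | zero => intro μ B η; exact ⟨[], by simp [chunkNode]⟩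
  | succ d ih =>
    rintro μ B (_ | ⟨_ | _, η⟩)
    · exact ⟨[], by simp [chunkNode]⟩
    · obtain ⟨ρ, h1, h2⟩ := ih (μ ++ List.range' B n ++ [B + n]) (B + n + 1) η
      refine ⟨List.range' B n ++ (B + n) :: ρ, by rw [chunkNode, h1]; simp, ?_⟩
      simp only [List.mem_append, List.mem_cons, List.mem_range'_1, chunkWidth]
      rintro x (hx | rfl | hx)
      · omega
      · omega
      · have := h2 x hx; omega
    · obtain ⟨ρ, h1, h2⟩ := ih (μ ++ List.range' B n ++ [B + n + 1 + chunkWidth n d])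
        (B + n + 1 + chunkWidth n d + 1) η
      refine ⟨List.range' B n ++ (B + n + 1 + chunkWidth n d) :: ρ, by rw [chunkNode, h1]; simp, ?_⟩
      simp only [List.mem_append, List.mem_cons, List.mem_range'_1, chunkWidth]
      rintro x (hx | rfl | hx)
      · omega
      · omega
      · have := h2 x hx; omega

/-- The chunk attached to a node of the binary tree of chunks. -/
def treeChunk (n d : ℕ) (η : List Bool) (μ : List ℕ) (B : ℕ) : Set (List ℕ) :=
  chunk (chunkNode n d η μ B).1 (List.range' (chunkNode n d η μ B).2 n)

theorem treeChunk_path (n d : ℕ) : ∀ (μ : List ℕ) (B : ℕ) (σ : List Bool), σ.length ≤ d →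
    ∃ q : List ℕ, q.Pairwise (· < ·) ∧ (∀ x ∈ q, B ≤ x) ∧ q.length ≤ chunkWidth n d ∧
      ∀ l, treeChunk n d (σ.take l) μ B ⊆ chunk μ q := by
  have hroot : ∀ d (μ : List ℕ) B, treeChunk n d [] μ B = chunk μ (List.range' B n) := by
    intro d μ B; cases d <;> rfl
  have hsorted : ∀ B, (List.range' B n).Pairwise (· < ·) := fun B => List.pairwise_lt_range'
  have hw : ∀ d, n ≤ chunkWidth n d := by
    intro d; cases d <;> simp only [chunkWidth] <;> omega
  induction d with
  | zero =>
    intro μ B σ hσ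
    obtain rfl : σ = [] := List.length_eq_zero_iff.1 (by omega)
    exact ⟨List.range' B n, hsorted B, by simp [List.mem_range'_1]; omega, by simp [hw],
      by simp [hroot]⟩
  | succ d ih =>
    rintro μ B (_ | ⟨c, σ⟩) hσ
    · exact ⟨List.range' B n, hsorted B, by simp [List.mem_range'_1]; omega, by simp [hw],
      by simp [hroot]⟩
    · obtain ⟨x, hx, hc⟩ : ∃ x, B + n ≤ x ∧ ∀ η, treeChunk n (d + 1) (c :: η) μ B =
          treeChunk n d η (μ ++ List.range' B n ++ [x]) (x + 1) := by
        cases c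
        · exact ⟨_, le_rfl, fun η => rfl⟩
        · exact ⟨B + n + 1 + chunkWidth n d, by omega, fun η => rfl⟩
      obtain ⟨q, h1, h2, h3, h4⟩ := ih (μ ++ List.range' B n ++ [x]) (x + 1) σ (by simpa using hσ)
      refine ⟨List.range' B n ++ x :: q, ?_, ?_, ?_, ?_⟩
      · rw [List.pairwise_append, List.pairwise_cons]
        refine ⟨hsorted B, ⟨fun y hy => by have := h2 y hy; omega, h1⟩, fun a ha b hb => ?_⟩
        rw [List.mem_range'_1] at ha
        rcases List.mem_cons.1 hb with rfl | hb
        · omega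
        · have := h2 b hb; omega
      · intro y hy
        simp only [List.mem_append, List.mem_cons, List.mem_range'_1] at hy
        rcases hy with hy | rfl | hy
        · omega
        · omega
        · have := h2 y hy; omega
      · simp only [List.length_append, List.length_range', List.length_cons, chunkWidth]
        omega
      · rintro (_ | l)
        · rw [List.take_zero, hroot]
          exact chunk_mono (List.prefix_append _ _)
        · rw [List.take_succ_cons, hc]
          refine (h4 l).trans ?_
          rintro ν ⟨q', hq', rfl⟩
          exact ⟨List.range' B n ++ x :: q', by simpa using hq', by simp⟩

theorem treeChunk_incomparable {K : ℕ} {C : Set (List ℕ) → Prop} (hC : CombSystem K C) {n j : ℕ}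
    (hn : ∀ μ κ B, Reach (j + 1) μ κ B → ¬ C ({ν | ν ∈ κ} ∪ chunk μ (List.range' B n))) (d : ℕ) :
    ∀ {μ : List ℕ} {κ : List (List ℕ)} {B : ℕ}, Reach j μ κ B → ∀ η η' : List Bool,
      η.length ≤ d → η'.length ≤ d → ¬ η <+: η' → ¬ η' <+: η →
      ¬ C ({ν | ν ∈ κ} ∪ treeChunk n d η μ B ∪ treeChunk n d η' μ B) := by
  have key : ∀ {d : ℕ} {μ : List ℕ} {κ : List (List ℕ)} {B : ℕ}, Reach j μ κ B → ∀ η η' : List Bool,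
      ¬ C ({ν | ν ∈ κ} ∪ treeChunk n (d + 1) (false :: η) μ B ∪
        treeChunk n (d + 1) (true :: η') μ B) := by
    intro d μ κ B h η η' hcon
    obtain ⟨ρ, h1, h2⟩ := chunkNode_bound n d (μ ++ List.range' B n ++ [B + n]) (B + n + 1) η
    have h3 := ((h.range' n).branch (i := B + n + 1 + chunkWidth n d) (a := B + n) (ν := ρ)
      (by omega) (by omega) h2).chunkNode n d η'
    refine hn _ _ _ h3 (hC.mono ?_ hcon)
    rintro ν (hν | hν)
    · rcases List.mem_cons.1 hν with rfl | hν
      · refine Or.inl (Or.inr ⟨[], ⟨_, rfl⟩, ?_⟩)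
        rw [List.append_nil, chunkNode, h1]; simp
      · exact Or.inl (Or.inl hν)
    · exact Or.inr hν
  induction d with
  | zero =>
    intro μ κ B h η η' hη hη' h1
    obtain rfl : η = [] := List.length_eq_zero_iff.1 (by omega)
    exact absurd ⟨_, rfl⟩ h1
  | succ d ih =>
    rintro μ κ B h (_ | ⟨c, η⟩) (_ | ⟨c', η'⟩) hη hη' h1 h2
    · exact absurd ⟨_, rfl⟩ h1
    · exact absurd ⟨_, rfl⟩ h1
    · exact absurd ⟨_, rfl⟩ h2
    · rcases c with _ | _ <;> rcases c' with _ | _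
      · exact ih ((h.range' n).step le_rfl) η η' (by simpa using hη) (by simpa using hη')
          (by simpa using h1) (by simpa using h2)
      · exact key h η η'
      · rw [Set.union_right_comm]
        exact key h η' η
      · exact ih ((h.range' n).step (by omega)) η η' (by simpa using hη) (by simpa using hη')
          (by simpa using h1) (by simpa using h2)

theorem CombSystem.exists_tree {K : ℕ} (hK : 0 < K) {C : Set (List ℕ) → Prop}
    (hC : CombSystem K C) :
    ∃ (ι : Type) (_ : Finite ι), ∀ N : ℕ, ∃ A : List Bool → ι → List ℕ,
      (∀ σ : List Bool, σ.length ≤ N → C {ν | ∃ l i, ν = A (σ.take l) i}) ∧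
      ∀ η η' : List Bool, η.length ≤ N → η'.length ≤ N → ¬ η <+: η' → ¬ η' <+: η →
        ¬ C (Set.range (A η) ∪ Set.range (A η')) := by
  let Good : ℕ → Prop := fun j => ∀ n, ∃ μ κ B, Reach j μ κ B ∧
    C ({ν | ν ∈ κ} ∪ chunk μ (List.range' B n))
  have h0 : Good 0 := fun n => ⟨[], [], 0, .base, by
    refine hC.mono ?_ (hC.path (List.range' 0 n))
    rintro ν (hν | ⟨q, hq, rfl⟩)
    · simp at hν
    · exact hq⟩
  have hKn : ¬ Good (K - 1) := by
    intro h
    obtain ⟨μ, κ, B, hr, hc⟩ := h 0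
    refine hC.comb _ (hr.comb.2 []) (by simp [hr.comb.1]; omega) (hC.mono ?_ hc)
    intro ν hν
    rcases List.mem_cons.1 hν with rfl | hν
    · exact Or.inr ⟨[], ⟨_, rfl⟩, rfl⟩
    · exact Or.inl hν
  obtain ⟨j, hj, hj'⟩ : ∃ j, Good j ∧ ¬ Good (j + 1) := by
    by_contra! hcon
    exact hKn (Nat.rec h0 (fun j hj => hcon j hj) (K - 1))
  simp only [Good] at hj'
  push Not at hj'
  obtain ⟨n, hn⟩ := hj'
  refine ⟨Fin j ⊕ Fin (n + 1), inferInstance, fun N => ?_⟩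
  obtain ⟨μ, κ, B, hr, hc⟩ := hj (chunkWidth n N)
  let A : List Bool → Fin j ⊕ Fin (n + 1) → List ℕ := fun η => Sum.elim
    (fun i => κ.getD i [])
    fun i => (chunkNode n N η μ B).1 ++ (List.range' (chunkNode n N η μ B).2 n).take i
  have hA : ∀ η, Set.range (A η) = {ν | ν ∈ κ} ∪ treeChunk n N η μ B := by
    intro η
    rw [Set.Sum.elim_range]
    congr 1
    · ext ν
      constructor
      · rintro ⟨i, rfl⟩
        have : (i : ℕ) < κ.length := by rw [hr.comb.1]; exact i.2
        change κ.getD i [] ∈ κ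
        rw [List.getD_eq_getElem _ _ this]
        exact List.getElem_mem _
      · intro hν
        obtain ⟨i, hi, rfl⟩ := List.getElem_of_mem hν
        exact ⟨⟨i, by rwa [← hr.comb.1]⟩, List.getD_eq_getElem _ _ hi⟩
    · ext ν
      constructor
      · rintro ⟨i, rfl⟩
        exact ⟨_, ⟨_, List.take_append_drop _ _⟩, rfl⟩
      · rintro ⟨q, hq, rfl⟩
        refine ⟨⟨q.length, by have := hq.length_le; simp at this; omega⟩, ?_⟩
        dsimp only
        rw [← List.prefix_iff_eq_take.1 hq]
  refine ⟨A, fun σ hσ => ?_, fun η η' hη hη' h1 h2 => ?_⟩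
  · obtain ⟨q, h1, h2, h3, h4⟩ := treeChunk_path n N μ B σ hσ
    have h5 : C ({ν | ν ∈ κ} ∪ chunk μ q) := by
      rw [hC.chunk_iff hr.lt.1 hr.lt.2 h1 h2]
      refine hC.mono (Set.union_subset_union_right _ (chunk_mono ?_)) hc
      obtain ⟨m, hm⟩ := Nat.exists_eq_add_of_le h3
      rw [hm, ← List.range'_append_1]
      exact List.prefix_append _ _
    refine hC.mono ?_ h5
    rintro ν ⟨l, i, rfl⟩
    have : A (σ.take l) i ∈ Set.range (A (σ.take l)) := ⟨i, rfl⟩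
    rw [hA] at this
    rcases this with h | h
    · exact Or.inl h
    · exact Or.inr (h4 l h)
  · refine fun hcon => treeChunk_incomparable hC hn N hr η η' hη hη' h1 h2 (hC.mono ?_ hcon)
    rw [hA, hA]
    rintro ν ((h | h) | h)
    · exact Or.inl (Or.inl h)
    · exact Or.inl (Or.inr h)
    · exact Or.inr (Or.inr h)

section

variable {M : Type u} {ξ τ : Type}

/-- Some definable set has finite binary trees of arbitrary height with consistent branches and
incomparable nodes pairwise inconsistent. -/
def DefinableFamily.HasBinaryPattern (D : DefinableFamily M) : Prop :=
  ∃ (ξ υ : Type) (_ : Finite ξ) (_ : Finite υ) (Θ : Set (ξ ⊕ υ → M)), D.IsDef Θ ∧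
    ∀ N : ℕ, ∃ b : List Bool → υ → M,
      (∀ σ : List Bool, σ.length ≤ N → ∃ x, ∀ l, Sum.elim x (b (σ.take l)) ∈ Θ) ∧
      ∀ η η' : List Bool, η.length ≤ N → η'.length ≤ N → ¬ η <+: η' → ¬ η' <+: η →
        ¬ ∃ x, Sum.elim x (b η) ∈ Θ ∧ Sum.elim x (b η') ∈ Θ

/-- There are finite trees of arbitrary height and width in which paths are consistent and combs
of size `K` are inconsistent. -/
def TreeProp (Ψ : Set (ξ ⊕ τ → M)) (K : ℕ) : Prop :=
  ∀ n : ℕ, ∃ T : Ultrafilter (List ℕ → τ → M),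
    (∀ p : List ℕ, p.length ≤ n → (∀ x ∈ p, x ≤ n) →
      ∀ᶠ v in (T : Filter (List ℕ → τ → M)), ∃ x, ∀ l, Sum.elim x (v (p.take l)) ∈ Ψ) ∧
    ∀ l, Comb l → l.length = K → (∀ ν ∈ l, ν.length ≤ n ∧ ∀ x ∈ ν, x ≤ n) →
      ∀ᶠ v in (T : Filter (List ℕ → τ → M)), ¬ ∃ x, ∀ ν ∈ l, Sum.elim x (v ν) ∈ Ψ

theorem Comb.map {f : ℕ → ℕ} (hf : StrictMono f) {l : List (List ℕ)} (h : Comb l) :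
    Comb (l.map (List.map f)) := by
  induction h with
  | single ν => exact .single _
  | @child i l _ ih => simpa [Function.comp_def] using ih.child (f i)
  | @ext i j ν l hji _ ih => simpa [Function.comp_def] using ih.ext (ν.map f) (hf hji)

theorem eventually_hyperfilter_ge (k : ℕ) : ∀ᶠ n in (hyperfilter ℕ : Filter ℕ), k ≤ n := by
  have : ∀ᶠ n in atTop, k ≤ n := eventually_ge_atTop k
  rw [← Nat.cofinite_eq_atTop] at this
  exact hyperfilter_le_cofinite this

/-- Consistency, in the limit, of the image of a set of nodes under `f`. -/
def LimitCon (Ψ : Set (ξ ⊕ τ → M)) (T : ℕ → Ultrafilter (List ℕ → τ → M)) (F : Set (List ℕ))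
    (f : ℕ → ℕ) : Prop :=
  ∀ᶠ n in (hyperfilter ℕ : Filter ℕ), ∀ᶠ v in (T n : Filter (List ℕ → τ → M)),
    ∃ x, ∀ ν ∈ F, Sum.elim x (v (ν.map f)) ∈ Ψ

theorem LimitCon.localAt (Ψ : Set (ξ ⊕ τ → M)) (T : ℕ → Ultrafilter (List ℕ → τ → M))
    {F : Set (List ℕ)} (hF : F.Finite) : ∃ k, LocalAt k (LimitCon Ψ T F) := by
  refine ⟨(hF.toFinset.sup fun ν => ν.sum) + 1, fun f g hfg => ?_⟩
  have : ∀ ν ∈ F, ν.map f = ν.map g := by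
    intro ν hν
    refine List.map_congr_left fun x hx => hfg x ?_
    have h1 : ν.sum ≤ hF.toFinset.sup fun ν => ν.sum :=
      Finset.le_sup (f := fun ν : List ℕ => ν.sum) (hF.mem_toFinset.2 hν)
    have h2 : x ≤ ν.sum := List.single_le_sum (fun _ _ => Nat.zero_le _) x hx
    omega
  unfold LimitCon
  have h : ∀ (v : List ℕ → τ → M) x, (∀ ν ∈ F, Sum.elim x (v (ν.map f)) ∈ Ψ) ↔
      ∀ ν ∈ F, Sum.elim x (v (ν.map g)) ∈ Ψ := fun v x =>
    forall₂_congr fun ν hν => by rw [this ν hν]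
  simp only [h]

theorem TreeProp.combSystem {Ψ : Set (ξ ⊕ τ → M)} {K : ℕ}
    {T : ℕ → Ultrafilter (List ℕ → τ → M)}
    (hT : ∀ n, (∀ p : List ℕ, p.length ≤ n → (∀ x ∈ p, x ≤ n) →
      ∀ᶠ v in (T n : Filter (List ℕ → τ → M)), ∃ x, ∀ l, Sum.elim x (v (p.take l)) ∈ Ψ) ∧
    ∀ l, Comb l → l.length = K → (∀ ν ∈ l, ν.length ≤ n ∧ ∀ x ∈ ν, x ≤ n) →
      ∀ᶠ v in (T n : Filter (List ℕ → τ → M)), ¬ ∃ x, ∀ ν ∈ l, Sum.elim x (v ν) ∈ Ψ) :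
    CombSystem K fun F => ∀ᶠ f in (seqUlt : Filter (ℕ → ℕ)), LimitCon Ψ T F f where
  mono := by
    intro F G hFG h
    filter_upwards [h] with f hf
    filter_upwards [hf] with n hn
    filter_upwards [hn] with v ⟨x, hx⟩
    exact ⟨x, fun ν hν => hx ν (hFG hν)⟩
  map_iff := by
    intro g hg F hF
    obtain ⟨k, hk⟩ := LimitCon.localAt Ψ T hF
    rw [← eventually_seqUlt_comp hk hg]
    unfold LimitCon
    simp only [Set.forall_mem_image, List.map_map]
  path := by
    intro p
    have hfin : {ν | ν <+: p}.Finite := by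
      refine (List.finite_toSet p.inits).subset fun ν hν => ?_
      exact (List.mem_inits _ _).2 hν
    obtain ⟨k, hk⟩ := LimitCon.localAt Ψ T hfin
    refine eventually_seqUlt_of_forall hk fun f hf => ?_
    filter_upwards [eventually_hyperfilter_ge p.length,
      eventually_hyperfilter_ge (p.map f).sum] with n h1 h2
    filter_upwards [(hT n).1 (p.map f) (by simpa using h1) fun x hx =>
      (List.single_le_sum (fun _ _ => Nat.zero_le _) x hx).trans h2] with v ⟨x, hx⟩
    refine ⟨x, fun ν hν => ?_⟩
    have := hx ν.length
    rwa [← List.map_take, ← List.prefix_iff_eq_take.1 hν] at this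
  comb := by
    intro l hl hlK
    obtain ⟨k, hk⟩ := LimitCon.localAt Ψ T (List.finite_toSet l)
    rw [← Ultrafilter.eventually_not]
    have hk' : LocalAt k fun f => ¬ LimitCon Ψ T {ν | ν ∈ l} f := fun f g h => not_congr (hk f g h)
    refine eventually_seqUlt_of_forall hk' fun f hf => ?_
    change ¬ (∀ᶠ n in (hyperfilter ℕ : Filter ℕ), _)
    rw [← Ultrafilter.eventually_not]
    filter_upwards [eventually_hyperfilter_ge (l.map List.length).sum,
      eventually_hyperfilter_ge (l.map fun ν => (ν.map f).sum).sum] with n h1 h2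
    rw [← Ultrafilter.eventually_not]
    filter_upwards [(hT n).2 (l.map (List.map f)) (hl.map hf) (by simpa using hlK) (by
      intro ν hν
      obtain ⟨μ, hμ, rfl⟩ := List.mem_map.1 hν
      refine ⟨?_, fun x hx => ?_⟩
      · rw [List.length_map]
        exact (List.single_le_sum (fun _ _ => Nat.zero_le _) _
          (List.mem_map_of_mem (f := List.length) hμ)).trans h1
      · exact (List.single_le_sum (fun _ _ => Nat.zero_le _) x hx).trans
          ((List.single_le_sum (fun _ _ => Nat.zero_le _) _
            (List.mem_map_of_mem (f := fun ν : List ℕ => (ν.map f).sum) hμ)).trans h2))] with v hv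
    rintro ⟨x, hx⟩
    exact hv ⟨x, by simpa using hx⟩

theorem TreeProp.hasBinaryPattern {D : DefinableFamily M} [Finite ξ] [Finite τ]
    {Ψ : Set (ξ ⊕ τ → M)} (hΨ : D.IsDef Ψ) {K : ℕ} (hK : 0 < K) (h : TreeProp Ψ K) :
    D.HasBinaryPattern := by
  choose T hT using h
  obtain ⟨ι, _, hA⟩ := (TreeProp.combSystem hT).exists_tree hK
  refine ⟨ξ, ι × τ, inferInstance, inferInstance,
    {w | ∀ i : ι, w ∈ {w : ξ ⊕ (ι × τ) → M | w ∘ Sum.map id (Prod.mk i) ∈ Ψ}},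
    DefinableFamily.finite_inter fun i => D.reindex _ hΨ, fun N => ?_⟩
  obtain ⟨A, hA1, hA2⟩ := hA N
  have hfin : {σ : List Bool | σ.length ≤ N}.Finite := List.finite_length_le Bool N
  have hfin2 : {p : List Bool × List Bool | (p.1.length ≤ N ∧ p.2.length ≤ N) ∧
      ¬ p.1 <+: p.2 ∧ ¬ p.2 <+: p.1}.Finite :=
    (hfin.prod hfin).subset fun p hp => hp.1
  have e1 := (eventually_all_finite hfin).2 hA1
  have e2 := (eventually_all_finite hfin2).2 fun p hp => Ultrafilter.eventually_not.2
    (hA2 p.1 p.2 hp.1.1 hp.1.2 hp.2.1 hp.2.2)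
  obtain ⟨f, hf1, hf2⟩ := (e1.and e2).exists
  have e3 := (eventually_all_finite hfin).2 hf1
  have e4 := (eventually_all_finite hfin2).2 fun p hp => Ultrafilter.eventually_not.2 (hf2 p hp)
  obtain ⟨n, hn1, hn2⟩ := (e3.and e4).exists
  have e5 := (eventually_all_finite hfin).2 hn1
  have e6 := (eventually_all_finite hfin2).2 fun p hp => Ultrafilter.eventually_not.2 (hn2 p hp)
  obtain ⟨v, hv1, hv2⟩ := (e5.and e6).exists
  have helim : ∀ (x : ξ → M) (w : ι × τ → M) (i : ι),
      Sum.elim x w ∘ Sum.map id (Prod.mk i) = Sum.elim x fun t => w (i, t) := by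
    intro x w i
    ext (a | a) <;> rfl
  refine ⟨fun η p => v ((A η p.1).map f) p.2, fun σ hσ => ?_, fun η η' h1 h2 h3 h4 => ?_⟩
  · obtain ⟨x, hx⟩ := hv1 σ hσ
    refine ⟨x, fun l i => ?_⟩
    change _ ∘ _ ∈ Ψ
    rw [helim]
    exact hx _ ⟨l, i, rfl⟩
  · rintro ⟨x, hx, hx'⟩
    refine hv2 (η, η') ⟨⟨h1, h2⟩, h3, h4⟩ ⟨x, ?_⟩
    rintro ν (⟨i, rfl⟩ | ⟨i, rfl⟩)
    · have := hx i
      change _ ∘ _ ∈ Ψ at this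
      rwa [helim] at this
    · have := hx' i
      change _ ∘ _ ∈ Ψ at this
      rwa [helim] at this

end

section

variable {M : Type u} {α β γ δ ξ τ : Type}

/-- The indices of the non-root variables in a tree of tuples of height `n` and width `b + 1`. -/
def Branches (τ β : Type) (b : ℕ) : ℕ → Type
  | 0 => β
  | n + 1 => Fin (b + 1) × (τ ⊕ Branches τ β b n)

instance Branches.finite (τ β : Type) [Finite τ] [Finite β] (b n : ℕ) :
    Finite (Branches τ β b n) := by
  induction n with
  | zero => assumption
  | succ n ih => exact inferInstanceAs (Finite (Fin (b + 1) × (τ ⊕ Branches τ β b n)))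

/-- The inclusion of a subtree. -/
def childIdx {b n : ℕ} (c : Fin (b + 1)) : τ ⊕ Branches τ β b n → τ ⊕ Branches τ β b (n + 1) :=
  fun z => Sum.inr (c, z)

/-- The reversed position of a label. -/
def revLabel (b i : ℕ) : Fin (b + 1) := ⟨b - i, by omega⟩

/-- The indices of the variables at a node of a tree of tuples. -/
def nodeIdx (b : ℕ) : (n : ℕ) → List ℕ → τ → τ ⊕ Branches τ β b n
  | 0, _ => Sum.inl
  | _ + 1, [] => Sum.inl
  | n + 1, i :: ν => childIdx (revLabel b i) ∘ nodeIdx b n ν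

theorem nodeIdx_nil (b n : ℕ) : (nodeIdx b n [] : τ → τ ⊕ Branches τ β b n) = Sum.inl := by
  cases n <;> rfl

namespace DefinableFamily
variable {D : DefinableFamily M}

theorem indep_of_isEmpty [IsEmpty α] (U : Ultrafilter (γ → M)) (f : α → γ) (g : β → γ) :
    D.Indep U f g (rs U g) := by
  refine Eqv.of_eq (Ultrafilter.ext fun S => ?_)
  have : ∀ v v' : γ → M, v ∘ f = v' ∘ f := fun v v' => Subsingleton.elim _ _
  simp only [mem_tens, mem_rs]
  have h : ∀ v' : γ → M, {v : γ → M | Sum.elim (v ∘ f) (v' ∘ g) ∈ S} ∈ U ↔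
      v' ∘ Sum.elim f g ∈ S := by
    intro v'
    rw [Sum.comp_elim]
    simp only [this _ v']
    exact eventually_const (f := (U : Filter (γ → M)))
  change _ ↔ {v' : γ → M | {v : γ → M | Sum.elim (v ∘ f) (v' ∘ g) ∈ S} ∈ U} ∈ U
  simp only [h]

theorem eqv_ch_one (U : Ultrafilter (γ → M)) (y : ℕ → τ → γ) :
    D.Eqv (rs U (pre y 1)) (ch (fun _ => rs U (y 0)) 1) :=
  eqv_ch_succ (R := fun _ => rs U (y 0)) (eqv_ch_zero U y _)
    (have : IsEmpty (Fin 0 × τ) := inferInstance; indep_of_isEmpty U _ _)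

theorem AdmAll.exists_pw [Finite γ] {X : Ultrafilter (γ → M)} (hX : D.AdmAll X) (m : ℕ) :
    ∃ Y : Ultrafilter (Fin (m + 1) × γ → M), D.AdmAll Y ∧ D.Eqv Y (pw X (m + 1)) ∧
      ∀ c, rs Y (Prod.mk c) = X := by
  induction m with
  | zero =>
    have : (pre (fun _ => id) 1 : Fin 1 × γ → γ) = Prod.snd := rfl
    exact ⟨rs X Prod.snd, hX.restrict _, eqv_ch_one X fun _ => id, fun c => rs_id X⟩
  | succ m ih =>
    obtain ⟨Y, h1, h2, h3⟩ := ih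
    obtain ⟨Q, hQ, hQ2, hQl, hQr⟩ := h1.exists_pair (g := id) (Eqv.refl _)
    let e : (Fin (m + 1) × γ) ⊕ γ → (Fin (m + 1) × γ) ⊕ (Fin (m + 1) × γ) :=
      Sum.map id (Prod.mk 0)
    refine ⟨rs Q (e ∘ splitLast (m + 1)), hQ.restrict _, ?_, fun c => ?_⟩
    · rw [← rs_rs]
      refine Eqv.restrict (V := tens (pw X (m + 1)) X) ?_ _
      have := hQ2.restrict e
      rw [tens_rs, rs_id, h3] at this
      exact this.trans (h2.prod _)
    · by_cases hc : (c : ℕ) < m + 1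
      · have : (e ∘ splitLast (m + 1)) ∘ Prod.mk c =
            (Sum.inl ∘ id) ∘ (Prod.mk ⟨c, hc⟩ : γ → _) := by
          ext z; simp [splitLast, hc, e]
        rw [rs_rs, this, ← rs_rs, hQl, h3]
      · have : (e ∘ splitLast (m + 1)) ∘ Prod.mk c =
            (Sum.inr ∘ id) ∘ (Prod.mk 0 : γ → Fin (m + 1) × γ) := by
          ext z; simp [splitLast, hc, e]
        rw [rs_rs, this, ← rs_rs, hQr, h3]

theorem rs_ch_coord (R : ℕ → Ultrafilter (τ → M)) {k : ℕ} (c : Fin k) :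
    rs (ch R k) (Prod.mk c) = R c := by
  induction k with
  | zero => exact c.elim0
  | succ k ih =>
    rw [ch, rs_rs]
    by_cases hc : (c : ℕ) < k
    · have : splitLast k ∘ Prod.mk c = Sum.inl ∘ (Prod.mk ⟨c, hc⟩ : τ → Fin k × τ) := by
        ext t; simp [splitLast, hc]
      rw [this, ← rs_rs, rs_tens_inl, ih]
    · have : splitLast k ∘ Prod.mk c = (Sum.inr : τ → (Fin k × τ) ⊕ τ) := by
        ext t; simp [splitLast, hc]
      rw [this, rs_tens_inr, show (c : ℕ) = k by omega]

theorem rs_ch_pair (R : ℕ → Ultrafilter (τ → M)) {k : ℕ} {c c' : Fin k} (hcc : c < c') :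
    rs (ch R k) (Sum.elim (Prod.mk c) (Prod.mk c')) = tens (R c) (R c') := by
  induction k with
  | zero => exact c.elim0
  | succ k ih =>
    have hc : (c : ℕ) < k := by omega
    rw [ch, rs_rs]
    by_cases hc' : (c' : ℕ) < k
    · have : splitLast k ∘ Sum.elim (Prod.mk c) (Prod.mk c') =
          Sum.inl ∘ Sum.elim (Prod.mk ⟨c, hc⟩) (Prod.mk ⟨c', hc'⟩ : τ → Fin k × τ) := by
        ext (t | t) <;> simp [splitLast, hc, hc']
      rw [this, ← rs_rs, rs_tens_inl, ih hcc]
    · have : splitLast k ∘ Sum.elim (Prod.mk c) (Prod.mk c') =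
          Sum.map (Prod.mk ⟨c, hc⟩ : τ → Fin k × τ) id := by
        ext (t | t) <;> simp [splitLast, hc, hc']
      rw [this, tens_rs, rs_id, rs_ch_coord, show (c' : ℕ) = k by omega]

variable (D) in
/-- All nodes have types in `𝒞`, and combs are generic chains of such types. -/
structure CombTree (𝒞 : Set (Ultrafilter (τ → M))) (b n : ℕ)
    (X : Ultrafilter (τ ⊕ Branches τ β b n → M)) : Prop where
  node : ∀ ν, rs X (nodeIdx b n ν) ∈ 𝒞
  comb : ∀ l, Comb l → (∀ ν ∈ l, ν.length ≤ n ∧ ∀ x ∈ ν, x ≤ b) → ∀ k, l.length = k →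
    ∃ R : ℕ → Ultrafilter (τ → M), (∀ i, R i ∈ 𝒞) ∧
      D.Eqv (rs X (pre (fun i => nodeIdx b n (l.getD i [])) k)) (ch R k)

theorem CombTree.comb_single {𝒞 : Set (Ultrafilter (τ → M))} {b n : ℕ}
    {X : Ultrafilter (τ ⊕ Branches τ β b n → M)} (h : ∀ ν, rs X (nodeIdx b n ν) ∈ 𝒞)
    (ν : List ℕ) (k : ℕ) (hk : [ν].length = k) :
    ∃ R : ℕ → Ultrafilter (τ → M), (∀ i, R i ∈ 𝒞) ∧
      D.Eqv (rs X (pre (fun i => nodeIdx b n ([ν].getD i [])) k)) (ch R k) := by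
  subst hk
  exact ⟨_, fun _ => h _, eqv_ch_one X _⟩

theorem CombTree.zero {𝒞 : Set (Ultrafilter (τ → M))} {b : ℕ}
    {X : Ultrafilter (τ ⊕ Branches τ β b 0 → M)} (h : rs X Sum.inl ∈ 𝒞) : D.CombTree 𝒞 b 0 X where
  node _ := h
  comb := by
    rintro _ (ν | @⟨i, l, hl⟩ | @⟨i, j, ν, l, hji, hl⟩) hval k hk
    · exact CombTree.comb_single (fun _ => h) ν k hk
    · obtain ⟨μ, l, rfl⟩ := List.exists_cons_of_ne_nil hl.ne_nil
      simp at hval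
    · have := (hval (j :: ν) (by simp)).1
      simp at this

theorem ch_congr {R R' : ℕ → Ultrafilter (τ → M)} {k : ℕ} (h : ∀ i < k, R i = R' i) :
    ch R k = ch R' k := by
  induction k with
  | zero => rfl
  | succ k ih => rw [ch, ch, ih fun i hi => h i (by omega), h k (by omega)]

theorem CombTree.succ {𝒞 : Set (Ultrafilter (τ → M))} {b n : ℕ}
    {X : Ultrafilter (τ ⊕ Branches τ β b n → M)} (h : D.CombTree 𝒞 b n X)
    {X' : Ultrafilter (τ ⊕ Branches τ β b (n + 1) → M)}
    (hnode : ∀ ν, rs X' (nodeIdx b (n + 1) ν) ∈ 𝒞)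
    (hchild : ∀ c, D.Eqv (rs X' (childIdx c)) X)
    (hpair : ∀ c c', c < c' → D.Eqv (rs X' (Sum.elim (childIdx c) (childIdx c'))) (tens X X)) :
    D.CombTree 𝒞 b (n + 1) X' where
  node := hnode
  comb := by
    have key : ∀ (i : ℕ) (l : List (List ℕ)) (l' : List (List ℕ)), pre (fun a => nodeIdx b (n + 1)
        ((l.map (List.cons i) ++ l').getD a [])) l.length = (childIdx (revLabel b i) ∘
          pre (fun a => nodeIdx b n (l.getD a [])) l.length :
          Fin l.length × τ → τ ⊕ Branches τ β b (n + 1)) := by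
      rintro i l l'
      ext ⟨a, t⟩
      have h1 : (l.map (List.cons i) ++ l').getD a [] = i :: l.getD a [] := by
        rw [List.getD_append _ _ _ _ (by simp), List.getD_eq_getElem _ _ (by simp),
          List.getElem_map, List.getD_eq_getElem]
      change nodeIdx b (n + 1) ((l.map (List.cons i) ++ l').getD a []) t = _
      rw [h1]
      rfl
    have hvalid : ∀ {i : ℕ} {l : List (List ℕ)} {l' : List (List ℕ)},
        (∀ ν ∈ l.map (List.cons i) ++ l', ν.length ≤ n + 1 ∧ ∀ x ∈ ν, x ≤ b) →
        ∀ ν ∈ l, ν.length ≤ n ∧ ∀ x ∈ ν, x ≤ b := by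
      intro i l l' hval ν hν
      obtain ⟨h1, h2⟩ := hval (i :: ν) (by simp [hν])
      exact ⟨by simpa using h1, fun x hx => h2 x (by simp [hx])⟩
    rintro _ (ν | @⟨i, l, hl⟩ | @⟨i, j, ν, l, hji, hl⟩) hval k hk
    · exact CombTree.comb_single hnode ν k hk
    · obtain rfl : l.length = k := by simpa using hk
      obtain ⟨R, hR, hR'⟩ := h.comb l hl (hvalid (l' := []) (by simpa using hval)) _ rfl
      refine ⟨R, hR, ?_⟩
      have := key i l []
      rw [List.append_nil] at this
      rw [this, ← rs_rs]
      exact ((hchild _).restrict _).trans hR'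
    · obtain rfl : l.length + 1 = k := by simpa using hk
      obtain ⟨R, hR, hR'⟩ := h.comb l hl (hvalid hval) _ rfl
      have hi : i ≤ b := by
        obtain ⟨μ, l, rfl⟩ := List.exists_cons_of_ne_nil hl.ne_nil
        exact (hval (i :: μ) (by simp)).2 i (by simp)
      refine ⟨Function.update R l.length (rs X (nodeIdx b n ν)), fun a => ?_, ?_⟩
      · by_cases ha : a = l.length
        · subst ha; rw [Function.update_self]; exact h.node ν
        · rw [Function.update_of_ne ha]; exact hR a
      · have h1 : ch (Function.update R l.length (rs X (nodeIdx b n ν))) l.length =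
            ch R l.length := ch_congr fun a ha => Function.update_of_ne (by omega) _ _
        rw [ch, h1, Function.update_self, pre_succ, ← rs_rs]
        refine Eqv.restrict ?_ _
        have h2 := (hpair (revLabel b i) (revLabel b j) (by
          rw [Fin.lt_def]; change b - i < b - j; omega)).restrict
          (Sum.map (pre (fun a => nodeIdx b n (l.getD a [])) l.length) (nodeIdx b n ν))
        rw [tens_rs, rs_rs, Sum.elim_comp_map] at h2
        rw [key]
        have h3 : (l.map (List.cons i) ++ [j :: ν]).getD l.length [] = j :: ν := by
          rw [List.getD_append_right _ _ _ _ (by simp)]; simp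
        rw [h3]
        exact h2.trans (hR'.prod _)

end DefinableFamily

open DefinableFamily

theorem treeProp_of_combTree {D : DefinableFamily M} [Finite ξ] {Ψ : Set (ξ ⊕ τ → M)}
    (hΨ : D.IsDef Ψ) {K : ℕ} {𝒞 : Set (Ultrafilter (τ → M))}
    (h𝒞 : ∀ R : ℕ → Ultrafilter (τ → M), (∀ i, R i ∈ 𝒞) → Con Ψ K ∉ ch R K)
    (hX : ∀ b, ∃ X : Ultrafilter (τ ⊕ Branches τ β b b → M), D.CombTree 𝒞 b b X ∧
      ∀ p : List ℕ, p.length ≤ b → ∀ᶠ v in (X : Filter (τ ⊕ Branches τ β b b → M)),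
        ∃ x, ∀ l, Sum.elim x (v ∘ nodeIdx b b (p.take l)) ∈ Ψ) : TreeProp Ψ K := by
  intro n
  obtain ⟨X, h1, h2⟩ := hX n
  refine ⟨X.map fun v ν => v ∘ nodeIdx n n ν, fun p hp _ => h2 p hp, fun l hl hK hval => ?_⟩
  obtain ⟨R, hR, hR'⟩ := h1.comb l hl hval K hK
  have h3 := h𝒞 R hR
  rw [← hR' _ (con hΨ K), mem_rs, ← Ultrafilter.compl_mem_iff_notMem] at h3
  change ∀ᶠ v in (X : Filter (τ ⊕ Branches τ β n n → M)), _
  filter_upwards [h3] with v hv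
  rintro ⟨x, hx⟩
  refine hv ⟨x, fun i => ?_⟩
  have := hx (l.getD i []) (by rw [List.getD_eq_getElem _ _ (by omega)]; exact List.getElem_mem _)
  exact this

theorem con_mono {Ψ : Set (ξ ⊕ τ → M)} {R : ℕ → Ultrafilter (τ → M)} {m k : ℕ}
    (h : Con Ψ (m + k) ∈ ch R (m + k)) : Con Ψ m ∈ ch R m := by
  rw [← rs_ch_castAdd R m k, mem_rs]
  filter_upwards [h] with u ⟨x, hx⟩
  exact ⟨x, fun l => hx (Fin.castAdd k l)⟩

/-- If the power of a canonical ultrafilter is inconsistent then so are all long generic chains of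
realisations of its type. -/
theorem exists_forall_con_notMem_ch {D : DefinableFamily M} (hD : ¬ D.HasBinaryPattern)
    [Finite ξ] [Finite τ] {q : Ultrafilter (τ → M)} (hq : D.AdmAll q) {Ψ : Set (ξ ⊕ τ → M)}
    (hΨ : D.IsDef Ψ) {K : ℕ} (hK : Con Ψ K ∉ pw q K) :
    ∃ k, ∀ R : ℕ → Ultrafilter (τ → M), (∀ i, D.Eqv (R i) q) → Con Ψ k ∉ ch R k := by
  by_contra! hcon
  refine hD (TreeProp.hasBinaryPattern hΨ (K := K + 1) (Nat.succ_pos K)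
    (treeProp_of_combTree (β := Empty) hΨ (𝒞 := {q}) ?_ fun b => ?_))
  · intro R hR h
    obtain rfl : R = fun _ => q := funext hR
    exact hK (con_mono h)
  · obtain ⟨R, hR, hR'⟩ := hcon (b + 1)
    have key : ∀ j, ∃ X : Ultrafilter (τ ⊕ Branches τ Empty b j → M), D.AdmAll X ∧
        D.CombTree {q} b j X ∧ ∀ p : List ℕ, p.length = j →
          D.Eqv (rs X (pre (fun i => nodeIdx b j (p.take (j - i))) (j + 1))) (ch R (j + 1)) := by
      intro j
      induction j with
      | zero =>
        have h0 : rs (rs q (Sum.elim id Empty.elim)) (Sum.inl : τ → τ ⊕ Branches τ Empty b 0) = q :=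
          rs_id q
        refine ⟨rs q (Sum.elim id Empty.elim), hq.restrict _, CombTree.zero h0, fun p hp => ?_⟩
        have h1 := eqv_ch_one (D := D) (R 0) fun _ => (id : τ → τ)
        rw [ch_congr (R' := R) fun i hi => by rw [show i = 0 by omega]; exact rs_id _] at h1
        exact ((hR 0).symm.restrict (pre (fun _ => id) 1)).trans h1
      | succ j ih =>
        obtain ⟨X, hX, hXc, hXp⟩ := ih
        obtain ⟨Y, hY, hYX, hYc⟩ := hX.exists_pw b
        let f : τ → Fin (b + 1) × (τ ⊕ Branches τ Empty b j) := fun t => (0, Sum.inl t)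
        have hf : rs Y f = q := by
          have := hXc.node []
          rw [nodeIdx_nil, ← hYc 0, rs_rs] at this
          exact this
        obtain ⟨R', hR'Y, hR'f⟩ := exists_eqv_rs_eq (D := D) (U := Y) (R := R (j + 1)) (f := f)
          (hf ▸ (hR (j + 1)).symm)
        obtain ⟨Q, hQ, hQR, hQl, hQr⟩ := hY.exists_pair (g := id) (R := R') hR'Y
        let e : τ ⊕ Branches τ Empty b (j + 1) →
            (Fin (b + 1) × (τ ⊕ Branches τ Empty b j)) ⊕
              (Fin (b + 1) × (τ ⊕ Branches τ Empty b j)) :=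
          Sum.elim (Sum.inr ∘ f) Sum.inl
        have hchild : ∀ c, rs (rs Q e) (childIdx c) = X := fun c => by
          rw [← hYc c, ← hQl]; rfl
        have hroot : rs (rs Q e) Sum.inl = q := by
          rw [← hf, ← hQr]; rfl
        refine ⟨rs Q e, hQ.restrict _, hXc.succ ?_ (fun c => Eqv.of_eq (hchild c)) ?_, ?_⟩
        · rintro (_ | ⟨i, ν⟩)
          · exact hroot
          · change rs (rs Q e) (childIdx _ ∘ nodeIdx b j ν) ∈ _
            rw [← rs_rs, hchild]
            exact hXc.node ν
        · intro c c' hcc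
          have h1 := hYX.restrict (Sum.elim (Prod.mk c) (Prod.mk c'))
          rw [rs_ch_pair _ hcc, ← hQl] at h1
          refine Eqv.trans (Eqv.of_eq ?_) h1
          rw [rs_rs, rs_rs]
          congr 1
          ext (z | z) <;> rfl
        · rintro (_ | ⟨a, p⟩) hp
          · simp at hp
          have hp' : p.length = j := by simpa using hp
          let y : ℕ → τ → τ ⊕ Branches τ Empty b j := fun i => nodeIdx b j (p.take (j - i))
          have h1 : pre (fun i => nodeIdx b (j + 1) ((a :: p).take (j + 1 - i))) (j + 1) =
              (childIdx (revLabel b a) ∘ pre y (j + 1) :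
                Fin (j + 1) × τ → τ ⊕ Branches τ Empty b (j + 1)) := by
            ext ⟨i, t⟩
            change nodeIdx b (j + 1) ((a :: p).take (j + 1 - i)) t = _
            rw [show j + 1 - (i : ℕ) = (j - i) + 1 by omega, List.take_succ_cons]
            rfl
          rw [pre_succ, h1, ← rs_rs, Nat.sub_self, List.take_zero, nodeIdx_nil, ch]
          refine Eqv.restrict ?_ _
          have h2 := hQR.restrict (Sum.map (Prod.mk (revLabel b a) ∘ pre y (j + 1)) f)
          rw [tens_rs, hR'f] at h2
          have h3 : D.Eqv (rs R' (Prod.mk (revLabel b a) ∘ pre y (j + 1))) (ch R (j + 1)) := by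
            refine (hR'Y.restrict (Prod.mk (revLabel b a) ∘ pre y (j + 1))).trans ?_
            rw [← rs_rs, hYc]
            exact hXp p hp'
          refine Eqv.trans (Eqv.of_eq ?_) (h2.trans (h3.prod _))
          rw [rs_rs]
          congr 1
          ext (z | z) <;> rfl
    obtain ⟨X, -, hXc, hXp⟩ := key b
    refine ⟨X, hXc, fun p hp => ?_⟩
    have h1 := (hXp (p ++ List.replicate (b - p.length) 0) (by simp; omega) _
      (con hΨ (b + 1))).2 hR'
    rw [mem_rs] at h1
    filter_upwards [h1] with v ⟨x, hx⟩
    refine ⟨x, fun l => ?_⟩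
    have := hx ⟨b - min l p.length, by omega⟩
    have h2 : (p ++ List.replicate (b - p.length) 0).take (b - (b - min l p.length)) =
        p.take l := by
      rw [show b - (b - min l p.length) = min l p.length by omega,
        List.take_append_of_le_length (by omega), List.take_eq_take_iff]
      omega
    change Sum.elim x (v ∘ nodeIdx b b ((p ++ List.replicate (b - p.length) 0).take
      (b - (b - min l p.length)))) ∈ Ψ at this
    rwa [h2] at this

end

section

variable {M : Type u} {α β γ δ ξ τ ζ : Type}

namespace DefinableFamily
variable {D : DefinableFamily M}

variable (D) in
/-- `P` is the common type of pairs `(t, zₗ)` along some Morley sequence `(zₗ)`. -/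
def Free (P : Ultrafilter (τ ⊕ ζ → M)) : Prop :=
  ∃ (R : Ultrafilter (ζ → M)) (U : Ultrafilter (τ ⊕ (ℕ × ζ) → M)),
    (∀ k, D.Eqv (rs U (pre seqIdx k)) (pw R k)) ∧
      ∀ l, D.Eqv (rs U (Sum.elim Sum.inl (seqIdx l))) P

theorem rs_ch_map (R : ℕ → Ultrafilter (τ → M)) (e : δ → τ) (k : ℕ) :
    rs (ch R k) (Prod.map id e) = ch (fun i => rs (R i) e) k := by
  induction k with
  | zero =>
    ext S
    rw [mem_rs, ch, ch, Ultrafilter.mem_pure, Ultrafilter.mem_pure]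
    change _ ∘ _ ∈ S ↔ _
    rw [Subsingleton.elim (_ ∘ _ : Fin 0 × δ → M) fun p => p.1.elim0]
  | succ k ih =>
    have : splitLast k ∘ Prod.map id e = Sum.map (Prod.map id e) e ∘ (splitLast k : _ → _ ⊕ δ) := by
      ext1 ⟨i, z⟩
      by_cases h : (i : ℕ) < k <;> simp [splitLast, h]
    rw [ch, ch, ← ih, ← tens_rs, rs_rs, rs_rs, this]

theorem eqv_seqIdx {U : Ultrafilter (α ⊕ (ℕ × ζ) → M)} {Q : Ultrafilter (ζ → M)}
    (h : ∀ k, D.Eqv (rs U (pre seqIdx k)) (pw Q k)) (l : ℕ) : D.Eqv (rs U (seqIdx l)) Q := by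
  have h1 := (h (l + 1)).restrict (Prod.mk (Fin.last l))
  rw [rs_ch_coord] at h1
  exact h1

theorem Free.con_mem (hD : ¬ D.HasBinaryPattern) [Finite τ] [Finite ζ]
    {P : Ultrafilter (τ ⊕ ζ → M)} (hP : D.Free P) {Q : Ultrafilter (ζ → M)} (hQ : D.AdmAll Q)
    (hQP : D.Eqv Q (rs P Sum.inr)) {S : Set (τ ⊕ ζ → M)} (hS : D.IsDef S) (hSP : S ∈ P) (N : ℕ) :
    Con S N ∈ pw Q N := by
  by_contra hcon
  obtain ⟨k, hk⟩ := exists_forall_con_notMem_ch hD hQ hS hcon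
  obtain ⟨R, U, h1, h2⟩ := hP
  have hR : D.Eqv R Q :=
    (eqv_seqIdx h1 0).symm.trans (((h2 0).restrict Sum.inr).trans hQP.symm)
  refine hk (fun _ => R) (fun _ => hR) ((h1 k _ (con hS k)).1 ?_)
  have h3 : ∀ᶠ v in (U : Filter (τ ⊕ (ℕ × ζ) → M)), ∀ l : Fin k,
      v ∘ Sum.elim Sum.inl (seqIdx l) ∈ S :=
    eventually_all.2 fun l => (h2 l S hS).2 hSP
  rw [mem_rs]
  filter_upwards [h3] with v hv
  refine ⟨v ∘ Sum.inl, fun l => ?_⟩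
  have := hv l
  rwa [Sum.comp_elim] at this

theorem exists_indisc_seq {P : Ultrafilter (τ ⊕ ζ → M)} {Q : Ultrafilter (δ → M)} (e : ζ → δ)
    (h : ∀ S, D.IsDef S → S ∈ P → ∀ N, Con S N ∈ pw (rs Q e) N) :
    ∃ U : Ultrafilter (τ ⊕ (ℕ × δ) → M), D.Indisc U ∧ (∀ k, D.Eqv (rs U (pre seqIdx k)) (pw Q k)) ∧
      ∀ l, D.Eqv (rs U (Sum.elim Sum.inl (seqIdx l ∘ e))) P := by
  obtain ⟨U, hU1, hU2⟩ := exists_seq (D := D) (P := P) (Q := Q) e fun S hS hSP N => by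
    have := h S hS hSP N
    change Con S N ∈ ch (fun _ => rs Q e) N at this
    rw [← rs_ch_map] at this
    exact this
  obtain ⟨U', h1, h2⟩ := exists_indisc (D := D) U
  refine ⟨U', h1, fun k => (Eqv.of_imp fun S hS hSk => ?_).symm,
    fun l => (Eqv.of_imp fun S hS hSP => ?_).symm⟩
  · refine h2 _ (D.reindex (pre seqIdx k) hS) fun f hf => ?_
    exact (eqv_pw_comp (fun k => Eqv.of_eq (hU1 k)) hf k S hS).2 hSk
  · refine h2 _ (D.reindex _ hS) fun f hf => ?_
    have h3 := (hU2 (f l) S hS).2 hSP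
    have h4 : (shift f ∘ Sum.elim Sum.inl (seqIdx l ∘ e) : τ ⊕ ζ → τ ⊕ (ℕ × δ)) =
        Sum.elim Sum.inl (seqIdx (f l) ∘ e) := by
      ext1 (t | z) <;> rfl
    rw [← h4, ← rs_rs] at h3
    exact h3

theorem CombTree.congr {𝒞 : Set (Ultrafilter (τ → M))} (h𝒞 : ∀ R R', D.Eqv R R' → R ∈ 𝒞 → R' ∈ 𝒞)
    {b n : ℕ} {X X' : Ultrafilter (τ ⊕ Branches τ β b n → M)} (h : D.CombTree 𝒞 b n X)
    (hX : D.Eqv X X') : D.CombTree 𝒞 b n X' where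
  node ν := h𝒞 _ _ (hX.restrict _) (h.node ν)
  comb l hl hv k hk := by
    obtain ⟨R, hR, hR'⟩ := h.comb l hl hv k hk
    exact ⟨R, hR, (hX.symm.restrict _).trans hR'⟩

/-- The leaf at the end of a path, extended by zeroes. -/
def leafIdx (b : ℕ) : (n : ℕ) → List ℕ → β → Branches τ β b n
  | 0, _ => id
  | n + 1, [] => fun z => (0, Sum.inr (leafIdx b n [] z))
  | n + 1, i :: ν => fun z => (revLabel b i, Sum.inr (leafIdx b n ν z))

theorem Free.con_swap_mem (hD : ¬ D.HasBinaryPattern) [Finite τ] [Finite β]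
    {P : Ultrafilter (τ ⊕ β → M)} (hP : D.Free P) {Q : Ultrafilter (τ → M)} (hQ : D.AdmAll Q)
    (hQP : D.Eqv Q (rs P Sum.inl)) {S : Set (τ ⊕ β → M)} (hS : D.IsDef S) (hSP : S ∈ P) (N : ℕ) :
    Con {v | v ∘ Sum.swap ∈ S} N ∈ pw Q N := by
  by_contra hcon
  have hS' : D.IsDef {v : β ⊕ τ → M | v ∘ Sum.swap ∈ S} := D.reindex _ hS
  obtain ⟨k, hk⟩ := exists_forall_con_notMem_ch hD hQ hS' hcon
  refine hD (TreeProp.hasBinaryPattern hS' (K := k + 1) k.succ_pos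
    (treeProp_of_combTree (β := β) hS' (𝒞 := {R | D.Eqv R Q})
      (fun R hR h => hk R hR (con_mono h)) fun b => ?_))
  have key : ∀ n, ∃ X : Ultrafilter (τ ⊕ Branches τ β b n → M), D.CombTree {R | D.Eqv R Q} b n X ∧
      D.Free X ∧ ∀ p l, S ∈ rs X (Sum.elim (nodeIdx b n (p.take l)) (Sum.inr ∘ leafIdx b n p)) := by
    intro n
    induction n with
    | zero =>
      refine ⟨P, CombTree.zero hQP.symm, hP, fun p l => ?_⟩
      have : Sum.elim (nodeIdx b 0 (p.take l)) (Sum.inr ∘ leafIdx b 0 p) =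
          (id : τ ⊕ β → τ ⊕ Branches τ β b 0) := by
        ext1 (t | z) <;> rfl
      rw [this]
      exact hSP
    | succ n ih =>
      obtain ⟨X, hXc, hXf, hXl⟩ := ih
      obtain ⟨G, hGX, hG⟩ := exists_admAll (D := D) X
      obtain ⟨U, hU1, hU2, hU3⟩ := exists_indisc_seq (D := D) (P := X) (Q := G) Sum.inr
        fun T hT hTX N => hXf.con_mem hD (hG.restrict _) (hGX.restrict _) hT hTX N
      let g : τ ⊕ Branches τ β b (n + 1) → τ ⊕ (ℕ × (τ ⊕ Branches τ β b n)) :=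
        Sum.map id (Prod.map Fin.val id : Fin (b + 1) × (τ ⊕ Branches τ β b n) → _)
      have hchild : ∀ c, D.Eqv (rs (rs U g) (childIdx c)) G := fun c => eqv_seqIdx hU2 c
      have hroot : ∀ c, rs (rs U g) (Sum.elim Sum.inl (childIdx c ∘ Sum.inr)) =
          rs U (Sum.elim Sum.inl (seqIdx c ∘ Sum.inr)) := by
        intro c
        rw [rs_rs]
        congr 1
        ext (z | z) <;> rfl
      have hrt : ∀ c p,
          S ∈ rs (rs U g) (Sum.elim Sum.inl (childIdx c ∘ Sum.inr ∘ leafIdx b n p)) := by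
        intro c p
        have h1 : (Sum.elim Sum.inl (childIdx c ∘ Sum.inr ∘ leafIdx b n p) : τ ⊕ β → _) =
            Sum.elim Sum.inl (childIdx c ∘ Sum.inr) ∘
              Sum.elim (nodeIdx b n (p.take 0)) (Sum.inr ∘ leafIdx b n p) := by
          rw [List.take_zero, nodeIdx_nil]
          ext1 (t | z) <;> rfl
        rw [h1, ← rs_rs, hroot]
        exact ((hU3 c).restrict _ S hS).2 (hXl p 0)
      refine ⟨rs U g, CombTree.succ (X := G) (hXc.congr (fun R R' h h' => h.symm.trans h') hGX.symm)
        ?_ hchild ?_, ⟨pw G (b + 1), rs U (Sum.map id fun p : ℕ × Fin (b + 1) × _ =>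
          (p.1 * (b + 1) + p.2.1, p.2.2)), fun k => eqv_pw_blocks hU2 (b + 1) k, fun l => ?_⟩, ?_⟩
      · rintro (_ | ⟨i, ν⟩)
        · have h1 := (hU3 0).restrict Sum.inl
          have h2 := hXc.node []
          rw [nodeIdx_nil] at h2
          exact h1.trans h2
        · change D.Eqv (rs (rs U g) (childIdx _ ∘ nodeIdx b n ν)) Q
          rw [← rs_rs]
          exact ((hchild _).restrict _).trans ((hGX.restrict _).trans (hXc.node ν))
      · intro c c' hcc
        have h1 := (hU2 (b + 1)).restrict (Sum.elim (Prod.mk c) (Prod.mk c'))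
        rw [rs_ch_pair _ hcc] at h1
        refine Eqv.trans (Eqv.of_eq ?_) h1
        rw [rs_rs, rs_rs]
        congr 1
        ext (z | z) <;> rfl
      · have h1 := (hU1 (fun i => l * (b + 1) + i) fun i j hij => by
          change _ + _ < _ + _; omega).restrict g
        refine Eqv.trans (Eqv.of_eq ?_) h1
        rw [rs_rs, rs_rs]
        congr 1
        ext (z | z) <;> rfl
      · rintro (_ | ⟨i, p⟩) l
        · rw [List.take_nil, nodeIdx_nil]
          exact hrt 0 []
        · rcases l with _ | l
          · rw [List.take_zero, nodeIdx_nil]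
            exact hrt (revLabel b i) p
          · have h1 : (Sum.elim (nodeIdx b (n + 1) ((i :: p).take (l + 1)))
                (Sum.inr ∘ leafIdx b (n + 1) (i :: p)) : τ ⊕ β → τ ⊕ Branches τ β b (n + 1)) =
                childIdx (revLabel b i) ∘
                  Sum.elim (nodeIdx b n (p.take l)) (Sum.inr ∘ leafIdx b n p) := by
              ext1 (t | z) <;> rfl
            rw [h1, ← rs_rs]
            exact ((hchild _).restrict _ S hS).2 ((hGX.restrict _ S hS).2 (hXl p l))
  obtain ⟨X, hX, -, hXl⟩ := key b
  refine ⟨X, hX, fun p hp => ?_⟩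
  have h1 : ∀ᶠ v in (X : Filter (τ ⊕ Branches τ β b b → M)), ∀ l : Fin (p.length + 1),
      v ∘ Sum.elim (nodeIdx b b (p.take l)) (Sum.inr ∘ leafIdx b b p) ∈ S :=
    eventually_all.2 fun l => hXl p l
  filter_upwards [h1] with v hv
  refine ⟨v ∘ Sum.inr ∘ leafIdx b b p, fun l => ?_⟩
  have h2 := hv ⟨min l p.length, by omega⟩
  rw [Sum.comp_elim] at h2
  have h3 : p.take (min l p.length) = p.take l := by rw [List.take_eq_take_iff]; omega
  change Sum.elim (v ∘ nodeIdx b b (p.take (min l p.length))) _ ∈ S at h2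
  rw [h3] at h2
  change _ ∘ _ ∈ S
  rwa [Sum.elim_swap]

end DefinableFamily
end

section

variable {M : Type u} {α β γ δ ξ τ ζ υ θ : Type}

/-! ### Dyadic intervals -/

/-- The left end point of the dyadic subinterval of `[0, 2 ^ N)` given by a binary string. -/
def dyadicLeft : ℕ → List Bool → ℕ
  | 0, _ => 0
  | _ + 1, [] => 0
  | N + 1, c :: η => (if c then 2 ^ N else 0) + dyadicLeft N η

/-- The right end point of the dyadic subinterval of `[0, 2 ^ N)` given by a binary string. -/
def dyadicRight (N : ℕ) (η : List Bool) : ℕ := dyadicLeft N η + 2 ^ (N - η.length)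

theorem dyadicRight_cons (N : ℕ) (c : Bool) (η : List Bool) :
    dyadicRight (N + 1) (c :: η) = (if c then 2 ^ N else 0) + dyadicRight N η := by
  simp [dyadicRight, dyadicLeft, add_assoc]

theorem dyadicRight_le (N : ℕ) : ∀ η : List Bool, η.length ≤ N → dyadicRight N η ≤ 2 ^ N := by
  induction N with
  | zero => intro η _; simp [dyadicRight, dyadicLeft]
  | succ N ih =>
    rintro (_ | ⟨c, η⟩) h
    · simp [dyadicRight, dyadicLeft]
    · have := ih η (by simpa using h)
      rw [dyadicRight_cons, pow_succ]
      split_ifs <;> omega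

theorem dyadicLeft_take_le (N : ℕ) : ∀ (η : List Bool) (l : ℕ),
    dyadicLeft N (η.take l) ≤ dyadicLeft N η := by
  induction N with
  | zero => intro η l; simp [dyadicLeft]
  | succ N ih =>
    rintro (_ | ⟨c, η⟩) (_ | l) <;> simp [dyadicLeft, ih]

theorem dyadicLeft_lt_dyadicRight_take (N : ℕ) : ∀ (η : List Bool) (l : ℕ), η.length ≤ N →
    dyadicLeft N η < dyadicRight N (η.take l) := by
  induction N with
  | zero => intro η l; simp [dyadicRight, dyadicLeft]
  | succ N ih =>
    rintro (_ | ⟨c, η⟩) (_ | l) h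
    · simp [dyadicRight, dyadicLeft]
    · simp [dyadicRight, dyadicLeft]
    · refine lt_of_lt_of_le ?_ ((dyadicRight_le (N + 1) (c :: η) h).trans ?_)
      · simp [dyadicRight]
      · simp [dyadicRight, dyadicLeft]
    · rw [List.take_succ_cons, dyadicRight_cons, dyadicLeft]
      exact Nat.add_lt_add_left (ih η l (by simpa using h)) _

theorem dyadicRight_le_dyadicLeft (N : ℕ) : ∀ η η' : List Bool, η.length ≤ N → η'.length ≤ N →
    ¬ η <+: η' → ¬ η' <+: η →
      dyadicRight N η ≤ dyadicLeft N η' ∨ dyadicRight N η' ≤ dyadicLeft N η := by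
  induction N with
  | zero =>
    intro η η' h _ h1
    rw [List.length_eq_zero_iff.1 (Nat.le_zero.1 h)] at h1
    exact absurd ⟨_, rfl⟩ h1
  | succ N ih =>
    rintro (_ | ⟨c, η⟩) (_ | ⟨c', η'⟩) h h' h1 h2
    · exact absurd ⟨_, rfl⟩ h1
    · exact absurd ⟨_, rfl⟩ h1
    · exact absurd ⟨_, rfl⟩ h2
    · have hl : η.length ≤ N := by simpa using h
      have hl' : η'.length ≤ N := by simpa using h'
      have hr := dyadicRight_le N η hl
      have hr' := dyadicRight_le N η' hl'
      rw [dyadicRight_cons, dyadicRight_cons, dyadicLeft, dyadicLeft]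
      by_cases hc : c = c'
      · subst hc
        rcases ih η η' hl hl' (fun h => h1 (by simpa using h)) (fun h => h2 (by simpa using h))
          with h | h <;> omega
      · cases c <;> cases c' <;> simp at hc ⊢ <;> omega

namespace DefinableFamily
variable {D : DefinableFamily M}

/-- The pairs `(y, y')` for which the instances of `Φ` at `y` and `y'` are inconsistent. -/
def Incon (Φ : Set (ξ ⊕ υ → M)) : Set (υ ⊕ υ → M) :=
  {v | ¬ ∃ x : ξ → M, Sum.elim x (v ∘ Sum.inl) ∈ Φ ∧ Sum.elim x (v ∘ Sum.inr) ∈ Φ}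

theorem incon [Finite ξ] {Φ : Set (ξ ⊕ υ → M)} (h : D.IsDef Φ) : D.IsDef (Incon Φ) := by
  have h1 : D.IsDef {v : (υ ⊕ υ) ⊕ ξ → M | v ∘ Sum.elim Sum.inr (Sum.inl ∘ Sum.inl) ∈ Φ} :=
    D.reindex _ h
  have h2 : D.IsDef {v : (υ ⊕ υ) ⊕ ξ → M | v ∘ Sum.elim Sum.inr (Sum.inl ∘ Sum.inr) ∈ Φ} :=
    D.reindex _ h
  convert D.compl (D.proj (D.inter h1 h2)) using 1
  ext v
  refine not_congr (exists_congr fun x => ?_)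
  rw [Set.mem_inter_iff]
  change _ ↔ _ ∘ _ ∈ Φ ∧ _ ∘ _ ∈ Φ
  rw [Sum.comp_elim, Sum.comp_elim]
  rfl

theorem hasBinaryPattern_of_sequences [Finite ξ] [Finite υ] {Φ : Set (ξ ⊕ υ → M)} (hΦ : D.IsDef Φ)
    (h : ∀ N, ∃ b c : ℕ → υ → M, (∀ i i', i ≤ i' → i' < N → Sum.elim (b i') (c i) ∈ Incon Φ) ∧
      ∀ n ≤ N, ∃ x, (∀ i < n, Sum.elim x (b i) ∈ Φ) ∧ ∀ i < N, n ≤ i → Sum.elim x (c i) ∈ Φ) :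
    D.HasBinaryPattern := by
  have h1 : D.IsDef {v : ξ ⊕ (υ ⊕ υ) → M | v ∘ Sum.map id Sum.inl ∈ Φ} := D.reindex _ hΦ
  have h2 : D.IsDef {v : ξ ⊕ (υ ⊕ υ) → M | v ∘ Sum.map id Sum.inr ∈ Φ} := D.reindex _ hΦ
  have hmem : ∀ (x : ξ → M) (y y' : υ → M), Sum.elim x (Sum.elim y y') ∈
      {v : ξ ⊕ (υ ⊕ υ) → M | v ∘ Sum.map id Sum.inl ∈ Φ} ∩ {v | v ∘ Sum.map id Sum.inr ∈ Φ} ↔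
        Sum.elim x y ∈ Φ ∧ Sum.elim x y' ∈ Φ := by
    intro x y y'
    rw [Set.mem_inter_iff]
    change _ ∘ _ ∈ Φ ∧ _ ∘ _ ∈ Φ ↔ _
    rw [Sum.elim_comp_map, Sum.elim_comp_map]
    rfl
  refine ⟨ξ, υ ⊕ υ, inferInstance, inferInstance, _, D.inter h1 h2, fun N => ?_⟩
  obtain ⟨b, c, hinc, hcon⟩ := h (2 ^ N + 1)
  refine ⟨fun η => Sum.elim (b (dyadicLeft N η)) (c (dyadicRight N η)), fun σ hσ => ?_,
    fun η η' hη hη' h1 h2 => ?_⟩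
  · have hlt := dyadicLeft_lt_dyadicRight_take N σ σ.length hσ
    rw [List.take_length] at hlt
    obtain ⟨x, hx, hx'⟩ := hcon (dyadicLeft N σ + 1) (by have := dyadicRight_le N σ hσ; omega)
    refine ⟨x, fun l => (hmem _ _ _).2 ⟨hx _ ?_, hx' _ ?_ ?_⟩⟩
    · exact Nat.lt_succ_of_le (dyadicLeft_take_le N σ l)
    · exact Nat.lt_succ_of_le (dyadicRight_le N _ ((List.length_take_le' _ _).trans hσ))
    · exact dyadicLeft_lt_dyadicRight_take N σ l hσ
  · rintro ⟨x, hx, hx'⟩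
    rw [hmem] at hx hx'
    have hlt : ∀ η : List Bool, η.length ≤ N → dyadicLeft N η < 2 ^ N + 1 := fun η hη => by
      have h := dyadicRight_le N η hη
      have h' : 0 < 2 ^ (N - η.length) := by positivity
      rw [dyadicRight] at h
      omega
    rcases dyadicRight_le_dyadicLeft N η η' hη hη' h1 h2 with h | h
    · exact hinc _ _ h (hlt _ hη') ⟨x, hx'.1, hx.2⟩
    · exact hinc _ _ h (hlt _ hη) ⟨x, hx.1, hx'.2⟩

theorem Eqv.of_forall_shift {U U' : Ultrafilter (α ⊕ (ℕ × ζ) → M)}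
    (h : ∀ S, D.IsDef S → (∀ f, StrictMono f → S ∈ rs U (shift f)) → S ∈ U')
    (g : γ → α ⊕ (ℕ × ζ)) {W : Ultrafilter (γ → M)}
    (hW : ∀ f, StrictMono f → D.Eqv (rs U (shift f ∘ g)) W) : D.Eqv (rs U' g) W :=
  (Eqv.of_imp fun S hS hSW =>
    h {v | v ∘ g ∈ S} (D.reindex g hS) fun f hf => (hW f hf S hS).2 hSW).symm

theorem exists_double (hD : ¬ D.HasBinaryPattern) [Finite θ] [Finite υ]
    {U : Ultrafilter (θ ⊕ (ℕ × υ) → M)} (hU : D.Indisc U) {q : Ultrafilter (υ → M)}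
    (hρ : ∀ k, D.Eqv (rs U (pre seqIdx k)) (pw q k)) {Q : Ultrafilter (θ → M)} (hQ : D.AdmAll Q)
    (hQU : D.Eqv Q (rs U Sum.inl)) :
    ∃ U' : Ultrafilter ((θ ⊕ θ) ⊕ (ℕ × υ) → M), D.Indisc U' ∧
      D.Eqv (rs U' Sum.inl) (tens Q Q) ∧ D.Eqv (rs U' (Sum.map Sum.inl id)) U ∧
        D.Eqv (rs U' (Sum.map Sum.inr id)) U := by
  obtain ⟨V, -, hV1, hV2⟩ := exists_indisc_seq (D := D) (P := rs U Sum.swap) (Q := Q) id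
    fun S hS hSU N => by
      obtain ⟨F, S₀, -, rfl⟩ := D.support hS
      let m := F.sup fun x => Sum.elim (fun p => p.1) (fun _ => 0) x
      let π : (ℕ × υ) ⊕ θ → θ ⊕ (Fin (m + 1) × υ) :=
        Sum.elim (fun p => Sum.inr (⟨min p.1 m, by omega⟩, p.2)) Sum.inl
      have hfree : D.Free (rs U (Sum.elim Sum.inl (pre seqIdx (m + 1)))) := by
        refine ⟨pw q (m + 1), rs U (Sum.map id fun p : ℕ × Fin (m + 1) × υ =>
          (p.1 * (m + 1) + p.2.1, p.2.2)), fun k => eqv_pw_blocks hρ (m + 1) k, fun l => ?_⟩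
        have h1 := (hU (fun i => l * (m + 1) + i) fun i j hij => by
          change _ + _ < _ + _; omega).restrict (Sum.elim Sum.inl (pre seqIdx (m + 1)))
        refine Eqv.trans (Eqv.of_eq ?_) h1
        rw [rs_rs, rs_rs]
        congr 1
        ext (z | z) <;> rfl
      have h1 := hfree.con_swap_mem hD hQ hQU (D.reindex π hS) (by
        rw [mem_rs]
        filter_upwards [hSU] with v hv
        change (fun i : F => v (Sum.elim Sum.inl (pre seqIdx (m + 1)) (π i))) ∈ S₀
        change (fun i : F => v (Sum.swap i.1)) ∈ S₀ at hv
        convert hv using 3 with i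
        obtain ⟨⟨l, z⟩ | t, hi⟩ := i
        · have : l ≤ m := Finset.le_sup (f := fun x : (ℕ × υ) ⊕ θ =>
            Sum.elim (fun p => p.1) (fun _ => 0) x) hi
          simp [π, pre, seqIdx, this]
        · rfl) N
      rw [rs_id]
      filter_upwards [h1] with u hu
      obtain ⟨x, hx⟩ := hu
      refine ⟨fun p => x (⟨min p.1 m, by omega⟩, p.2), fun l => ?_⟩
      have h2 := hx l
      change (Sum.elim _ _ ∘ Sum.swap) ∘ π ∈ {v : (ℕ × υ) ⊕ θ → M | (fun i : F => v i) ∈ S₀} at h2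
      convert h2 using 1
      ext (i | i) <;> rfl
  let g : (θ ⊕ θ) ⊕ (ℕ × υ) → (ℕ × υ) ⊕ (ℕ × θ) :=
    Sum.elim (Sum.elim (seqIdx 0) (seqIdx 1)) Sum.inl
  obtain ⟨U', h1, h2⟩ := exists_indisc (D := D) (rs V g)
  have hside : ∀ (s : θ → θ ⊕ θ) (l : ℕ),
      (Sum.elim (seqIdx 0) (seqIdx 1) ∘ s : θ → (ℕ × υ) ⊕ (ℕ × θ)) = seqIdx l →
        D.Eqv (rs U' (Sum.map s id)) U := by
    intro s l hs
    refine Eqv.of_forall_shift h2 _ fun f hf => Eqv.trans ?_ (hU f hf)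
    have h3 := (hV2 l).restrict (Sum.swap ∘ shift f)
    rw [rs_rs, rs_rs, ← Function.comp_assoc Sum.swap Sum.swap, Sum.swap_swap_eq] at h3
    refine Eqv.trans (Eqv.of_eq ?_) h3
    rw [rs_rs]
    congr 1
    ext1 (t | p)
    · exact congrFun hs t
    · rfl
  refine ⟨U', h1, ?_, hside _ 0 rfl, hside _ 1 rfl⟩
  refine Eqv.of_forall_shift h2 _ fun f hf => ?_
  have h3 := (hV1 2).restrict (Sum.elim (Prod.mk 0) (Prod.mk 1))
  rw [rs_ch_pair _ (by decide)] at h3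
  refine Eqv.trans (Eqv.of_eq ?_) h3
  rw [rs_rs, rs_rs]
  congr 1
  ext (t | t) <;> rfl

end DefinableFamily
end

section

variable {M : Type u} {α β γ δ ξ τ ζ υ θ : Type}

/-- The sequence of tuples beginning with `b 0, …, b (j - 1)` and continuing in `ℕ × υ`. -/
def prependIdx (j : ℕ) (b : ℕ → υ → θ) (i : ℕ) : υ → θ ⊕ (ℕ × υ) :=
  if i < j then Sum.inl ∘ b i else seqIdx (i - j)

/-- The sequence of tuples which switches from `b` to `c` at position `n`. -/
def switchIdx (n : ℕ) (b c : ℕ → υ → θ) (i : ℕ) : υ → θ := if i < n then b i else c i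

namespace DefinableFamily
variable {D : DefinableFamily M}

variable (D) in
/-- A finite approximation, of length `j`, to a tree pattern for `Φ`: an initial segment `b` of a
Morley sequence of `q`, and tuples `c i`, each inconsistent with the tail of `b` from `i` on, which
may replace the corresponding tail of `b`. The tuple `z` is used to continue. -/
structure Ladder (Φ : Set (ξ ⊕ υ → M)) (q : Ultrafilter (υ → M)) (j : ℕ) (z : υ → θ)
    (b c : ℕ → υ → θ) (U : Ultrafilter (θ ⊕ (ℕ × υ) → M)) : Prop where
  indisc : D.Indisc U
  eqv_pw : ∀ k, D.Eqv (rs U (pre (prependIdx j b) k)) (pw q k)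
  eqv_last : D.Eqv (rs U (Sum.inl ∘ z)) q
  incon_last : ∀ i, Incon Φ ∈ rs U (Sum.elim (prependIdx j b i) (Sum.inl ∘ z))
  incon : ∀ i < j, ∀ i', i ≤ i' → Incon Φ ∈ rs U (Sum.elim (prependIdx j b i') (Sum.inl ∘ c i))
  eqv_switch : ∀ n ≤ j, D.Eqv (rs U (Sum.inl ∘ pre (switchIdx n b c) j)) (pw q j)

theorem exists_ladder_zero {Φ : Set (ξ ⊕ υ → M)} {q s : Ultrafilter (υ → M)} (hqs : D.Eqv q s)
    (hΦ : D.IsDef (Incon Φ)) (hs : Incon Φ ∈ tens q s) :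
    ∃ U, D.Ladder Φ q 0 (id : υ → υ) (fun _ => id) (fun _ => id) U := by
  obtain ⟨U, h1, h2, h3⟩ := exists_indisc_seq (D := D) (P := rs (tens q s) Sum.swap) (Q := q) id
    fun S hS hSP N => by
      obtain ⟨t, ht⟩ := (Ultrafilter.nonempty_of_mem (mem_tens.1 hSP))
      rw [rs_id]
      have h1 : ∀ᶠ u in (pw q N : Filter (Fin N × υ → M)), ∀ l : Fin N,
          u ∘ Prod.mk l ∈ {v | Sum.elim v t ∘ Sum.swap ∈ S} := eventually_all.2 fun l => by
        have h2 := mem_rs.1 ((rs_ch_coord (fun _ => q) l).symm ▸ ht)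
        exact h2
      filter_upwards [h1] with u hu
      refine ⟨t, fun l => ?_⟩
      have h2 : Sum.elim (u ∘ Prod.mk l) t ∘ Sum.swap ∈ S := hu l
      rwa [Sum.elim_swap] at h2
  have hpre : ∀ i, prependIdx 0 (fun _ => (id : υ → υ)) i = seqIdx i := fun i => rfl
  refine ⟨U, h1, h2, ?_, fun i => ?_, fun i hi => absurd hi (Nat.not_lt_zero _), fun n hn => ?_⟩
  · have h4 := (h3 0).restrict Sum.inl
    rw [rs_rs, rs_rs] at h4
    refine h4.trans (Eqv.trans (Eqv.of_eq ?_) hqs.symm)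
    exact rs_tens_inr q s
  · rw [hpre]
    have h4 := (h3 i).restrict Sum.swap
    rw [rs_rs, rs_rs, Sum.swap_swap_eq, rs_id] at h4
    have h5 := (h4 _ hΦ).2 hs
    have h6 : (Sum.elim Sum.inl (seqIdx i ∘ id) ∘ Sum.swap : υ ⊕ υ → υ ⊕ (ℕ × υ)) =
        Sum.elim (seqIdx i) (Sum.inl ∘ id) := by
      ext1 (t | t) <;> rfl
    rwa [h6] at h5
  · have h4 := eqv_ch_zero (D := D) (rs U Sum.inl) (switchIdx n (fun _ => (id : υ → υ)) fun _ => id)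
      fun _ => q
    rwa [rs_rs] at h4

theorem Ladder.exists_succ (hD : ¬ D.HasBinaryPattern) [Finite θ] [Finite υ]
    {Φ : Set (ξ ⊕ υ → M)} {q : Ultrafilter (υ → M)} (hq : D.AdmAll q) (hΦ : D.IsDef (Incon Φ))
    {j : ℕ} {z : υ → θ} {b c : ℕ → υ → θ} {U : Ultrafilter (θ ⊕ (ℕ × υ) → M)}
    (h : D.Ladder Φ q j z b c U) :
    ∃ (z' : υ → (θ ⊕ θ) ⊕ υ) (b' c' : ℕ → υ → (θ ⊕ θ) ⊕ υ)
      (U' : Ultrafilter (((θ ⊕ θ) ⊕ υ) ⊕ (ℕ × υ) → M)), D.Ladder Φ q (j + 1) z' b' c' U' := by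
  obtain ⟨Q, hQ, hQU, hQz⟩ := hq.exists_extension (g := z) (R := rs U Sum.inl) h.eqv_last
  have hρ : ∀ k, D.Eqv (rs U (pre seqIdx k)) (pw q k) := fun k => by
    have h1 := eqv_pw_comp h.eqv_pw (f := fun i => j + i) (fun _ _ h => Nat.add_lt_add_left h j) k
    have h2 : prependIdx j b ∘ (fun i => j + i) = seqIdx := by
      ext1 i
      simp [prependIdx]
    rwa [h2] at h1
  obtain ⟨V, hV, hV1, hV2, hV3⟩ := exists_double hD h.indisc hρ hQ hQU
  let g : ((θ ⊕ θ) ⊕ υ) ⊕ (ℕ × υ) → (θ ⊕ θ) ⊕ (ℕ × υ) :=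
    Sum.elim (Sum.elim Sum.inl (seqIdx 0)) fun p => Sum.inr (p.1 + 1, p.2)
  let b' : ℕ → υ → (θ ⊕ θ) ⊕ υ := fun i => if i < j then Sum.inl ∘ Sum.inl ∘ b i else Sum.inr
  let c' : ℕ → υ → (θ ⊕ θ) ⊕ υ := fun i =>
    if i < j then Sum.inl ∘ Sum.inl ∘ c i else Sum.inl ∘ Sum.inr ∘ z
  have hb : ∀ i, g ∘ prependIdx (j + 1) b' i = Sum.map Sum.inl id ∘ prependIdx j b i := by
    intro i
    ext1 t
    rcases lt_trichotomy i j with hi | rfl | hi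
    · simp [prependIdx, b', g, hi, hi.trans (Nat.lt_succ_self j)]
    · simp [prependIdx, b', g, seqIdx]
    · have h1 : i - (j + 1) + 1 = i - j := by omega
      simp [prependIdx, g, seqIdx, hi.not_gt, show ¬ i < j + 1 by omega, h1]
  have hpre : ∀ k, D.Eqv (rs (rs V g) (pre (prependIdx (j + 1) b') k)) (pw q k) := fun k => by
    refine Eqv.trans (Eqv.of_eq ?_) ((hV2.restrict (pre (prependIdx j b) k)).trans (h.eqv_pw k))
    rw [rs_rs, rs_rs]
    congr 1
    ext1 ⟨i, t⟩
    exact congrFun (hb i) t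
  have hincon : ∀ (i : ℕ) (w : υ → θ),
      Incon Φ ∈ rs U (Sum.elim (prependIdx j b i) (Sum.inl ∘ w)) →
        Incon Φ ∈ rs (rs V g) (Sum.elim (prependIdx (j + 1) b' i)
          (Sum.inl ∘ Sum.inl ∘ Sum.inl ∘ w)) := fun i w hw => by
    have h1 := (hV2.restrict (Sum.elim (prependIdx j b i) (Sum.inl ∘ w)) _ hΦ).2 hw
    rw [rs_rs, Sum.comp_elim] at h1 ⊢
    rwa [hb]
  refine ⟨Sum.inl ∘ Sum.inl ∘ z, b', c', rs V g, fun f hf => ?_, hpre, ?_, fun i => ?_,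
    fun i hi i' hii => ?_, fun n hn => ?_⟩
  · let f' : ℕ → ℕ := fun | 0 => 0 | i + 1 => f i + 1
    have hf' : StrictMono f' := strictMono_nat_of_lt_succ fun
      | 0 => Nat.succ_pos _
      | i + 1 => Nat.succ_lt_succ (hf (Nat.lt_succ_self i))
    refine Eqv.trans (Eqv.of_eq ?_) ((hV f' hf').restrict g)
    rw [rs_rs, rs_rs]
    congr 1
    ext1 (((t | t) | t) | t) <;> rfl
  · exact (hV2.restrict (Sum.inl ∘ z)).trans h.eqv_last
  · exact hincon i z (h.incon_last i)
  · by_cases hij : i < j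
    · have h1 : c' i = Sum.inl ∘ Sum.inl ∘ c i := if_pos hij
      rw [h1]
      exact hincon i' (c i) (h.incon i hij i' hii)
    · have h1 : c' i = Sum.inl ∘ Sum.inr ∘ z := if_neg hij
      have h2 : g ∘ prependIdx (j + 1) b' i' = Sum.map Sum.inr id ∘ prependIdx j b i' := by
        rw [hb, prependIdx, if_neg (by omega)]
        rfl
      have h3 := (hV3.restrict (Sum.elim (prependIdx j b i') (Sum.inl ∘ z)) _ hΦ).2
        (h.incon_last i')
      rw [h1]
      rw [rs_rs, Sum.comp_elim] at h3 ⊢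
      rwa [h2]
  · by_cases hnj : n ≤ j
    · have h1 := (hV1.restrict (Sum.map (pre (switchIdx n b c) j) z)).restrict (splitLast j)
      rw [tens_rs, hQz] at h1
      have h2 : D.Eqv (rs Q (pre (switchIdx n b c) j)) (pw q j) :=
        (hQU.restrict _).trans (h.eqv_switch n hnj)
      refine Eqv.trans (Eqv.of_eq ?_) (h1.trans ((h2.prod q).restrict (splitLast j)))
      rw [rs_rs, rs_rs, rs_rs, pre_succ]
      congr 1
      ext1 p
      change g (Sum.inl (Sum.elim _ _ (splitLast j p))) =
        Sum.inl (Sum.map _ _ (splitLast j p))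
      rcases splitLast j p with ⟨i, t⟩ | t
      · by_cases hin : (i : ℕ) < n <;> simp [pre, switchIdx, b', c', g, hin]
      · simp [switchIdx, c', g, hnj.not_gt]
    · obtain rfl : n = j + 1 := by omega
      have h1 : Sum.inl ∘ pre (switchIdx (j + 1) b' c') (j + 1) =
          pre (prependIdx (j + 1) b') (j + 1) := by
        ext1 ⟨i, t⟩
        simp only [pre, switchIdx, prependIdx, i.2, Function.comp_apply, if_true]
      rw [h1]
      exact hpre (j + 1)

theorem exists_ladder (hD : ¬ D.HasBinaryPattern) [Finite υ]
    {Φ : Set (ξ ⊕ υ → M)} {q s : Ultrafilter (υ → M)} (hq : D.AdmAll q) (hqs : D.Eqv q s)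
    (hΦ : D.IsDef (Incon Φ)) (hs : Incon Φ ∈ tens q s) (j : ℕ) :
    ∃ (θ : Type) (_ : Finite θ) (z : υ → θ) (b c : ℕ → υ → θ)
      (U : Ultrafilter (θ ⊕ (ℕ × υ) → M)), D.Ladder Φ q j z b c U := by
  induction j with
  | zero =>
    obtain ⟨U, hU⟩ := exists_ladder_zero hqs hΦ hs
    exact ⟨υ, inferInstance, _, _, _, U, hU⟩
  | succ j ih =>
    obtain ⟨θ, _, z, b, c, U, hU⟩ := ih
    obtain ⟨z', b', c', U', hU'⟩ := hU.exists_succ hD hq hΦ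
    exact ⟨_, inferInstance, z', b', c', U', hU'⟩

theorem hasBinaryPattern_of_eqv [Finite ξ] [Finite υ] {Φ : Set (ξ ⊕ υ → M)} (hΦ : D.IsDef Φ)
    {r s : Ultrafilter (υ → M)} (hrs : D.Eqv r s) (hr : ∀ k, Con Φ k ∈ pw r k)
    (hs : Incon Φ ∈ tens s s) : D.HasBinaryPattern := by
  by_contra hD
  obtain ⟨q, hqs, hq⟩ := exists_admAll (D := D) s
  have hqr : D.Eqv r q := hrs.trans hqs.symm
  have hcon : ∀ k, Con Φ k ∈ pw q k := by
    by_contra! ⟨K, hK⟩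
    obtain ⟨k, hk⟩ := exists_forall_con_notMem_ch hD hq hΦ hK
    exact hk (fun _ => r) (fun _ => hqr) (hr k)
  have hΦ' := DefinableFamily.incon hΦ
  refine hD (hasBinaryPattern_of_sequences hΦ fun N => ?_)
  obtain ⟨θ, _, z, b, c, U, hU⟩ := exists_ladder hD hq hqs hΦ' ((hqs.prod s _ hΦ').2 hs) N
  have h1 : ∀ᶠ v in (U : Filter (θ ⊕ (ℕ × υ) → M)), ∀ i i' : Fin N, i ≤ i' →
      v ∘ Sum.elim (prependIdx N b i') (Sum.inl ∘ c i) ∈ Incon Φ :=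
    eventually_all.2 fun i => eventually_all.2 fun i' => by
      by_cases hi : i ≤ i'
      · filter_upwards [hU.incon i i.2 i' hi] with v hv _ using hv
      · exact Eventually.of_forall fun v hv => absurd hv hi
  have h2 : ∀ᶠ v in (U : Filter (θ ⊕ (ℕ × υ) → M)), ∀ n : Fin (N + 1),
      v ∘ Sum.inl ∘ pre (switchIdx n b c) N ∈ Con Φ N :=
    eventually_all.2 fun n =>
      (hU.eqv_switch n (Nat.lt_succ_iff.1 n.2) _ (con hΦ N)).2 (hcon N)
  obtain ⟨v, hv1, hv2⟩ := (h1.and h2).exists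
  refine ⟨fun i => v ∘ Sum.inl ∘ b i, fun i => v ∘ Sum.inl ∘ c i, fun i i' hi hi' => ?_,
    fun n hn => ?_⟩
  · have h3 := hv1 ⟨i, hi.trans_lt hi'⟩ ⟨i', hi'⟩ hi
    rw [Sum.comp_elim] at h3
    simpa only [prependIdx, hi', if_true] using h3
  · obtain ⟨x, hx⟩ := hv2 ⟨n, Nat.lt_succ_iff.2 hn⟩
    refine ⟨x, fun i hi => ?_, fun i hi hni => ?_⟩
    · have h3 := hx ⟨i, by omega⟩
      simpa [pre, switchIdx, hi, Function.comp_def] using h3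
    · have h3 := hx ⟨i, hi⟩
      simpa [pre, switchIdx, hni.not_gt, Function.comp_def] using h3

end DefinableFamily
end

theorem exists_finset_realize_iff {L : FirstOrder.Language.{v, w}} {M : Type u} [L.Structure M]
    {α : Type} (φ : L.Formula α) : ∃ (F : Finset α) (φ₀ : L.Formula F),
      ∀ v : α → M, φ.Realize v ↔ φ₀.Realize fun i : F => v i := by
  classical
  refine ⟨φ.freeVarFinset, φ.restrictFreeVar id, fun v => ?_⟩
  exact (FirstOrder.Language.BoundedFormula.realize_restrictFreeVar (f := id) v
    (fun _ => rfl)).symm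

/-- The sets definable with parameters in a first-order structure. -/
def DefinableFamily.ofStructure (L : FirstOrder.Language.{0, 0}) (M : Type u) [L.Structure M] :
    DefinableFamily M where
  IsDef S := (Set.univ : Set M).Definable L S
  univ := Set.definable_univ
  inter hS hT := hS.inter hT
  compl hS := hS.compl
  reindex f _ hS := hS.preimage_comp f
  proj hS := hS.exists_of_finite
  fiber := by
    intro α β S w hS
    obtain ⟨φ, rfl⟩ := Set.definable_iff_exists_formula_sum.1 hS
    refine Set.definable_iff_exists_formula_sum.2 ⟨φ.relabel
      (Sum.elim Sum.inl (Sum.elim Sum.inr fun i => Sum.inl ⟨w i, trivial⟩)), ?_⟩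
    ext v
    refine Iff.trans (iff_of_eq (congrArg φ.Realize ?_))
      FirstOrder.Language.Formula.realize_relabel.symm
    ext (i | i | i) <;> rfl
  diag := ⟨(FirstOrder.Language.Term.var true).equal (FirstOrder.Language.Term.var false), by
    ext v
    exact (FirstOrder.Language.Formula.realize_equal (L := L.withConstants (Set.univ : Set M))
      (t₁ := .var true) (t₂ := .var false) (x := v)).symm⟩
  support := by
    intro α S hS
    obtain ⟨φ, rfl⟩ := hS
    obtain ⟨F, φ₀, h⟩ := exists_finset_realize_iff (M := M) φ
    exact ⟨F, _, ⟨φ₀, rfl⟩, Set.ext h⟩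

theorem DefinableFamily.isDef_ofStructure {L : FirstOrder.Language.{0, 0}} {M : Type u}
    [L.Structure M] {α : Type} {S : Set (α → M)} (hS : (ofStructure L M).IsDef S) :
    ∃ (p : ℕ) (φ : L.Formula (α ⊕ Fin p)) (c : Fin p → M),
      S = {v | φ.Realize (Sum.elim v c)} := by
  obtain ⟨A, -, hA⟩ := Set.definable_iff_finitely_definable.1 hS
  obtain ⟨φ, rfl⟩ := Set.definable_iff_exists_formula_sum.1 hA
  refine ⟨A.card, φ.relabel (Sum.elim (fun a => Sum.inr (A.equivFin a)) Sum.inl),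
    fun i => A.equivFin.symm i, ?_⟩
  ext v
  refine Iff.trans (iff_of_eq (congrArg φ.Realize ?_))
    FirstOrder.Language.Formula.realize_relabel.symm
  ext (i | i)
  · simp
  · rfl

theorem exists_right_turns (η : List Bool) {i : ℕ} (c : List Bool → Set (Fin i)) :
    ∃ l r η₁ : List Bool, l = η₁ ++ [true] ∧ η <+: η₁ ∧ η₁ ++ [false] <+: r ∧ c l = c r := by
  obtain ⟨a, b, hab, h⟩ := Finite.exists_ne_map_eq_of_infinite
    fun a : ℕ => c (η ++ List.replicate a false ++ [true])
  wlog hlt : a < b generalizing a b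
  · exact this b a hab.symm h.symm (by omega)
  refine ⟨_, _, η ++ List.replicate a false, rfl, List.prefix_append _ _, ?_, h⟩
  obtain ⟨d, rfl⟩ := Nat.exists_eq_add_of_lt hlt
  refine ⟨List.replicate d false ++ [true], ?_⟩
  rw [show a + d + 1 = a + (1 + d) by omega, List.replicate_add, List.replicate_add]
  simp

/-- The first `i` entries of a sequence of pairs of nodes, padded with the root. -/
def trunc (i : ℕ) (node : ℕ → Bool → List Bool) : ℕ → Bool → List Bool :=
  fun j => if j < i then node j else fun _ => []

theorem exists_node_sequence (test : ℕ → (ℕ → Bool → List Bool) → List Bool → Prop) :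
    ∃ node : ℕ → Bool → List Bool,
      (∀ i j, i ≤ j → node i false <+: node j false) ∧
      (∀ i j, i < j → ∃ η₁, node i true = η₁ ++ [true] ∧ η₁ ++ [false] <+: node j true) ∧
      ∀ i n, n < i →
        (test n (trunc i node) (node i true) ↔ test n (trunc i node) (node i false)) := by
  choose l r η₁ h₁ h₂ h₃ h₄ using fun (i : ℕ) (h : ℕ → Bool → List Bool) (η : List Bool) =>
    exists_right_turns η fun ν => {n : Fin i | test n h ν}
  let st : ℕ → List Bool × (ℕ → Bool → List Bool) := Nat.rec ([], fun _ _ => []) fun i s =>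
    (r i s.2 s.1, Function.update s.2 i fun b => cond b (l i s.2 s.1) (r i s.2 s.1))
  let node : ℕ → Bool → List Bool := fun i b =>
    cond b (l i (st i).2 (st i).1) (r i (st i).2 (st i).1)
  have htr : ∀ i, (st i).2 = trunc i node := by
    intro i
    induction i with
    | zero => rfl
    | succ i ih =>
      change Function.update (st i).2 i (node i) = _
      rw [ih]
      ext1 j
      rcases eq_or_ne j i with rfl | hj
      · simp [trunc]
      · rw [Function.update_of_ne hj]
        simp only [trunc, show j < i + 1 ↔ j < i by omega]
  have hη₁ : ∀ i, η₁ i (st i).2 (st i).1 <+: node i false := fun i =>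
    (List.prefix_append _ _).trans (h₃ i _ _)
  have hst : ∀ i j, i ≤ j → (st i).1 <+: (st j).1 := fun i j hij => by
    induction j, hij using Nat.le_induction with
    | base => exact List.prefix_rfl
    | succ j _ ih => exact ih.trans ((h₂ j _ _).trans (hη₁ j))
  refine ⟨node, fun i j hij => hst (i + 1) (j + 1) (by omega), fun i j hij => ?_, fun i n hn => ?_⟩
  · refine ⟨η₁ i (st i).2 (st i).1, h₁ _ _ _, (h₃ i _ _).trans ((hst (i + 1) j hij).trans ?_)⟩
    refine (h₂ j (st j).2 _).trans ?_
    change _ <+: l j (st j).2 (st j).1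
    rw [h₁]
    exact List.prefix_append _ _
  · rw [← htr]
    exact iff_of_eq (congrArg (fun S : Set (Fin i) => (⟨n, hn⟩ : Fin i) ∈ S)
      (h₄ i (st i).2 (st i).1))

theorem countable_symbols_sum_skolem (L : FirstOrder.Language.{0, 0}) [Countable L.Symbols] :
    Countable (L.sum L.skolem₁).Symbols := by
  have h₁ : ∀ n, Countable (L.Functions n) := fun n =>
    Function.Injective.countable (f := fun x => (Sum.inl ⟨n, x⟩ : L.Symbols))
      fun x y h => by simpa using h
  have h₂ : ∀ n, Countable (L.Relations n) := fun n =>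
    Function.Injective.countable (f := fun x => (Sum.inr ⟨n, x⟩ : L.Symbols))
      fun x y h => by simpa using h
  have h₃ : ∀ n, Countable (L.BoundedFormula Empty n) := fun n =>
    Function.Injective.countable
      (f := fun x => (⟨n, x⟩ : Σ n, L.BoundedFormula Empty n)) fun x y h => by simpa using h
  have h₄ : ∀ n, Countable ((L.sum L.skolem₁).Functions n) := fun n =>
    inferInstanceAs (Countable (L.Functions n ⊕ L.BoundedFormula Empty (n + 1)))
  have h₅ : ∀ n, Countable ((L.sum L.skolem₁).Relations n) := fun n =>
    inferInstanceAs (Countable (L.Relations n ⊕ Empty))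
  exact inferInstanceAs (Countable ((Σ n, (L.sum L.skolem₁).Functions n) ⊕
    (Σ n, (L.sum L.skolem₁).Relations n)))

theorem exists_elementarySubstructure_eventually_iff (L : FirstOrder.Language.{0, 0})
    [Countable L.Symbols] {𝕄 : Type u} [L.Structure 𝕄] [Nonempty 𝕄] {m : ℕ}
    (b : List Bool → Fin m → 𝕄) :
    ∃ (node : ℕ → Bool → List Bool) (M : L.ElementarySubstructure 𝕄) (e : Bool → ℕ → Fin m → M),
      (∀ i j, i ≤ j → node i false <+: node j false) ∧
      (∀ i j, i < j → ∃ η₁, node i true = η₁ ++ [true] ∧ η₁ ++ [false] <+: node j true) ∧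
      (∀ c i x, (e c i x : 𝕄) = b (node i c) x) ∧
      ∀ S, (DefinableFamily.ofStructure L M).IsDef S →
        ∀ᶠ i in atTop, (e true i ∈ S ↔ e false i ∈ S) := by
  have := countable_symbols_sum_skolem L
  obtain ⟨ψ, hψ⟩ := exists_surjective_nat ((L.sum L.skolem₁).Formula ((ℕ × Bool × Fin m) ⊕ Fin m))
  obtain ⟨node, h₁, h₂, h₃⟩ := exists_node_sequence fun n h ν =>
    (ψ n).Realize (Sum.elim (fun p : ℕ × Bool × Fin m => b (h p.1 p.2.1) p.2.2) (b ν))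
  let val : ℕ × Bool × Fin m → 𝕄 := fun p => b (node p.1 p.2.1) p.2.2
  let M := Substructure.elementarySkolem₁Reduct (L := L)
    (Substructure.closure (L.sum L.skolem₁) (Set.range val))
  have hM : ∀ p, val p ∈ M := fun p => Substructure.subset_closure (Set.mem_range_self p)
  refine ⟨node, M, fun c i x => ⟨val (i, c, x), hM _⟩, h₁, h₂, fun _ _ _ => rfl, fun S hS => ?_⟩
  obtain ⟨p, φ, c, rfl⟩ := DefinableFamily.isDef_ofStructure hS
  have ht : ∀ q, ∃ t : (L.sum L.skolem₁).Term (ℕ × Bool × Fin m), t.realize val = c q := by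
    intro q
    obtain ⟨t, ht⟩ := Substructure.mem_closure_iff_exists_term.1 (c q).2
    refine ⟨t.relabel fun y => y.2.choose, ?_⟩
    rw [Term.realize_relabel, ← ht]
    congr 1
    ext y
    exact y.2.choose_spec
  choose t ht using ht
  let χ : (L.sum L.skolem₁).Formula ((ℕ × Bool × Fin m) ⊕ Fin m) :=
    BoundedFormula.subst (LHom.sumInl.onFormula φ)
      (Sum.elim (fun x => Term.var (Sum.inr x)) fun q => (t q).relabel Sum.inl)
  have hχ : ∀ v : Fin m → M, φ.Realize (Sum.elim v c) ↔
      χ.Realize (Sum.elim val fun x => (v x : 𝕄)) := by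
    intro v
    rw [← M.subtype.map_formula, Sum.comp_elim]
    change _ ↔ BoundedFormula.Realize _ _ _
    rw [BoundedFormula.realize_subst]
    change _ ↔ (LHom.sumInl.onFormula φ).Realize _
    rw [LHom.realize_onFormula]
    refine iff_of_eq (congrArg φ.Realize ?_)
    ext (x | q)
    · rfl
    · change (c q : 𝕄) = _
      rw [← ht q]
      exact (Term.realize_relabel (t := t q) (g := Sum.inl)
        (v := Sum.elim val fun x => (v x : 𝕄))).symm
  obtain ⟨n, hn⟩ := hψ χ
  rw [← hn] at hχ
  obtain ⟨F, χ₀, hχ₀⟩ := exists_finset_realize_iff (M := 𝕄) (ψ n)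
  have hF : ∀ᶠ i in atTop, ∀ q ∈ F, ∀ y, q = Sum.inl y → y.1 < i := by
    rw [Filter.eventually_all_finset]
    rintro (y | x) -
    · filter_upwards [eventually_gt_atTop y.1] with i hi
      rintro _ ⟨⟩
      exact hi
    · exact Eventually.of_forall fun i y h => by cases h
  filter_upwards [hF, eventually_gt_atTop n] with i hi hni
  have htr : ∀ v : Fin m → 𝕄, (ψ n).Realize (Sum.elim val v) ↔ (ψ n).Realize
      (Sum.elim (fun p : ℕ × Bool × Fin m => b (trunc i node p.1 p.2.1) p.2.2) v) := by
    intro v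
    rw [hχ₀, hχ₀]
    refine iff_of_eq (congrArg χ₀.Realize ?_)
    ext ⟨y | x, hq⟩
    · change b _ _ = b _ _
      rw [trunc, if_pos (hi _ hq y rfl)]
    · rfl
  change φ.Realize _ ↔ φ.Realize _
  rw [hχ, hχ, htr, htr]
  exact h₃ i n hni

theorem exists_formula_exists_forall (L : FirstOrder.Language.{v, w}) {ξ τ κ : Type}
    [Finite ξ] [Finite κ]
    (χ : L.Formula (ξ ⊕ τ)) : ∃ Ψ : L.Formula (κ × τ),
      ∀ {M : Type u} [L.Structure M] (u : κ × τ → M),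
        Ψ.Realize u ↔ ∃ x : ξ → M, ∀ l, χ.Realize (Sum.elim x fun t => u (l, t)) := by
  refine ⟨(Formula.iInf fun l => χ.relabel (Sum.elim Sum.inr fun t => Sum.inl (l, t))).iExs ξ,
    fun {M} _ u => ?_⟩
  rw [Formula.realize_iExs]
  refine exists_congr fun x => ?_
  rw [Formula.realize_iInf]
  refine forall_congr' fun l => ?_
  rw [Formula.realize_relabel, Sum.comp_elim]
  rfl

/-- The nodes along a common branch of a sequence of nested nodes. -/
theorem exists_branch {η : ℕ → List Bool} (hη : ∀ i j, i ≤ j → η i <+: η j) (N : ℕ) :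
    ∃ σ : ℕ → Bool, ∀ i ≤ N, List.ofFn (fun l : Fin (η i).length => σ l) = η i := by
  refine ⟨fun l => (η N).getD l false, fun i hi => ?_⟩
  obtain ⟨t, ht⟩ := hη i N hi
  rw [← ht]
  refine List.ext_getElem (by simp) fun l h₁ h₂ => ?_
  simp [List.getElem?_append_left h₂, List.getElem?_eq_getElem h₂]

theorem exists_hasBinaryPattern (L : FirstOrder.Language.{0, 0}) [Countable L.Symbols]
    {𝕄 : Type u} [L.Structure 𝕄] [Nonempty 𝕄] {k m : ℕ} (φ : L.Formula (Fin k ⊕ Fin m))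
    (b : List Bool → Fin m → 𝕄)
    (hbranch : ∀ σ : ℕ → Bool, ∃ a : Fin k → 𝕄,
      ∀ n : ℕ, φ.Realize (Sum.elim a (b (List.ofFn fun i : Fin n => σ i))))
    (hincon : ∀ η₁ η₂ : List Bool, (η₁ ++ [false]) <+: η₂ →
      ¬ ∃ a : Fin k → 𝕄, φ.Realize (Sum.elim a (b η₂)) ∧
        φ.Realize (Sum.elim a (b (η₁ ++ [true])))) :
    ∃ M : L.ElementarySubstructure 𝕄, (DefinableFamily.ofStructure L M).HasBinaryPattern := by
  obtain ⟨node, M, e, h₁, h₂, he, hE⟩ := exists_elementarySubstructure_eventually_iff L b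
  have he' : ∀ c i, (fun x => (e c i x : 𝕄)) = b (node i c) := fun c i => funext (he c i)
  refine ⟨M, DefinableFamily.hasBinaryPattern_of_eqv (Φ := {v | φ.Realize v})
    (r := (hyperfilter ℕ).map (e false)) (s := (hyperfilter ℕ).map (e true)) ?_ ?_ ?_ ?_⟩
  · exact Set.empty_definable_iff.2 ⟨φ, rfl⟩ |>.mono (Set.empty_subset _)
  · intro S hS
    have : ∀ᶠ i in (hyperfilter ℕ : Filter ℕ), (e false i ∈ S ↔ e true i ∈ S) :=
      Nat.hyperfilter_le_atTop ((hE S hS).mono fun i hi => hi.symm)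
    exact Filter.eventually_congr this
  · intro K
    have hr : ∀ c : Fin K, ∀ᶠ u : Fin K × Fin m → M in
        (pw ((hyperfilter ℕ).map (e false)) K : Filter (Fin K × Fin m → M)),
        (fun t => u (c, t)) ∈ Set.range (e false) := by
      intro c
      change Set.range (e false) ∈ rs _ (Prod.mk c)
      rw [DefinableFamily.rs_ch_coord]
      exact Filter.Eventually.of_forall (f := (hyperfilter ℕ : Filter ℕ)) fun i =>
        Set.mem_range_self i
    filter_upwards [Filter.eventually_all.2 hr] with u hu
    choose i hi using hu
    obtain ⟨N, hN⟩ := Set.finite_range i |>.bddAbove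
    obtain ⟨σ, hσ⟩ := exists_branch h₁ N
    obtain ⟨a, ha⟩ := hbranch σ
    obtain ⟨Ψ, hΨ⟩ := exists_formula_exists_forall.{u} (κ := Fin K) L φ
    refine (hΨ u).1 ((M.subtype.map_formula Ψ u).1 ((hΨ _).2 ⟨a, fun c => ?_⟩))
    have := ha (node (i c) false).length
    rw [hσ (i c) (hN (Set.mem_range_self c)), ← he', hi c] at this
    exact this
  · refine Filter.Eventually.of_forall (f := (hyperfilter ℕ : Filter ℕ)) fun i => ?_
    refine Nat.hyperfilter_le_atTop ((eventually_gt_atTop i).mono fun j hij => ?_)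
    rintro ⟨x, hx₁, hx₂⟩
    obtain ⟨η₁, hη₁, hη₂⟩ := h₂ i j hij
    refine hincon η₁ _ hη₂ ⟨fun t => x t, ?_, ?_⟩
    · rw [← he']
      have := (M.subtype.map_formula φ _).2 hx₁
      rwa [Sum.comp_elim] at this
    · rw [← hη₁, ← he']
      have := (M.subtype.map_formula φ _).2 hx₂
      rwa [Sum.comp_elim] at this

/-- The finite binary trees of every height are realized by instances of `χ` for which the
branches are consistent and incomparable nodes are inconsistent. -/
def HasFiniteTrees (L : FirstOrder.Language.{v, w}) {M : Type u} [L.Structure M] {k m : ℕ}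
    (χ : L.Formula (Fin k ⊕ Fin m)) : Prop :=
  ∀ N : ℕ, ∃ b : List Bool → Fin m → M,
    (∀ σ : List Bool, σ.length ≤ N → ∃ x : Fin k → M, ∀ l, χ.Realize (Sum.elim x (b (σ.take l)))) ∧
    ∀ η η' : List Bool, η.length ≤ N → η'.length ≤ N → ¬ η <+: η' → ¬ η' <+: η →
      ¬ ∃ x : Fin k → M, χ.Realize (Sum.elim x (b η)) ∧ χ.Realize (Sum.elim x (b η'))

theorem exists_hasFiniteTrees {L : FirstOrder.Language.{0, 0}} {𝕄 : Type u} [L.Structure 𝕄]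
    (M : L.ElementarySubstructure 𝕄) (hM : (DefinableFamily.ofStructure L M).HasBinaryPattern) :
    ∃ (k m : ℕ) (χ : L.Formula (Fin k ⊕ Fin m)), HasFiniteTrees L (M := 𝕄) χ := by
  obtain ⟨ξ, υ, hξ, hυ, Θ, hΘ, hM⟩ := hM
  obtain ⟨p, φ, c, rfl⟩ := DefinableFamily.isDef_ofStructure hΘ
  obtain ⟨k, ⟨f⟩⟩ := Finite.exists_equiv_fin ξ
  obtain ⟨m, ⟨g⟩⟩ := Finite.exists_equiv_fin (υ ⊕ Fin p)
  let χ : L.Formula (Fin k ⊕ Fin m) := φ.relabel (Sum.elim (Sum.elim (Sum.inl ∘ f)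
    (Sum.inr ∘ g ∘ Sum.inl)) (Sum.inr ∘ g ∘ Sum.inr))
  have hχ : ∀ (x : Fin k → M) (b : υ → M), χ.Realize (Sum.elim x (Sum.elim b c ∘ g.symm)) ↔
      φ.Realize (Sum.elim (Sum.elim (x ∘ f) b) c) := by
    intro x b
    rw [Formula.realize_relabel]
    refine iff_of_eq (congrArg φ.Realize ?_)
    ext ((i | i) | i) <;> simp
  refine ⟨k, m, χ, fun N => ?_⟩
  obtain ⟨b, hb₁, hb₂⟩ := hM N
  refine ⟨fun η => Subtype.val ∘ Sum.elim (b η) c ∘ g.symm, fun σ hσ => ?_,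
    fun η η' hη hη' h h' => ?_⟩
  · obtain ⟨x, hx⟩ := hb₁ σ hσ
    refine ⟨fun i => x (f.symm i), fun l => ?_⟩
    have := (M.subtype.map_formula χ _).2 ((hχ (x ∘ f.symm) (b (σ.take l))).2 (by
      rw [Function.comp_assoc, Equiv.symm_comp_self]; exact hx l))
    rwa [Sum.comp_elim] at this
  · rintro ⟨x, hx, hx'⟩
    obtain ⟨Ψ, hΨ⟩ := exists_formula_exists_forall.{u} (κ := Bool) L χ
    let u : Bool × Fin m → M := fun q => (Sum.elim (b (cond q.1 η η')) c ∘ g.symm) q.2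
    obtain ⟨y, hy⟩ := (hΨ u).1 ((M.subtype.map_formula Ψ u).1 ((hΨ _).2 ⟨x, fun l => by
      cases l
      · exact hx'
      · exact hx⟩))
    exact hb₂ η η' hη hη' h h' ⟨y ∘ f, (hχ y (b η)).1 (hy true), (hχ y (b η')).1 (hy false)⟩

/-- A relational language for a single relation and its substitution instances. -/
def relLang (ι : Type) : FirstOrder.Language.{0, 0} := ⟨fun _ => Empty, fun n => ι → Fin n⟩

instance (ι : Type) [Finite ι] : Countable (relLang ι).Symbols :=
  inferInstanceAs (Countable ((Σ _ : ℕ, Empty) ⊕ (Σ n : ℕ, ι → Fin n)))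

/-- The structure interpreting the relation by the solution set of a formula. -/
@[reducible]
def relStructure {L : FirstOrder.Language.{v, w}} {M : Type u} [L.Structure M] {ι : Type}
    (φ : L.Formula ι) : (relLang ι).Structure M where
  funMap f := Empty.elim f
  RelMap {_} (f : ι → Fin _) xs := φ.Realize (xs ∘ f)

theorem exists_relLang_formula {L : FirstOrder.Language.{v, w}} {M : Type u} [L.Structure M]
    {ι : Type} [Finite ι] (φ : L.Formula ι) :
    let := relStructure (M := M) φ
    ∃ φ' : (relLang ι).Formula ι, ∀ v : ι → M, φ'.Realize v ↔ φ.Realize v := by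
  let := relStructure (M := M) φ
  obtain ⟨n, ⟨f⟩⟩ := Finite.exists_equiv_fin ι
  let R : (relLang ι).Relations n := (f : ι → Fin n)
  refine ⟨R.formula fun i => Term.var (f.symm i), fun v => ?_⟩
  rw [Formula.realize_rel]
  refine iff_of_eq (congrArg φ.Realize ?_)
  ext i
  exact congrArg v (f.symm_apply_apply i)

theorem exists_formula_of_relLang {L : FirstOrder.Language.{v, w}} {M : Type u} [L.Structure M]
    {ι : Type} (φ : L.Formula ι) {α : Type} {n : ℕ} (ψ : (relLang ι).BoundedFormula α n) :
    let := relStructure (M := M) φ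
    ∃ ψ' : L.BoundedFormula α n, ∀ (v : α → M) (xs : Fin n → M),
      ψ'.Realize v xs ↔ ψ.Realize v xs := by
  let := relStructure (M := M) φ
  have hvar : ∀ {n : ℕ} (t : (relLang ι).Term (α ⊕ Fin n)), ∃ i, t = Term.var i := by
    rintro n (i | f)
    · exact ⟨i, rfl⟩
    · exact f.elim
  induction ψ with
  | falsum => exact ⟨⊥, fun v xs => Iff.rfl⟩
  | equal t₁ t₂ =>
    obtain ⟨i, rfl⟩ := hvar t₁
    obtain ⟨j, rfl⟩ := hvar t₂
    exact ⟨.equal (.var i) (.var j), fun v xs => Iff.rfl⟩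
  | @rel n l R ts =>
    choose i hi using fun j => hvar (ts j)
    refine ⟨BoundedFormula.relabel (n := n) (k := 0) (fun j => i (R j)) φ, fun v xs => ?_⟩
    refine (BoundedFormula.realize_relabel (m := n) (n := 0) (xs := xs)).trans ?_
    change _ ↔ BoundedFormula.Realize φ _ default
    refine iff_of_eq (congrArg₂ (BoundedFormula.Realize φ) ?_ (Subsingleton.elim _ _))
    ext j
    change _ = (ts (R j)).realize (Sum.elim v xs)
    rw [hi]
    rfl
  | imp _ _ ih₁ ih₂ =>
    obtain ⟨ψ₁, h₁⟩ := ih₁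
    obtain ⟨ψ₂, h₂⟩ := ih₂
    exact ⟨ψ₁.imp ψ₂, fun v xs => imp_congr (h₁ v xs) (h₂ v xs)⟩
  | all _ ih =>
    obtain ⟨ψ, h⟩ := ih
    exact ⟨ψ.all, fun v xs => forall_congr' fun x => h v _⟩

section

open NSOP2Paper

variable {L : FirstOrder.Language.{u, u}} {𝕄 : Type u} [L.Structure 𝕄] {κ : Cardinal.{u}}

theorem _root_.NSOP2Paper.IsSaturated.exists_forall_realize (hsat : IsSaturated L 𝕄 κ)
    (hκ : Cardinal.aleph0 < κ) {α : Type u} (hα : Cardinal.mk α < κ) {G : ℕ → Set (α → 𝕄)}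
    (hG : Antitone G) (hne : ∀ N, (G N).Nonempty) :
    ∃ b : α → 𝕄, ∀ (γ : L.Formula α) (N : ℕ), (∀ v ∈ G N, γ.Realize v) → γ.Realize b := by
  have hinl : ∀ (γ : L.Formula α) (v : α → 𝕄),
      (γ.relabel (Sum.inl : α → α ⊕ Fin 0)).Realize (Sum.elim v Fin.elim0) ↔ γ.Realize v := by
    intro γ v
    rw [Formula.realize_relabel, Sum.elim_comp_inl]
  obtain ⟨b, hb⟩ := hsat α ∅ hα (by simpa using Cardinal.aleph0_pos.trans hκ)
    {p | ∃ (γ : L.Formula α) (N : ℕ), (∀ v ∈ G N, γ.Realize v) ∧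
      p = ⟨0, γ.relabel Sum.inl, Fin.elim0⟩}
    (by rintro _ ⟨γ, N, -, rfl⟩ i; exact i.elim0) (by
      intro t ht
      have : ∀ᶠ N in atTop, ∀ p ∈ t, ∀ v ∈ G N, p.2.1.Realize (Sum.elim v p.2.2) := by
        rw [Filter.eventually_all_finset]
        intro p hp
        obtain ⟨γ, N, hγ, rfl⟩ := ht hp
        filter_upwards [eventually_ge_atTop N] with N' hN' v hv
        exact (hinl γ v).2 (hγ v (hG hN' hv))
      obtain ⟨N, hN⟩ := this.exists
      obtain ⟨v, hv⟩ := hne N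
      exact ⟨v, fun p hp => hN p hp v hv⟩)
  exact ⟨b, fun γ N hγ => (hinl γ b).1 (hb _ ⟨γ, N, hγ, rfl⟩)⟩

theorem _root_.NSOP2Paper.IsSaturated.exists_forall_instance (hsat : IsSaturated L 𝕄 κ)
    (hκ : Cardinal.aleph0 < κ) {k m : ℕ} (χ : L.Formula (Fin k ⊕ Fin m)) (c : ℕ → Fin m → 𝕄)
    (h : ∀ N, ∃ x : Fin k → 𝕄, ∀ n ≤ N, χ.Realize (Sum.elim x (c n))) :
    ∃ x : Fin k → 𝕄, ∀ n, χ.Realize (Sum.elim x (c n)) := by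
  let χ' : L.Formula (ULift.{u} (Fin k) ⊕ Fin m) := χ.relabel (Sum.map ULift.up id)
  have hχ' : ∀ (x : ULift.{u} (Fin k) → 𝕄) (d : Fin m → 𝕄),
      χ'.Realize (Sum.elim x d) ↔ χ.Realize (Sum.elim (x ∘ ULift.up) d) := by
    intro x d
    rw [Formula.realize_relabel, Sum.elim_comp_map, Function.comp_id]
  obtain ⟨x, hx⟩ := hsat (ULift (Fin k)) (Set.range fun p : ℕ × Fin m => c p.1 p.2)
    ((Cardinal.mk_lt_aleph0).trans hκ)
    (((Set.countable_range _).le_aleph0).trans_lt hκ)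
    (Set.range fun n => ⟨m, χ', c n⟩) (by
      rintro _ ⟨n, rfl⟩ i
      exact ⟨(n, i), rfl⟩) (by
      intro t ht
      have : ∀ᶠ N in atTop, ∀ p ∈ t, ∃ n ≤ N, p = ⟨m, χ', c n⟩ := by
        rw [Filter.eventually_all_finset]
        intro p hp
        obtain ⟨n, rfl⟩ := ht hp
        filter_upwards [eventually_ge_atTop n] with N hN
        exact ⟨n, hN, rfl⟩
      obtain ⟨N, hN⟩ := this.exists
      obtain ⟨x, hx⟩ := h N
      refine ⟨x ∘ ULift.down, fun p hp => ?_⟩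
      obtain ⟨n, hn, rfl⟩ := hN p hp
      exact (hχ' _ _).2 (hx n hn))
  exact ⟨x ∘ ULift.up, fun n => (hχ' _ _).1 (hx _ ⟨n, rfl⟩)⟩

theorem _root_.NSOP2Paper.IsSaturated.hasSOP2_of_hasFiniteTrees (hsat : IsSaturated L 𝕄 κ)
    (hκ : Cardinal.aleph0 < κ) {k m : ℕ} {χ : L.Formula (Fin k ⊕ Fin m)}
    (hχ : HasFiniteTrees L (M := 𝕄) χ) : HasSOP2 L 𝕄 := by
  let G : ℕ → Set (ULift.{u} (List Bool × Fin m) → 𝕄) := fun N => {v |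
    (∀ σ : List Bool, σ.length ≤ N → ∃ x : Fin k → 𝕄, ∀ l,
      χ.Realize (Sum.elim x fun t => v ⟨σ.take l, t⟩)) ∧
    ∀ η η' : List Bool, η.length ≤ N → η'.length ≤ N → ¬ η <+: η' → ¬ η' <+: η →
      ¬ ∃ x : Fin k → 𝕄, χ.Realize (Sum.elim x fun t => v ⟨η, t⟩) ∧
        χ.Realize (Sum.elim x fun t => v ⟨η', t⟩)}
  have hG : Antitone G := fun N N' h v hv => ⟨fun σ hσ => hv.1 σ (hσ.trans h),
    fun η η' hη hη' => hv.2 η η' (hη.trans h) (hη'.trans h)⟩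
  have hne : ∀ N, (G N).Nonempty := fun N => by
    obtain ⟨b, hb⟩ := hχ N
    exact ⟨fun p => b p.down.1 p.down.2, hb⟩
  obtain ⟨v, hv⟩ := hsat.exists_forall_realize hκ
    (α := ULift.{u} (List Bool × Fin m)) (Cardinal.mk_le_aleph0.trans_lt hκ) hG hne
  refine ⟨k, m, χ, fun η t => v ⟨η, t⟩, fun σ => ?_, fun η η' h h' => ?_⟩
  · refine hsat.exists_forall_instance hκ χ (fun n t => v ⟨List.ofFn fun i : Fin n => σ i, t⟩)
      fun N => ?_
    obtain ⟨Ψ, hΨ⟩ := exists_formula_exists_forall.{u} (κ := Fin (N + 1)) L χ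
    have := hv (Ψ.relabel fun p : Fin (N + 1) × Fin m =>
      ULift.up (List.ofFn (fun i : Fin p.1 => σ i), p.2)) N (by
        intro w hw
        rw [Formula.realize_relabel, hΨ]
        obtain ⟨x, hx⟩ := hw.1 (List.ofFn fun i : Fin N => σ i) (by simp)
        refine ⟨x, fun l => ?_⟩
        have := hx l
        rwa [show (List.ofFn fun i : Fin N => σ i).take l = List.ofFn fun i : Fin l => σ i by
          refine List.ext_getElem (by simp; omega) fun i h₁ h₂ => by simp] at this)
    rw [Formula.realize_relabel, hΨ] at this
    obtain ⟨x, hx⟩ := this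
    exact ⟨x, fun n hn => hx ⟨n, by omega⟩⟩
  · obtain ⟨Ψ, hΨ⟩ := exists_formula_exists_forall.{u} (κ := Bool) L χ
    have := hv (Ψ.relabel fun p : Bool × Fin m => ULift.up (cond p.1 η η', p.2)).not
      (max η.length η'.length) (by
        intro w hw
        rw [Formula.realize_not, Formula.realize_relabel, hΨ]
        rintro ⟨x, hx⟩
        exact hw.2 η η' (le_max_left _ _) (le_max_right _ _) h h' ⟨x, hx true, hx false⟩)
    rw [Formula.realize_not, Formula.realize_relabel, hΨ] at this
    rintro ⟨x, hx, hx'⟩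
    exact this ⟨x, fun l => by cases l <;> assumption⟩

end

end CanonicalCoheir

namespace NSOP2Paper

/-- **Main Theorem (Theorem 1.6).** Every complete first-order theory with
`NSOP₂` has `NSOP₁`; equivalently, if `T` has `SOP₁` then `T` has `SOP₂`.
Stated in a monster model `𝕄` of the complete theory `T = Th(𝕄)`. -/
theorem nsop2_implies_nsop1 (L : FirstOrder.Language.{u, u}) (𝕄 : Type u) [L.Structure 𝕄]
    (κ : Cardinal.{u}) (hmonster : IsMonster L 𝕄 κ)
    (hNSOP2 : ¬ HasSOP2 L 𝕄) : ¬ HasSOP1 L 𝕄 := by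
  rintro ⟨k, m, φ, b, hb₁, hb₂⟩
  obtain ⟨hκ, hsat, -⟩ := hmonster
  let := CanonicalCoheir.relStructure (M := 𝕄) φ
  obtain ⟨φ', hφ'⟩ := CanonicalCoheir.exists_relLang_formula (M := 𝕄) φ
  have hne : Nonempty 𝕄 := by
    by_contra hempty
    rw [not_nonempty_iff] at hempty
    obtain ⟨a, ha⟩ := hb₁ fun _ => true
    have h : ∀ η, φ.Realize (Sum.elim a (b η)) := fun η => Subsingleton.elim _ (b η) ▸ ha 0
    exact hb₂ [] [false] List.prefix_rfl ⟨a, h _, h _⟩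
  obtain ⟨M, hM⟩ := CanonicalCoheir.exists_hasBinaryPattern _ φ' b
    (by simpa only [hφ'] using hb₁) (by simpa only [hφ'] using hb₂)
  obtain ⟨k', m', χ, hχ⟩ := CanonicalCoheir.exists_hasFiniteTrees M hM
  obtain ⟨χ', hχ'⟩ := CanonicalCoheir.exists_formula_of_relLang (M := 𝕄) φ χ
  have : ∀ v, Formula.Realize χ' v ↔ χ.Realize v := fun v => hχ' v default
  exact hNSOP2 (hsat.hasSOP2_of_hasFiniteTrees hκ (χ := χ')
    (by simpa only [CanonicalCoheir.HasFiniteTrees, this] using hχ))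

end NSOP2Paper
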